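/- arXiv:1906.06354 — 2 statements merged into one kernel-verified Lean document; each statement's English description precedes it below -/
import Mathlib

section
/- Let n ≥ 1, 0 ≤ k ≤ n, and r ≥ 0 (r ≥ 1 in the second case). The pointwise-defined map (Φ^*)^{-1} ∘ (u_N *_{S^n}) ∘ Φ^* is a linear isomorphism from P_rΛ^k(T^n) onto P̊_{r+k+1}^-Λ^{n-k}(T^n), and also a linear isomorphism from P_r^-Λ^k(T^n) onto P̊_{r+k}Λ^{n-k}(T^n). -/
open scoped BigOperators
open MeasureTheory

noncomputable section

/-- Vectors in `ℝ^m`. -/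
abbrev Vec (m : ℕ) := Fin m → ℝ

/-- Differential `k`-forms on `ℝ^m`, given pointwise as alternating `k`-tensors. -/
abbrev Form (m k : ℕ) := Vec m → (Vec m [⋀^Fin k]→ₗ[ℝ] ℝ)

/-- A multivariate polynomial has (total) degree at most `r : ℤ`. -/
def degLE {m : ℕ} (r : ℤ) (p : MvPolynomial (Fin m) ℝ) : Prop :=
  ∀ d ∈ p.support, ((d.sum fun _ e => e : ℕ) : ℤ) ≤ r

/-- `P_rΛ^k(ℝ^m)`: differential `k`-forms with polynomial coefficients of degree at most `r`. -/
def PL (m k : ℕ) (r : ℤ) : Set (Form m k) :=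
  {α | ∀ v : Fin k → Vec m, ∃ p : MvPolynomial (Fin m) ℝ,
      degLE r p ∧ ∀ x, α x v = MvPolynomial.eval x p}

/-- Interior product with the radial vector field `X = Σ xᵢ ∂/∂xᵢ`. -/
def iU {m k : ℕ} (β : Form m (k + 1)) : Form m k := fun x => (β x).curryLeft x

/-- `P_r⁻Λ^k(ℝ^m) := i_X P_{r-1}Λ^{k+1}(ℝ^m)`. -/
def PLm (m k : ℕ) (r : ℤ) : Set (Form m k) := iU '' PL m (k + 1) (r - 1)

/-- The reflection negating the `i`-th coordinate, as a map. -/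
def reflFun (m : ℕ) (i : Fin m) (u : Vec m) : Vec m := fun j => if j = i then -u j else u j

/-- The reflection negating the `i`-th coordinate, as a linear map. -/
def reflLin (m : ℕ) (i : Fin m) : Vec m →ₗ[ℝ] Vec m :=
  LinearMap.pi fun j => if j = i then -LinearMap.proj j else LinearMap.proj j

/-- Pullback of an ambient form along the reflection `R_i`. -/
def reflPull (m k : ℕ) (i : Fin m) (α : Form m k) : Form m k :=
  fun x => (α (reflFun m i x)).compLinearMap (reflLin m i)

/-- A form on `ℝ^m` is even if it is invariant under all coordinate reflections. -/
def IsEven (m k : ℕ) (α : Form m k) : Prop := ∀ i, reflPull m k i α = α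

/-- A form on `ℝ^m` is odd if every coordinate reflection negates it. -/
def IsOdd (m k : ℕ) (α : Form m k) : Prop := ∀ i, reflPull m k i α = -α

/-- The map `Φ(u) = (u₁², …, u_m²)`. -/
def Phi (m : ℕ) (u : Vec m) : Vec m := fun i => u i ^ 2

/-- The differential of `Φ` at `u`. -/
def dPhi (m : ℕ) (u : Vec m) : Vec m →ₗ[ℝ] Vec m :=
  LinearMap.pi fun i => (2 * u i) • LinearMap.proj i

/-- Pullback of ambient forms along `Φ`. -/
def phiPull (m k : ℕ) (α : Form m k) : Form m k :=
  fun u => (α (Phi m u)).compLinearMap (dPhi m u)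

/-- The standard simplex `T^{m-1} ⊂ ℝ^m`. -/
def simplexSet (m : ℕ) : Set (Vec m) := {x | (∀ i, 0 ≤ x i) ∧ ∑ i, x i = 1}

/-- The unit sphere `S^{m-1} ⊂ ℝ^m`. -/
def sphereSet (m : ℕ) : Set (Vec m) := {u | ∑ i, u i ^ 2 = 1}

/-- The linear functional `v ↦ ⟨u, v⟩`. -/
def dotLin (m : ℕ) (u : Vec m) : Vec m →ₗ[ℝ] ℝ := ∑ i, u i • LinearMap.proj i

/-- Orthogonal projection onto the tangent space of the sphere at `u`. -/
def projSph (m : ℕ) (u : Vec m) : Vec m →ₗ[ℝ] Vec m :=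
  LinearMap.id - (dotLin m u).smulRight u

/-- The linear functional `v ↦ Σ vᵢ`. -/
def sumLin (m : ℕ) : Vec m →ₗ[ℝ] ℝ := ∑ i, LinearMap.proj i

/-- Orthogonal projection onto the tangent hyperplane `{Σ vᵢ = 0}` of the simplex. -/
def projSim (m : ℕ) : Vec m →ₗ[ℝ] Vec m :=
  LinearMap.id - ((m : ℝ)⁻¹ • sumLin m).smulRight (fun _ => 1)

/-- Differential `k`-forms on a subset `M ⊆ ℝ^m`, encoded at each point by the canonical
alternating tensor on `ℝ^m` that vanishes in the directions normal to `M` (i.e. the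
pullback along the inclusion, extended by the tangent projection). -/
abbrev FormOn (m : ℕ) (M : Set (Vec m)) (k : ℕ) := M → (Vec m [⋀^Fin k]→ₗ[ℝ] ℝ)

/-- Restriction (pullback along the inclusion) of an ambient form to the simplex. -/
def resSim (m k : ℕ) (α : Form m k) : FormOn m (simplexSet m) k :=
  fun x => (α x.1).compLinearMap (projSim m)

/-- Restriction (pullback along the inclusion) of an ambient form to the sphere. -/
def resSph (m k : ℕ) (α : Form m k) : FormOn m (sphereSet m) k :=
  fun u => (α u.1).compLinearMap (projSph m u.1)

/-- `P_rΛ^k(T^{m-1})`. -/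
def PLsim (m k : ℕ) (r : ℤ) : Set (FormOn m (simplexSet m) k) := resSim m k '' PL m k r

/-- `P_rΛ^k(S^{m-1})`. -/
def PLsph (m k : ℕ) (r : ℤ) : Set (FormOn m (sphereSet m) k) := resSph m k '' PL m k r

/-- `P_r⁻Λ^k(T^{m-1})`. -/
def PLmsim (m k : ℕ) (r : ℤ) : Set (FormOn m (simplexSet m) k) := resSim m k '' PLm m k r

/-- `P_r⁻Λ^k(S^{m-1})`. -/
def PLmsph (m k : ℕ) (r : ℤ) : Set (FormOn m (sphereSet m) k) := resSph m k '' PLm m k r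

lemma phi_mem_simplex {m : ℕ} {u : Vec m} (hu : u ∈ sphereSet m) :
    Phi m u ∈ simplexSet m :=
  ⟨fun _ => sq_nonneg _, hu⟩

/-- Pullback `Φ^* : Λ^k(T^{m-1}) → Λ^k(S^{m-1})` along `Φ : S^{m-1} → T^{m-1}`. -/
def phiPullTS (m k : ℕ) (a : FormOn m (simplexSet m) k) : FormOn m (sphereSet m) k :=
  fun u => (a ⟨Phi m u.1, phi_mem_simplex u.2⟩).compLinearMap
    ((dPhi m u.1).comp (projSph m u.1))

lemma refl_mem_sphere {m : ℕ} {i : Fin m} {u : Vec m} (hu : u ∈ sphereSet m) :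
    reflFun m i u ∈ sphereSet m := by
  have : ∀ j, (reflFun m i u j) ^ 2 = u j ^ 2 := by
    intro j; simp only [reflFun]; split <;> ring
  simpa only [sphereSet, Set.mem_setOf_eq, this] using hu

/-- Pullback of a form on the sphere along the reflection `R_i`. -/
def reflPullSph (m k : ℕ) (i : Fin m) (α : FormOn m (sphereSet m) k) :
    FormOn m (sphereSet m) k :=
  fun u => (α ⟨reflFun m i u.1, refl_mem_sphere u.2⟩).compLinearMap (reflLin m i)

/-- A form on the sphere is even if it is invariant under all coordinate reflections. -/
def IsEvenSph (m k : ℕ) (α : FormOn m (sphereSet m) k) : Prop :=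
  ∀ i, reflPullSph m k i α = α

/-- A form on the sphere is odd if every coordinate reflection negates it. -/
def IsOddSph (m k : ℕ) (α : FormOn m (sphereSet m) k) : Prop :=
  ∀ i, reflPullSph m k i α = -α

/-- The bubble function `u_N = u₁ ⋯ u_m`. -/
def bubble (m : ℕ) (u : Vec m) : ℝ := ∏ i, u i

/-- Multiplication of a form on the sphere by the bubble function. -/
def bubbleSmul (m k : ℕ) (α : FormOn m (sphereSet m) k) : FormOn m (sphereSet m) k :=
  fun u => bubble m u.1 • α u

/-- Multiplication of an ambient form by the bubble function. -/
def bubbleSmulAmb (m k : ℕ) (α : Form m k) : Form m k :=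
  fun u => bubble m u • α u

/-- The standard volume form on `ℝ^m`. -/
def volForm (m : ℕ) : (Vec m) [⋀^Fin m]→ₗ[ℝ] ℝ := (Pi.basisFun ℝ (Fin m)).det

/-- Iterated interior product: insert the vectors `v 0, …, v (k-1)` into the
first `k` slots of an alternating `(k+j)`-tensor. -/
def contrMany {m : ℕ} : (k : ℕ) → (Fin k → Vec m) → {j : ℕ} →
    ((Vec m) [⋀^Fin (k + j)]→ₗ[ℝ] ℝ) → ((Vec m) [⋀^Fin j]→ₗ[ℝ] ℝ)
  | 0, _, j, α => α.domDomCongr (finCongr (Nat.zero_add j))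
  | (k + 1), v, j, α =>
      contrMany k (fun i => v i.succ)
        ((α.domDomCongr (finCongr (by omega : (k + 1) + j = (k + j) + 1))).curryLeft (v 0))

/-- The Hodge star on alternating tensors on `ℝ^m` (standard metric and orientation):
`(⋆α)(w₁,…,w_{m-k}) = (1/k!) Σ_g α(e_{g 0},…,e_{g(k-1)}) vol(e_{g 0},…,e_{g(k-1)},w₁,…,w_{m-k})`. -/
def starAlt (m k : ℕ) (α : (Vec m) [⋀^Fin k]→ₗ[ℝ] ℝ) : (Vec m) [⋀^Fin (m - k)]→ₗ[ℝ] ℝ :=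
  if h : k ≤ m then
    (k.factorial : ℝ)⁻¹ •
      ∑ g : Fin k → Fin m,
        α (fun i => Pi.single (g i) 1) •
          contrMany k (fun i => Pi.single (g i) 1)
            ((volForm m).domDomCongr (finCongr (by omega : m = k + (m - k))))
  else 0

/-- The Hodge star `⋆_{ℝ^m}` applied pointwise to ambient forms. -/
def starR (m k : ℕ) (α : Form m k) : Form m (m - k) := fun x => starAlt m k (α x)

/-- The wedge product of alternating tensors. -/
def wedgeAlt {m k l : ℕ} (α : (Vec m) [⋀^Fin k]→ₗ[ℝ] ℝ) (β : (Vec m) [⋀^Fin l]→ₗ[ℝ] ℝ) :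
    (Vec m) [⋀^Fin (k + l)]→ₗ[ℝ] ℝ :=
  ((TensorProduct.lid ℝ ℝ).toLinearMap.compAlternatingMap (α.domCoprod β)).domDomCongr
    finSumFinEquiv

/-- The conormal `ν = Σ uᵢ duᵢ` at `u`, as an alternating 1-tensor. -/
def nuForm (m : ℕ) (u : Vec m) : (Vec m) [⋀^Fin 1]→ₗ[ℝ] ℝ :=
  AlternatingMap.ofSubsingleton ℝ (Vec m) ℝ (0 : Fin 1) (dotLin m u)

/-- The extended Hodge star `⋆_{S^{m-1}} α := ⋆_{ℝ^m}(ν ∧ α)` on ambient forms. -/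
def starSphAmb (m k : ℕ) (α : Form m k) : Form m (m - (1 + k)) :=
  fun x => starAlt m (1 + k) (wedgeAlt (nuForm m x) (α x))

/-- The Hodge star of a form on the sphere (w.r.t. the round metric and the orientation
induced by the outward normal), computed as the restriction of `⋆_{ℝ^m}(ν ∧ ·)`. -/
def starSph (m k : ℕ) (α : FormOn m (sphereSet m) k) :
    FormOn m (sphereSet m) (m - (1 + k)) :=
  fun u => (starAlt m (1 + k) (wedgeAlt (nuForm m u.1) (α u))).compLinearMap (projSph m u.1)

/-- Re-indexing a form along an equality of form degrees. -/
def castForm {m k l : ℕ} (h : k = l) (α : Form m k) : Form m l :=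
  fun x => (α x).domDomCongr (finCongr h)

/-- Re-indexing a form on a subset along an equality of form degrees. -/
def castFormOn {m : ℕ} {M : Set (Vec m)} {k l : ℕ} (h : k = l) (α : FormOn m M k) :
    FormOn m M l :=
  fun x => (α x).domDomCongr (finCongr h)

/-- Trace on the boundary of the simplex vanishes: at every boundary point (a point of some
face `xᵢ = 0`), the form vanishes on vectors tangent to that face. -/
def vanishBdry (m k : ℕ) (a : FormOn m (simplexSet m) k) : Prop :=
  ∀ (x : simplexSet m) (i : Fin m), x.1 i = 0 →
    ∀ v : Fin k → Vec m, (∀ j, (∑ l, v j l) = 0 ∧ v j i = 0) → a x v = 0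

/-- `P̊_rΛ^k(T^{m-1})`: forms in `P_rΛ^k(T^{m-1})` with vanishing trace on the boundary. -/
def PLosim (m k : ℕ) (r : ℤ) : Set (FormOn m (simplexSet m) k) :=
  {a ∈ PLsim m k r | vanishBdry m k a}

/-- `P̊_r⁻Λ^k(T^{m-1})`. -/
def PLmosim (m k : ℕ) (r : ℤ) : Set (FormOn m (simplexSet m) k) :=
  {a ∈ PLmsim m k r | vanishBdry m k a}

/-- A form on the sphere vanishes (as an alternating tensor on the tangent space)
at every point of `S^{m-1} ∩ Γ`, where `Γ = ∪ᵢ {uᵢ = 0}`. -/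
def zeroOnGammaSph (m k : ℕ) (α : FormOn m (sphereSet m) k) : Prop :=
  ∀ u : sphereSet m, (∃ i, u.1 i = 0) →
    ∀ v : Fin k → Vec m, (∀ j, ∑ l, u.1 l * v j l = 0) → α u v = 0

/-- An ambient form vanishes (as an alternating tensor) at every point of `Γ`. -/
def zeroOnGammaAmb (m k : ℕ) (α : Form m k) : Prop :=
  ∀ u : Vec m, (∃ i, u i = 0) → α u = 0

/-- The wedge product of forms on a subset. -/
def wedgeOn {m : ℕ} {M : Set (Vec m)} {k l : ℕ} (a : FormOn m M k) (b : FormOn m M l) :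
    FormOn m M (k + l) :=
  fun x => wedgeAlt (a x) (b x)

/-- The base region of the parametrization of the simplex. -/
def baseSimplex (n : ℕ) : Set (Fin n → ℝ) := {y | (∀ j, 0 ≤ y j) ∧ ∑ j, y j ≤ 1}

/-- Parametrization `y ↦ (1 - Σy, y)` of `T^n` over the base region. -/
def simplexParam (n : ℕ) (y : Fin n → ℝ) : Vec (n + 1) := Fin.cons (1 - ∑ j, y j) y

lemma simplexParam_mem {n : ℕ} {y : Fin n → ℝ} (h : y ∈ baseSimplex n) :
    simplexParam n y ∈ simplexSet (n + 1) := by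
  constructor
  · intro i
    refine Fin.cases ?_ ?_ i
    · simpa [simplexParam] using sub_nonneg.mpr h.2
    · intro j; simpa [simplexParam] using h.1 j
  · simp [simplexParam, Fin.sum_cons]

/-- The coordinate tangent vectors `∂x/∂y_j = e_{j+1} - e_0` of the parametrization,
a positively oriented frame for the orientation of `T^n` induced from the outward-normal
orientation of `S^n` via `Φ`. -/
def simplexTangent (n : ℕ) (j : Fin n) : Vec (n + 1) :=
  Fin.cons (-1) (Pi.single j 1)

open Classical in
/-- The integral of an `n`-form over the oriented simplex `T^n`. -/
def integralSimplex (n : ℕ) (ω : FormOn (n + 1) (simplexSet (n + 1)) n) : ℝ :=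
  ∫ y : Fin n → ℝ,
    if h : y ∈ baseSimplex n then ω ⟨simplexParam n y, simplexParam_mem h⟩ (simplexTangent n)
    else 0

/-- Forms on a subset that genuinely are pullbacks to the simplex: they vanish in the
normal directions (canonical representatives). -/
def TangentialSim (m k : ℕ) (a : FormOn m (simplexSet m) k) : Prop :=
  ∀ x, (a x).compLinearMap (projSim m) = a x

/-- Continuity of a form on a subset. -/
def ContFormOn (m : ℕ) (M : Set (Vec m)) (k : ℕ) (a : FormOn m M k) : Prop :=
  ∀ v : Fin k → Vec m, Continuous fun x : M => a x v

/-- The Riemannian volume form of the round sphere `S^{m-1}` (outward-normal orientation),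
i.e. the restriction of `⋆_{ℝ^m} ν`. -/
def volSph (m : ℕ) : FormOn m (sphereSet m) (m - 1) :=
  fun u => (starAlt m 1 (nuForm m u.1)).compLinearMap (projSph m u.1)

namespace AltVec

variable {m p q k l : ℕ} {N : Type*} [AddCommGroup N] [Module ℝ N]

/-- The tuple of standard basis vectors with indices `h`. -/
abbrev bv (h : Fin p → Fin m) : Fin p → Vec m := fun i => Pi.single (h i) 1

/-- Every multilinear map is determined by its values on tuples of standard basis vectors. -/
lemma expand (F : Vec m [⋀^Fin p]→ₗ[ℝ] N) (v : Fin p → Vec m) :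
    F v = ∑ g : Fin p → Fin m, (∏ i, v i (g i)) • F (bv g) := by
  have hv : v = fun i => ∑ j, v i j • (Pi.single j 1 : Vec m) := by
    funext i
    exact (pi_eq_sum_univ' (v i)).trans (by simp)
  conv_lhs => rw [hv]
  rw [← AlternatingMap.coe_multilinearMap, MultilinearMap.map_sum]
  refine Finset.sum_congr rfl fun g _ => ?_
  rw [MultilinearMap.map_smul_univ]

/-- A linear map can be moved across the pairing of two alternating maps as its transpose. -/
lemma sum_smul_comp_eq (F : Vec m [⋀^Fin p]→ₗ[ℝ] N) (G : Vec m [⋀^Fin p]→ₗ[ℝ] ℝ)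
    (L L' : Vec m →ₗ[ℝ] Vec m)
    (hL : ∀ i j, L (Pi.single i 1) j = L' (Pi.single j 1) i) :
    ∑ h : Fin p → Fin m, G (bv h) • F (fun i => L (bv h i)) =
      ∑ h : Fin p → Fin m, G (fun i => L' (bv h i)) • F (bv h) := by
  have h1 : ∀ h : Fin p → Fin m, F (fun i => L (bv h i)) =
      ∑ g : Fin p → Fin m, (∏ i, L (bv h i) (g i)) • F (bv g) := fun h => expand F _
  have h2 : ∀ h : Fin p → Fin m, G (fun i => L' (bv h i)) =
      ∑ g : Fin p → Fin m, (∏ i, L' (bv h i) (g i)) • G (bv g) := fun h => expand G _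
  simp only [h1, h2, Finset.smul_sum, Finset.sum_smul, smul_smul, smul_eq_mul]
  rw [Finset.sum_comm]
  refine Finset.sum_congr rfl fun h _ => Finset.sum_congr rfl fun g _ => ?_
  rw [mul_comm]
  congr 2
  exact Finset.prod_congr rfl fun i _ => hL _ _

/-- An alternating map that vanishes as soon as one argument is `y` is invariant under
translations of its arguments by multiples of `y`. -/
lemma map_add_smul_eq (F : Vec m [⋀^Fin p]→ₗ[ℝ] N) (y : Vec m)
    (hF : ∀ v i, v i = y → F v = 0) (v : Fin p → Vec m) (c : Fin p → ℝ) :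
    F (fun i => v i + c i • y) = F v := by
  classical
  have h1 : (fun i => v i + c i • y) = v + fun i => c i • y := rfl
  rw [h1, ← AlternatingMap.coe_multilinearMap, MultilinearMap.map_add_univ]
  rw [Finset.sum_eq_single Finset.univ]
  · simp
  · intro s _ hs
    obtain ⟨i, hi⟩ : ∃ i, i ∉ s := by
      by_contra! h
      exact hs (Finset.eq_univ_iff_forall.2 h)
    have : s.piecewise v (fun i => c i • y) =
        Function.update (s.piecewise v (fun i => c i • y)) i (c i • y) := by
      rw [eq_comm, Function.update_eq_self_iff]
      simp [hi]
    rw [this, MultilinearMap.map_update_smul]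
    rw [AlternatingMap.coe_multilinearMap, hF _ i (by simp), smul_zero]
  · simp

/-- The exterior product of a linear functional with an alternating map. -/
def wedgeOne (lam : Vec m →ₗ[ℝ] ℝ) (μ : Vec m [⋀^Fin k]→ₗ[ℝ] ℝ) :
    Vec m [⋀^Fin (k + 1)]→ₗ[ℝ] ℝ :=
  AlternatingMap.alternatizeUncurryFin (lam.smulRight μ)

lemma wedgeOne_apply (lam : Vec m →ₗ[ℝ] ℝ) (μ : Vec m [⋀^Fin k]→ₗ[ℝ] ℝ)
    (v : Fin (k + 1) → Vec m) :
    wedgeOne lam μ v = ∑ i : Fin (k + 1), (-1) ^ (i : ℕ) * (lam (v i) * μ (i.removeNth v)) := by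
  simp [wedgeOne, AlternatingMap.alternatizeUncurryFin_apply]

lemma wedgeOne_eq_zero_of_forall (lam : Vec m →ₗ[ℝ] ℝ) (μ : Vec m [⋀^Fin k]→ₗ[ℝ] ℝ)
    (v : Fin (k + 1) → Vec m) (hv : ∀ i, lam (v i) = 0) : wedgeOne lam μ v = 0 := by
  simp [wedgeOne_apply, hv]

lemma wedgeOne_cons (lam : Vec m →ₗ[ℝ] ℝ) (μ : Vec m [⋀^Fin k]→ₗ[ℝ] ℝ) (y : Vec m)
    (v : Fin k → Vec m) (hv : ∀ i, lam (v i) = 0) :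
    wedgeOne lam μ (Matrix.vecCons y v) = lam y * μ v := by
  rw [wedgeOne_apply, Fin.sum_univ_succ]
  simp [hv, Matrix.vecCons]

/-- If `lam p = 1` and `μ` vanishes on the kernel of `lam`, then `μ = lam ∧ i_p μ`. -/
lemma eq_wedgeOne_curryLeft (lam : Vec m →ₗ[ℝ] ℝ) (x : Vec m) (hx : lam x = 1)
    (μ : Vec m [⋀^Fin (k + 1)]→ₗ[ℝ] ℝ) (hμ : ∀ v, (∀ i, lam (v i) = 0) → μ v = 0) :
    μ = wedgeOne lam (μ.curryLeft x) := by
  rw [← sub_eq_zero]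
  set θ := μ - wedgeOne lam (μ.curryLeft x) with hθ
  have h0 : ∀ v : Fin k → Vec m, θ (Matrix.vecCons x v) = 0 := by
    intro v
    rw [hθ, AlternatingMap.sub_apply, wedgeOne_apply, Fin.sum_univ_succ]
    rw [Finset.sum_eq_zero]
    · simp [hx, Matrix.vecCons]
    · intro i _
      obtain ⟨k, rfl⟩ : ∃ j, k = j + 1 := ⟨k - 1, by have := i.pos; omega⟩
      have : (i.succ.removeNth (Matrix.vecCons x v)) =
          Matrix.vecCons x (i.removeNth v) := by
        funext j
        refine Fin.cases ?_ (fun j => ?_) j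
        · simp [Fin.removeNth]
        · simp [Fin.removeNth]
      rw [this, AlternatingMap.curryLeft_apply_apply, AlternatingMap.map_eq_zero_of_eq μ
        (i := 0) (j := 1) _ (by simp) (by simp)]
      simp
  have h1 : ∀ v i, v i = x → θ v = 0 := by
    intro v i hv
    have : v = i.insertNth x (i.removeNth v) := by
      rw [← hv]; simp
    rw [this, AlternatingMap.map_insertNth, h0, smul_zero]
  ext v
  rw [AlternatingMap.zero_apply, ← map_add_smul_eq θ x h1 v (fun i => - lam (v i))]
  have h2 : ∀ i, lam (v i + (-lam (v i)) • x) = 0 := by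
    intro i; simp [hx]
  rw [hθ, AlternatingMap.sub_apply, wedgeOne_eq_zero_of_forall _ _ _ h2, hμ _ h2, sub_zero]

/-- The concatenation of two tuples, indexed by `Fin m` along an equality `p + q = m`. -/
def joinTup {α : Type*} (h : p + q = m) (z : Fin p → α) (w : Fin q → α) : Fin m → α :=
  fun i => Fin.append z w (Fin.cast h.symm i)

lemma joinTup_comp {α β : Type*} (h : p + q = m) (z : Fin p → α) (w : Fin q → α) (f : α → β) :
    (fun i => f (joinTup h z w i)) = joinTup h (fun i => f (z i)) (fun i => f (w i)) := by
  subst h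
  funext i
  refine Fin.addCases (fun i => ?_) (fun i => ?_) i <;> simp [joinTup]

lemma joinTup_injective {α : Type*} (h : p + q = m) {z : Fin p → α} {w : Fin q → α} :
    Function.Injective (joinTup h z w) ↔
      Function.Injective z ∧ Function.Injective w ∧ ∀ i j, z i ≠ w j := by
  subst h
  rw [← Fin.append_injective_iff]
  rfl

lemma joinTup_forall {α : Type*} (h : p + q = m) {z : Fin p → α} {w : Fin q → α}
    {P : α → Prop} (hz : ∀ i, P (z i)) (hw : ∀ i, P (w i)) (i : Fin m) : P (joinTup h z w i) := by
  subst h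
  refine Fin.addCases (fun i => ?_) (fun i => ?_) i <;> simp [joinTup, hz, hw]

lemma joinTup_update_left {α : Type*} (h : p + q = m) (z : Fin p → α) (w : Fin q → α)
    (i : Fin p) (a : α) : joinTup h (Function.update z i a) w =
      Function.update (joinTup h z w) (Fin.cast h (Fin.castAdd q i)) a := by
  subst h
  funext j
  refine Fin.addCases (fun j => ?_) (fun j => ?_) j
  · by_cases hj : j = i
    · subst hj; simp [joinTup]
    · simp [joinTup, hj]
  · have : Fin.natAdd p j ≠ Fin.castAdd q i := by
      intro hh; have := congrArg Fin.val hh; simp at this; omega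
    simp [joinTup, this]

lemma joinTup_update_right {α : Type*} (h : p + q = m) (z : Fin p → α) (w : Fin q → α)
    (i : Fin q) (a : α) : joinTup h z (Function.update w i a) =
      Function.update (joinTup h z w) (Fin.cast h (Fin.natAdd p i)) a := by
  subst h
  funext j
  refine Fin.addCases (fun j => ?_) (fun j => ?_) j
  · have : Fin.castAdd q j ≠ Fin.natAdd p i := by
      intro hh; have := congrArg Fin.val hh; simp at this; omega
    simp [joinTup, this]
  · by_cases hj : j = i
    · subst hj; simp [joinTup]
    · simp [joinTup, hj]

@[simp] lemma joinTup_left {α : Type*} (h : p + q = m) (z : Fin p → α) (w : Fin q → α)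
    (i : Fin p) : joinTup h z w (Fin.cast h (Fin.castAdd q i)) = z i := by
  simp [joinTup]

@[simp] lemma joinTup_right {α : Type*} (h : p + q = m) (z : Fin p → α) (w : Fin q → α)
    (i : Fin q) : joinTup h z w (Fin.cast h (Fin.natAdd p i)) = w i := by
  simp [joinTup]

/-- The volume form evaluated on the concatenation of two tuples. -/
def volPair (h : p + q = m) (z : Fin p → Vec m) (w : Fin q → Vec m) : ℝ :=
  volForm m (joinTup h z w)

/-- The volume form as an alternating map in its first `p` arguments. -/
def volLeft (h : p + q = m) (w : Fin q → Vec m) : Vec m [⋀^Fin p]→ₗ[ℝ] ℝ where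
  toFun z := volPair h z w
  map_update_add' z i x y := by
    classical
    convert (volForm m).map_update_add (joinTup h z w) (Fin.cast h (Fin.castAdd q i)) x y using 1
    · rw [← joinTup_update_left]; unfold volPair; congr; exact Subsingleton.elim _ _
    · rw [← joinTup_update_left, ← joinTup_update_left]
      unfold volPair
      congr <;> exact Subsingleton.elim _ _
  map_update_smul' z i c x := by
    classical
    convert (volForm m).map_update_smul (joinTup h z w) (Fin.cast h (Fin.castAdd q i)) c x using 1
    · rw [← joinTup_update_left]; unfold volPair; congr; exact Subsingleton.elim _ _
    · rw [← joinTup_update_left]; unfold volPair; congr; exact Subsingleton.elim _ _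
  map_eq_zero_of_eq' z i j hz hij := by
    refine (volForm m).map_eq_zero_of_eq (i := Fin.cast h (Fin.castAdd q i))
      (j := Fin.cast h (Fin.castAdd q j)) _ (by simpa using hz) ?_
    simpa using hij

/-- The volume form as an alternating map in its last `q` arguments. -/
def volRight (h : p + q = m) (z : Fin p → Vec m) : Vec m [⋀^Fin q]→ₗ[ℝ] ℝ where
  toFun w := volPair h z w
  map_update_add' w i x y := by
    classical
    convert (volForm m).map_update_add (joinTup h z w) (Fin.cast h (Fin.natAdd p i)) x y using 1
    · rw [← joinTup_update_right]; unfold volPair; congr; exact Subsingleton.elim _ _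
    · rw [← joinTup_update_right, ← joinTup_update_right]
      unfold volPair
      congr <;> exact Subsingleton.elim _ _
  map_update_smul' w i c x := by
    classical
    convert (volForm m).map_update_smul (joinTup h z w) (Fin.cast h (Fin.natAdd p i)) c x using 1
    · rw [← joinTup_update_right]; unfold volPair; congr; exact Subsingleton.elim _ _
    · rw [← joinTup_update_right]; unfold volPair; congr; exact Subsingleton.elim _ _
  map_eq_zero_of_eq' w i j hz hij := by
    refine (volForm m).map_eq_zero_of_eq (i := Fin.cast h (Fin.natAdd p i))
      (j := Fin.cast h (Fin.natAdd p j)) _ (by simpa using hz) ?_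
    simpa using hij

@[simp] lemma volLeft_apply (h : p + q = m) (z : Fin p → Vec m) (w : Fin q → Vec m) :
    volLeft h w z = volPair h z w := rfl

@[simp] lemma volRight_apply (h : p + q = m) (z : Fin p → Vec m) (w : Fin q → Vec m) :
    volRight h z w = volPair h z w := rfl

/-- A tuple of `m` vectors in the kernel of a nonzero functional has volume zero. -/
lemma volForm_eq_zero_of_forall (lam : Vec m →ₗ[ℝ] ℝ) (hlam : lam ≠ 0) (x : Fin m → Vec m)
    (hx : ∀ i, lam (x i) = 0) : volForm m x = 0 := by
  refine AlternatingMap.map_linearDependent _ _ fun hli => hlam ?_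
  have hspan := hli.span_eq_top_of_card_eq_finrank' (by simp)
  refine LinearMap.ext_on_range (v := x) hspan fun i => by simp [hx]

lemma volPair_eq_zero_of_forall (h : p + q = m) (lam : Vec m →ₗ[ℝ] ℝ) (hlam : lam ≠ 0)
    (z : Fin p → Vec m) (w : Fin q → Vec m) (hz : ∀ i, lam (z i) = 0) (hw : ∀ i, lam (w i) = 0) :
    volPair h z w = 0 :=
  volForm_eq_zero_of_forall lam hlam _ (joinTup_forall h (P := fun v => lam v = 0) hz hw)

lemma volPair_eq_zero_of_eq (h : p + q = m) (z : Fin p → Vec m) (w : Fin q → Vec m)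
    (i : Fin p) (j : Fin q) (hij : z i = w j) : volPair h z w = 0 := by
  refine (volForm m).map_eq_zero_of_eq (i := Fin.cast h (Fin.castAdd q i))
      (j := Fin.cast h (Fin.natAdd p j)) _ (by simpa using hij) ?_
  intro hh; have := congrArg Fin.val hh; simp at this; omega

/-- The diagonal linear map with entries `y`. -/
def diagLin (y : Vec m) : Vec m →ₗ[ℝ] Vec m := LinearMap.pi fun i => y i • LinearMap.proj i

@[simp] lemma diagLin_apply (y v : Vec m) (i : Fin m) : diagLin y v i = y i * v i := rfl

lemma diagLin_symm (y : Vec m) (i j : Fin m) :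
    diagLin y (Pi.single i 1) j = diagLin y (Pi.single j 1) i := by
  by_cases hij : i = j
  · subst hij; rfl
  · simp [hij, Ne.symm hij]

lemma diagLin_single (y : Vec m) (i : Fin m) :
    diagLin y (Pi.single i 1) = y i • (Pi.single i 1 : Vec m) := by
  funext j
  by_cases hij : j = i
  · subst hij; simp
  · simp [hij]

lemma volForm_diagLin (y : Vec m) (x : Fin m → Vec m) :
    volForm m (fun i => diagLin y (x i)) = (∏ i, y i) * volForm m x := by
  unfold volForm
  have := (Pi.basisFun ℝ (Fin m)).det_comp (diagLin y) x
  have h2 : LinearMap.det (diagLin y) = ∏ i, y i := by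
    have : diagLin y = Matrix.toLin' (Matrix.diagonal y) := by
      ext i j
      simp [Matrix.toLin'_apply, Matrix.mulVec_diagonal, Pi.single_apply]
    rw [this, LinearMap.det_toLin', Matrix.det_diagonal]
  rw [← h2, ← this]
  rfl

lemma volPair_diagLin (h : p + q = m) (y : Vec m) (z : Fin p → Vec m) (w : Fin q → Vec m) :
    volPair h (fun i => diagLin y (z i)) (fun i => diagLin y (w i)) =
      (∏ i, y i) * volPair h z w := by
  unfold volPair
  rw [← joinTup_comp h z w (diagLin y), volForm_diagLin]

/-- Two arrangements of the same list of vectors have volumes that differ by a fixed sign. -/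
lemma exists_sign {ι : Type*} [Fintype ι] (hι : Fintype.card ι = m) (e e' : Fin m → ι)
    (he : Function.Injective e) (he' : Function.Injective e') :
    ∃ ε : ℝ, ε * ε = 1 ∧ ∀ x : ι → Vec m,
      volForm m (fun i => x (e i)) = ε * volForm m (fun i => x (e' i)) := by
  classical
  have hc : Fintype.card (Fin m) = Fintype.card ι := by simp [hι]
  let E := Equiv.ofBijective e ((Fintype.bijective_iff_injective_and_card e).2 ⟨he, hc⟩)
  let E' := Equiv.ofBijective e' ((Fintype.bijective_iff_injective_and_card e').2 ⟨he', hc⟩)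
  let σ : Equiv.Perm (Fin m) := E.trans E'.symm
  refine ⟨((Equiv.Perm.sign σ : ℤ) : ℝ), ?_, fun x => ?_⟩
  · rcases Int.units_eq_one_or (Equiv.Perm.sign σ) with h | h <;> simp [h]
  · have : (fun i => x (e i)) = (fun i => x (e' i)) ∘ σ := by
      funext i
      have : e' (σ i) = e i := by
        change E' (E'.symm (E i)) = E i
        simp
      simp [this]
    rw [this, AlternatingMap.map_perm, Units.smul_def, zsmul_eq_mul]

lemma volPair_swap (h : p + q = m) (h' : q + p = m) :
    ∃ ε : ℝ, ε * ε = 1 ∧ ∀ (z : Fin p → Vec m) (w : Fin q → Vec m),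
      volPair h z w = ε * volPair h' w z := by
  obtain ⟨ε, h1, h2⟩ := exists_sign (ι := Fin p ⊕ Fin q) (by simp [h])
    (joinTup h Sum.inl Sum.inr) (joinTup h' Sum.inr Sum.inl)
    ((joinTup_injective h).2 ⟨Sum.inl_injective, Sum.inr_injective, by simp⟩)
    ((joinTup_injective h').2 ⟨Sum.inr_injective, Sum.inl_injective, by simp⟩)
  refine ⟨ε, h1, fun z w => ?_⟩
  have := h2 (Sum.elim z w)
  simpa only [volPair, joinTup_comp, Sum.elim_inl, Sum.elim_inr] using this

lemma vecCons_comp {α β : Type*} (f : α → β) (a : α) (v : Fin p → α) :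
    (fun i => f (Matrix.vecCons a v i)) = Matrix.vecCons (f a) (fun i => f (v i)) := by
  funext i
  refine Fin.cases ?_ (fun i => ?_) i <;> simp

lemma vecCons_injective {α : Type*} {a : α} {v : Fin p → α} (ha : ∀ i, a ≠ v i)
    (hv : Function.Injective v) : Function.Injective (Matrix.vecCons a v) := by
  refine Fin.cons_injective_iff.2 ⟨?_, hv⟩
  rintro ⟨i, hi⟩
  exact ha i hi.symm

lemma volPair_cons (h : p + (q + 1) = m) (h' : (p + 1) + q = m) :
    ∃ ε : ℝ, ε * ε = 1 ∧ ∀ (y : Vec m) (z : Fin p → Vec m) (w : Fin q → Vec m),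
      volPair h z (Matrix.vecCons y w) = ε * volPair h' (Matrix.vecCons y z) w := by
  have i1 : Function.Injective
      (joinTup h (fun i => (Sum.inr (Sum.inl i) : Unit ⊕ (Fin p ⊕ Fin q)))
      (Matrix.vecCons (Sum.inl ()) (fun i => Sum.inr (Sum.inr i)))) := by
    refine (joinTup_injective h).2 ⟨?_, vecCons_injective (by simp) ?_, fun i j => ?_⟩
    · intro i j; simp
    · intro i j; simp
    · refine Fin.cases ?_ (fun i => ?_) j <;> simp
  have i2 : Function.Injective
      (joinTup h' (Matrix.vecCons (Sum.inl ()) (fun i => Sum.inr (Sum.inl i)))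
        (fun i => (Sum.inr (Sum.inr i) : Unit ⊕ (Fin p ⊕ Fin q)))) := by
    refine (joinTup_injective h').2 ⟨vecCons_injective (by simp) ?_, ?_, fun i j => ?_⟩
    · intro i j; simp
    · intro i j; simp
    · refine Fin.cases ?_ (fun i => ?_) i <;> simp
  obtain ⟨ε, h1, h2⟩ := exists_sign (by simp; omega) _ _ i1 i2
  refine ⟨ε, h1, fun y z w => ?_⟩
  have := h2 (Sum.elim (fun _ => y) (Sum.elim z w))
  simpa only [volPair, joinTup_comp, Sum.elim_inl, Sum.elim_inr, vecCons_comp] using this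

lemma volForm_bv_sq (σ : Fin m → Fin m) (hσ : Function.Injective σ) :
    volForm m (bv σ) * volForm m (bv σ) = 1 := by
  obtain ⟨ε, h1, h2⟩ := exists_sign (ι := Fin m) (by simp) σ id hσ Function.injective_id
  have := h2 (fun i => Pi.single i 1)
  have h3 : volForm m (fun i : Fin m => Pi.single i 1) = 1 := by
    have : (fun i : Fin m => (Pi.single i 1 : Vec m)) = Pi.basisFun ℝ (Fin m) := by
      funext i; simp
    rw [volForm, this, Module.Basis.det_self]
  simp only [id] at this
  rw [h3, mul_one] at this
  unfold bv
  rw [this, h1]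

lemma volPair_bv (h : p + q = m) (z : Fin p → Fin m) (w : Fin q → Fin m) :
    volPair h (bv z) (bv w) = volForm m (bv (joinTup h z w)) := by
  unfold volPair bv
  rw [joinTup_comp h z w (fun i => (Pi.single i (1 : ℝ) : Vec m))]

lemma injective_of_volPair_bv_ne_zero (h : p + q = m) {z : Fin p → Fin m} {w : Fin q → Fin m}
    (hne : volPair h (bv z) (bv w) ≠ 0) : Function.Injective (joinTup h z w) := by
  rw [volPair_bv] at hne
  by_contra hinj
  apply hne
  unfold Function.Injective at hinj
  push Not at hinj
  obtain ⟨i, j, hij, hne'⟩ := hinj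
  exact AlternatingMap.map_eq_zero_of_eq _ _ (by simp [bv, hij]) hne'

lemma sum_altMap_apply {ι : Type*} (s : Finset ι) (f : ι → Vec m [⋀^Fin q]→ₗ[ℝ] N)
    (v : Fin q → Vec m) : (∑ i ∈ s, f i) v = ∑ i ∈ s, f i v := by
  classical
  induction s using Finset.induction_on with
  | empty => simp
  | insert a s ha ih => rw [Finset.sum_insert ha, Finset.sum_insert ha, AlternatingMap.add_apply, ih]

/-- The unnormalized Hodge star: pair an alternating `q`-tensor with the volume form. -/
def starForm (h : p + q = m) (β : Vec m [⋀^Fin q]→ₗ[ℝ] N) : Vec m [⋀^Fin p]→ₗ[ℝ] N :=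
  ∑ κ : Fin q → Fin m,
    (LinearMap.toSpanSingleton ℝ N (β (bv κ))).compAlternatingMap (volLeft h (bv κ))

lemma starForm_apply (h : p + q = m) (β : Vec m [⋀^Fin q]→ₗ[ℝ] N) (z : Fin p → Vec m) :
    starForm h β z = ∑ κ : Fin q → Fin m, volPair h z (bv κ) • β (bv κ) := by
  simp [starForm, sum_altMap_apply]

lemma starForm_smul (h : p + q = m) (c : ℝ) (β : Vec m [⋀^Fin q]→ₗ[ℝ] N) :
    starForm h (c • β) = c • starForm h β := by
  ext z
  simp [starForm_apply, Finset.smul_sum, smul_comm c]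

lemma starForm_sub (h : p + q = m) (β β' : Vec m [⋀^Fin q]→ₗ[ℝ] N) :
    starForm h (β - β') = starForm h β - starForm h β' := by
  ext z
  simp [starForm_apply, smul_sub, Finset.sum_sub_distrib]

lemma starForm_zero (h : p + q = m) : starForm h (0 : Vec m [⋀^Fin q]→ₗ[ℝ] N) = 0 := by
  ext z
  simp [starForm_apply]

lemma joinTup_surjective {h : p + q = m} {z : Fin p → Fin m} {w : Fin q → Fin m}
    (hi : Function.Injective (joinTup h z w)) (x : Fin m) : (∃ i, z i = x) ∨ ∃ j, w j = x := by
  obtain ⟨i, rfl⟩ := Finite.surjective_of_injective hi x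
  exact joinTup_forall h (P := fun x => (∃ i, z i = x) ∨ ∃ j, w j = x)
    (fun i => Or.inl ⟨i, rfl⟩) (fun i => Or.inr ⟨i, rfl⟩) i

/-- A pairing of alternating maps that is supported on the rearrangements of one tuple. -/
lemma sum_smul_eq_factorial (F : Vec m [⋀^Fin q]→ₗ[ℝ] ℝ) (G : Vec m [⋀^Fin q]→ₗ[ℝ] N)
    (τ : Fin q → Fin m) (hτ : Function.Injective τ)
    (hne : ∀ κ : Fin q → Fin m, Function.Injective κ → F (bv κ) ≠ 0 → ∀ i, ∃ j, τ j = κ i) :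
    ∑ κ : Fin q → Fin m, F (bv κ) • G (bv κ) = (q.factorial : ℝ) • F (bv τ) • G (bv τ) := by
  have h1 : ∀ π : Equiv.Perm (Fin q), F (bv τ) • G (bv τ) =
      F (bv (τ ∘ π)) • G (bv (τ ∘ π)) := by
    intro π
    have e : bv (m := m) (τ ∘ π) = bv τ ∘ π := rfl
    rw [e, AlternatingMap.map_perm, AlternatingMap.map_perm]
    rcases Int.units_eq_one_or (Equiv.Perm.sign π) with h | h <;> simp [h]
  rw [← Fintype.sum_of_injective (fun π : Equiv.Perm (Fin q) => τ ∘ π) _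
    (fun π => F (bv τ) • G (bv τ)) (fun κ => F (bv κ) • G (bv κ)) ?_ h1]
  · simp [Fintype.card_perm, ← Nat.cast_smul_eq_nsmul ℝ]
  · intro π π' h
    ext i
    have := hτ (congrFun h i)
    rw [this]
  · intro κ hκ
    by_contra h0
    have hF : F (bv κ) ≠ 0 := fun h => h0 (by simp [h])
    have hinj : Function.Injective κ := by
      by_contra hinj
      apply hF
      unfold Function.Injective at hinj
      push Not at hinj
      obtain ⟨i, j, hij, hne'⟩ := hinj
      exact AlternatingMap.map_eq_zero_of_eq _ _ (by simp [bv, hij]) hne'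
    choose f hf using hne κ hinj hF
    have hf' : Function.Injective f := fun i j hij => hinj (by rw [← hf, ← hf, hij])
    apply hκ
    refine ⟨Equiv.ofBijective f (Finite.injective_iff_bijective.1 hf'), ?_⟩
    funext i
    simp [hf]

lemma exists_complement (h : p + q = m) (τ : Fin p → Fin m) (hτ : Function.Injective τ) :
    ∃ τ' : Fin q → Fin m, Function.Injective (joinTup h τ τ') := by
  classical
  have hc : (Finset.univ.image τ)ᶜ.card = q := by
    rw [Finset.card_compl, Finset.card_image_of_injective _ hτ]
    simp; omega
  refine ⟨(Finset.univ.image τ)ᶜ.orderEmbOfFin hc, (joinTup_injective h).2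
    ⟨hτ, (Finset.orderEmbOfFin _ hc).injective, fun i j hij => ?_⟩⟩
  have := Finset.orderEmbOfFin_mem _ hc j
  rw [← hij] at this
  simp at this

/-- The star operator is an involution up to a nonzero constant. -/
lemma starForm_starForm (h : p + q = m) (h' : q + p = m) :
    ∃ C : ℝ, C ≠ 0 ∧ ∀ {N : Type} [AddCommGroup N] [Module ℝ N] (β : Vec m [⋀^Fin q]→ₗ[ℝ] N),
      starForm h' (starForm h β) = C • β := by
  obtain ⟨ε, hε, hsw⟩ := volPair_swap h h'
  refine ⟨p.factorial * q.factorial * ε, ?_, fun {N} _ _ β => ?_⟩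
  · have : ε ≠ 0 := by rintro rfl; simp at hε
    positivity
  refine (Pi.basisFun ℝ (Fin m)).ext_alternating fun τ hτ => ?_
  have e : (fun i => Pi.basisFun ℝ (Fin m) (τ i)) = bv τ := by funext i; simp
  rw [e, starForm_apply]
  obtain ⟨τ', hτ'⟩ := exists_complement h' τ hτ
  have h1 : ∀ lam : Fin p → Fin m, volPair h' (bv τ) (bv lam) • starForm h β (bv lam) =
      (volPair h' (bv τ) (bv lam) * volPair h' (bv τ) (bv lam)) •
        (q.factorial * ε) • β (bv τ) := by
    intro lam
    by_cases h0 : volPair h' (bv τ) (bv lam) = 0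
    · simp [h0]
    have hi := injective_of_volPair_bv_ne_zero h' h0
    have h2 := sum_smul_eq_factorial (volRight h (bv lam)) β τ hτ (by
      intro κ _ hne i
      have h3 := injective_of_volPair_bv_ne_zero h hne
      rcases joinTup_surjective hi (κ i) with h4 | ⟨j, h4⟩
      · exact h4
      · exact absurd h4 (((joinTup_injective h).1 h3).2.2 j i))
    simp only [volRight_apply] at h2
    rw [starForm_apply, h2, hsw (bv lam) (bv τ)]
    simp only [smul_smul]
    congr 1
    ring
  rw [Finset.sum_congr rfl fun lam _ => h1 lam, ← Finset.sum_smul]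
  have h2 := sum_smul_eq_factorial (volRight h' (bv τ)) (volRight h' (bv τ)) τ'
    ((joinTup_injective h').1 hτ').2.1 (by
      intro κ _ hne i
      have h3 := injective_of_volPair_bv_ne_zero h' hne
      rcases joinTup_surjective hτ' (κ i) with ⟨j, h4⟩ | h4
      · exact absurd h4 (((joinTup_injective h').1 h3).2.2 j i)
      · exact h4)
  simp only [volRight_apply, smul_eq_mul] at h2
  rw [h2, volPair_bv h' τ τ', volForm_bv_sq _ hτ', AlternatingMap.smul_apply, smul_smul]
  congr 1
  ring

lemma dotLin_apply (y v : Vec m) : dotLin m y v = ∑ i, y i * v i := by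
  simp [dotLin, LinearMap.sum_apply]

lemma dotLin_single (y : Vec m) (i : Fin m) : dotLin m y (Pi.single i 1) = y i := by
  simp [dotLin_apply, Pi.single_apply]

lemma sumLin_apply (v : Vec m) : sumLin m v = ∑ i, v i := by
  simp [sumLin, LinearMap.sum_apply]

lemma dotLin_one : dotLin m (fun _ => 1) = sumLin m := by
  ext; simp [dotLin_apply, sumLin_apply]

lemma dotLin_self_ne_zero {y : Vec m} (hy : y ≠ 0) : dotLin m y y ≠ 0 := by
  rw [dotLin_apply]
  intro h
  apply hy
  funext i
  have := (Finset.sum_eq_zero_iff_of_nonneg (fun i _ => mul_self_nonneg (y i))).1 h i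
    (Finset.mem_univ i)
  simpa using this

/-- If one of two alternating maps is killed by `y ≠ 0` and the other one vanishes on the
hyperplane orthogonal to `y`, then their pairing vanishes. -/
lemma sum_smul_eq_zero (F : Vec m [⋀^Fin q]→ₗ[ℝ] N) (G : Vec m [⋀^Fin q]→ₗ[ℝ] ℝ) (y : Vec m)
    (hy : y ≠ 0)
    (h : ((∀ v i, v i = y → F v = 0) ∧ ∀ v, (∀ i, dotLin m y (v i) = 0) → G v = 0) ∨
      ((∀ v i, v i = y → G v = 0) ∧ ∀ v, (∀ i, dotLin m y (v i) = 0) → F v = 0)) :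
    ∑ κ : Fin q → Fin m, G (bv κ) • F (bv κ) = 0 := by
  have hyy := dotLin_self_ne_zero hy
  let P : Vec m →ₗ[ℝ] Vec m := LinearMap.id - ((dotLin m y y)⁻¹ • dotLin m y).smulRight y
  have hP : ∀ v, P v = v + (-((dotLin m y y)⁻¹ * dotLin m y v)) • y := by
    intro v; simp [P, sub_eq_add_neg]
  have hsymm : ∀ i j, P (Pi.single i 1) j = P (Pi.single j 1) i := by
    intro i j
    have : (Pi.single i 1 : Vec m) j = (Pi.single j 1 : Vec m) i := by
      simp [Pi.single_apply, eq_comm]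
    simp only [hP, Pi.add_apply, Pi.smul_apply, dotLin_single, this, smul_eq_mul]
    ring
  have hker : ∀ v, dotLin m y (P v) = 0 := by
    intro v
    rw [hP, map_add, map_smul, smul_eq_mul]
    field_simp
    ring
  rcases h with ⟨hF, hG⟩ | ⟨hG, hF⟩
  · have h1 : ∀ κ : Fin q → Fin m, F (bv κ) = F (fun i => P (bv κ i)) := by
      intro κ
      simp only [hP]
      rw [map_add_smul_eq F y hF]
    simp only [h1]
    rw [sum_smul_comp_eq F G P P hsymm]
    exact Finset.sum_eq_zero fun κ _ => by rw [hG _ fun i => hker _, zero_smul]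
  · have h1 : ∀ κ : Fin q → Fin m, G (bv κ) = G (fun i => P (bv κ i)) := by
      intro κ
      simp only [hP]
      rw [map_add_smul_eq G y hG]
    simp only [h1]
    rw [← sum_smul_comp_eq F G P P hsymm]
    exact Finset.sum_eq_zero fun κ _ => by rw [hF _ fun i => hker _, smul_zero]

lemma dotLin_ne_zero {y : Vec m} (hy : y ≠ 0) : dotLin m y ≠ 0 := fun h =>
  dotLin_self_ne_zero hy (by rw [h, LinearMap.zero_apply])

/-- The star of a tensor killed by `y` vanishes on the hyperplane orthogonal to `y`. -/
lemma starForm_eq_zero_of_forall (h : p + q = m) (β : Vec m [⋀^Fin q]→ₗ[ℝ] N) (y : Vec m)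
    (hy : y ≠ 0) (hβ : ∀ v i, v i = y → β v = 0) (z : Fin p → Vec m)
    (hz : ∀ i, dotLin m y (z i) = 0) : starForm h β z = 0 := by
  rw [starForm_apply]
  exact sum_smul_eq_zero β (volRight h z) y hy (Or.inl ⟨hβ, fun v hv =>
    volPair_eq_zero_of_forall h _ (dotLin_ne_zero hy) _ _ hz hv⟩)

/-- The star of a tensor that vanishes on the hyperplane orthogonal to `y` is killed by `y`. -/
lemma starForm_eq_zero_of_eq (h : p + q = m) (β : Vec m [⋀^Fin q]→ₗ[ℝ] N) (y : Vec m)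
    (hy : y ≠ 0) (hβ : ∀ v, (∀ i, dotLin m y (v i) = 0) → β v = 0) (z : Fin p → Vec m)
    (i : Fin p) (hz : z i = y) : starForm h β z = 0 := by
  rw [starForm_apply]
  exact sum_smul_eq_zero β (volRight h z) y hy (Or.inr ⟨fun v j hv =>
    volPair_eq_zero_of_eq h _ _ i j (by rw [hz, hv]), hβ⟩)

/-- The star turns the exterior product with `⟨y, ·⟩` into the interior product with `y`. -/
lemma starForm_wedgeOne (h : p + (k + 1) = m) (h' : (p + 1) + k = m) :
    ∃ C : ℝ, C ≠ 0 ∧ ∀ (y : Vec m) (μ : Vec m [⋀^Fin k]→ₗ[ℝ] ℝ) (w : Fin p → Vec m),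
      starForm h (wedgeOne (dotLin m y) μ) w = C * starForm h' μ (Matrix.vecCons y w) := by
  obtain ⟨ε, hε, hc⟩ := volPair_cons h h'
  refine ⟨(k + 1) * ε, ?_, fun y μ w => ?_⟩
  · have : ε ≠ 0 := by rintro rfl; simp at hε
    positivity
  simp only [starForm_apply, wedgeOne_apply, smul_eq_mul, Finset.mul_sum]
  rw [Finset.sum_comm]
  have hi : ∀ i : Fin (k + 1), ∑ κ : Fin (k + 1) → Fin m, volPair h w (bv κ) *
      ((-1) ^ (i : ℕ) * (dotLin m y (bv κ i) * μ (i.removeNth (bv κ)))) =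
      ∑ κ : Fin k → Fin m, ε * (volPair h' (Matrix.vecCons y w) (bv κ) * μ (bv κ)) := by
    intro i
    rw [← (Fin.insertNthEquiv (fun _ => Fin m) i).sum_comp, Fintype.sum_prod_type,
      Finset.sum_comm]
    refine Finset.sum_congr rfl fun κ _ => ?_
    have h1 : ∀ a : Fin m, volPair h w (bv (i.insertNth (α := fun _ => Fin m) a κ)) =
        (-1) ^ (i : ℕ) * volPair h w (Matrix.vecCons (Pi.single a 1) (bv κ)) := by
      intro a
      have : bv (i.insertNth (α := fun _ => Fin m) a κ) =
          i.insertNth (α := fun _ => Vec m) (Pi.single a 1) (bv κ) := by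
        funext j
        refine Fin.succAboveCases i ?_ (fun j => ?_) j <;> simp [bv]
      rw [this, ← volRight_apply, AlternatingMap.map_insertNth]
      simp
    have h2 : ∀ a : Fin m, i.removeNth (bv (i.insertNth (α := fun _ => Fin m) a κ)) =
        (bv κ : Fin k → Vec m) := by
      intro a
      funext j
      simp [bv, Fin.removeNth]
    have h3 : ε * (volPair h' (Matrix.vecCons y w) (bv κ)) =
        ∑ a, y a * volPair h w (Matrix.vecCons (Pi.single a 1) (bv κ)) := by
      rw [← hc]
      have hy : y = ∑ a, y a • (Pi.single a 1 : Vec m) :=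
        (pi_eq_sum_univ' y).trans (by simp)
      have h4 : ∀ x : Vec m, volPair h w (Matrix.vecCons x (bv κ)) =
          ((volRight h w).curryLeft x) (bv κ) := fun _ => rfl
      simp only [h4]
      conv_lhs => rw [hy]
      simp [map_sum, sum_altMap_apply]
    rw [← mul_assoc, h3, Finset.sum_mul]
    refine Finset.sum_congr rfl fun a _ => ?_
    have h5 : (-1 : ℝ) ^ (i : ℕ) * (-1 : ℝ) ^ (i : ℕ) = 1 := by
      rw [← mul_pow]; simp
    have h6 : Fin.insertNthEquiv (fun _ => Fin m) i (a, κ) = i.insertNth a κ := rfl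
    simp only [h6, h1, h2, bv, Fin.insertNth_apply_same, dotLin_single]
    linear_combination (volPair h w (Matrix.vecCons (Pi.single a 1) (bv κ)) * y a * μ (bv κ)) * h5
  rw [Finset.sum_congr rfl fun i _ => hi i]
  simp only [Finset.sum_const, Finset.card_univ, Fintype.card_fin, nsmul_eq_mul, ← Finset.mul_sum]
  push_cast
  ring

lemma contrMany_apply (k : ℕ) (v : Fin k → Vec m) {j : ℕ} (α : Vec m [⋀^Fin (k + j)]→ₗ[ℝ] ℝ)
    (w : Fin j → Vec m) : contrMany k v α w = α (Fin.append v w) := by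
  induction k generalizing j with
  | zero =>
    rw [contrMany, AlternatingMap.domDomCongr_apply, Fin.append_left_nil _ _ rfl]
    rfl
  | succ k ih =>
    rw [contrMany, ih, AlternatingMap.curryLeft_apply_apply, AlternatingMap.domDomCongr_apply]
    congr 1
    have := Fin.append_cons (v 0) (fun i => v i.succ) w
    have h2 : (Fin.cons (v 0) (fun i => v i.succ) : Fin (k + 1) → Vec m) = v :=
      Fin.cons_self_tail v
    rw [h2] at this
    rw [this]
    rfl

lemma wedgeAlt_apply (ν : Vec m [⋀^Fin 1]→ₗ[ℝ] ℝ) (ω : Vec m [⋀^Fin k]→ₗ[ℝ] ℝ)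
    (v : Fin (1 + k) → Vec m) :
    (k.factorial : ℝ) * wedgeAlt ν ω v = ∑ σ : Equiv.Perm (Fin 1 ⊕ Fin k),
      ((Equiv.Perm.sign σ : ℤ) : ℝ) * (ν (fun i => v (finSumFinEquiv (σ (Sum.inl i)))) *
        ω (fun i => v (finSumFinEquiv (σ (Sum.inr i))))) := by
  have h := MultilinearMap.domCoprod_alternization_eq ν ω
  have h2 := congrArg (fun F => TensorProduct.lid ℝ ℝ (F (fun i => v (finSumFinEquiv i)))) h
  simp only [Fintype.card_fin, Nat.factorial_one, one_mul] at h2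
  rw [AlternatingMap.smul_apply, map_nsmul, nsmul_eq_mul] at h2
  have h3 : wedgeAlt ν ω v = TensorProduct.lid ℝ ℝ ((ν.domCoprod ω)
    (fun i => v (finSumFinEquiv i))) := rfl
  rw [h3, ← h2, MultilinearMap.alternatization_apply, map_sum]
  refine Finset.sum_congr rfl fun σ _ => ?_
  rw [Units.smul_def, map_zsmul, zsmul_eq_mul]
  rfl

lemma sum_wedgeAlt (ν : Vec m [⋀^Fin 1]→ₗ[ℝ] ℝ) (ω : Vec m [⋀^Fin k]→ₗ[ℝ] ℝ)
    (V : Vec m [⋀^Fin (1 + k)]→ₗ[ℝ] ℝ) :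
    (k.factorial : ℝ) * ∑ g : Fin (1 + k) → Fin m, wedgeAlt ν ω (bv g) * V (bv g) =
      ((1 + k).factorial : ℝ) * ∑ f : (Fin 1 → Fin m) × (Fin k → Fin m),
        ν (bv f.1) * ω (bv f.2) * V (Fin.append (bv f.1) (bv f.2)) := by
  let W : (Fin 1 ⊕ Fin k → Fin m) → ℝ := fun g =>
    (V.domDomCongr finSumFinEquiv.symm) (fun i => Pi.single (g i) 1)
  let f : (Fin 1 ⊕ Fin k → Fin m) → ℝ := fun g =>
    ν (fun i => Pi.single (g (Sum.inl i)) 1) * ω (fun i => Pi.single (g (Sum.inr i)) 1)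
  have hW : ∀ (σ : Equiv.Perm (Fin 1 ⊕ Fin k)) g, W (g ∘ σ) =
      ((Equiv.Perm.sign σ : ℤ) : ℝ) * W g := by
    intro σ g
    have := (V.domDomCongr finSumFinEquiv.symm).map_perm
      (fun i => (Pi.single (g i) 1 : Vec m)) σ
    rw [Units.smul_def, zsmul_eq_mul] at this
    exact this
  have hsq : ∀ σ : Equiv.Perm (Fin 1 ⊕ Fin k), ((Equiv.Perm.sign σ : ℤ) : ℝ) *
      ((Equiv.Perm.sign σ : ℤ) : ℝ) = 1 := by
    intro σ
    rcases Int.units_eq_one_or (Equiv.Perm.sign σ) with h | h <;> simp [h]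
  rw [Finset.mul_sum]
  have h1 : ∀ g : Fin (1 + k) → Fin m, (k.factorial : ℝ) * (wedgeAlt ν ω (bv g) * V (bv g)) =
      ∑ σ : Equiv.Perm (Fin 1 ⊕ Fin k), ((Equiv.Perm.sign σ : ℤ) : ℝ) *
        f (g ∘ finSumFinEquiv ∘ σ) * W (g ∘ finSumFinEquiv) := by
    intro g
    rw [← mul_assoc, wedgeAlt_apply, Finset.sum_mul]
    refine Finset.sum_congr rfl fun σ _ => ?_
    have : W (g ∘ finSumFinEquiv) = V (bv g) := by
      simp only [W, AlternatingMap.domDomCongr_apply]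
      congr 1
      funext i
      simp
    rw [this]
    rfl
  rw [Finset.sum_congr rfl fun g _ => h1 g, Finset.sum_comm]
  have h2 : ∀ σ : Equiv.Perm (Fin 1 ⊕ Fin k), ∑ g : Fin (1 + k) → Fin m,
      ((Equiv.Perm.sign σ : ℤ) : ℝ) * f (g ∘ finSumFinEquiv ∘ σ) * W (g ∘ finSumFinEquiv) =
      ∑ g : Fin 1 ⊕ Fin k → Fin m, f g * W g := by
    intro σ
    let E := (finSumFinEquiv (m := 1) (n := k)).arrowCongr (Equiv.refl (Fin m))
    rw [← E.sum_comp]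
    rw [← (σ.arrowCongr (Equiv.refl (Fin m))).sum_comp]
    refine Finset.sum_congr rfl fun g _ => ?_
    have e1 : E ((σ.arrowCongr (Equiv.refl (Fin m))) g) ∘ finSumFinEquiv = g ∘ σ.symm := by
      funext i
      simp [E, Equiv.arrowCongr]
    have e2 : E ((σ.arrowCongr (Equiv.refl (Fin m))) g) ∘ finSumFinEquiv ∘ σ = g := by
      rw [← Function.comp_assoc, e1]
      funext i
      simp
    rw [e1, e2, hW, Equiv.Perm.sign_symm]
    linear_combination (f g * W g) * hsq σ
  rw [Finset.sum_congr rfl fun σ _ => h2 σ, Finset.sum_const, Finset.card_univ,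
    Fintype.card_perm, Fintype.card_sum, Fintype.card_fin, Fintype.card_fin, nsmul_eq_mul]
  congr 1
  rw [← (Equiv.sumArrowEquivProdArrow (Fin 1) (Fin k) (Fin m)).symm.sum_comp]
  refine Finset.sum_congr rfl fun g _ => ?_
  simp only [f, W]
  congr 1
  rw [AlternatingMap.domDomCongr_apply]
  congr 1
  funext i
  refine Fin.addCases (fun i => ?_) (fun i => ?_) i <;> simp [Equiv.sumArrowEquivProdArrow]

lemma volPair_append (h0 : (1 + k) + l = m) (h : (l + 1) + k = m) :
    ∃ ε : ℝ, ε ≠ 0 ∧ ∀ (x : Fin 1 → Vec m) (z : Fin k → Vec m) (w : Fin l → Vec m),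
      volPair h0 (Fin.append x z) w = ε * volPair h (Matrix.vecCons (x 0) w) z := by
  have i1 : Function.Injective (joinTup h0
      (Fin.append (fun _ : Fin 1 => (Sum.inl () : Unit ⊕ (Fin k ⊕ Fin l)))
        (fun i => Sum.inr (Sum.inl i))) (fun i => Sum.inr (Sum.inr i))) := by
    refine (joinTup_injective h0).2 ⟨Fin.append_injective_iff.2 ⟨?_, ?_, by simp⟩, ?_, ?_⟩
    · exact Function.injective_of_subsingleton _
    · intro i j; simp
    · intro i j; simp
    · intro i j
      refine Fin.addCases (fun i => ?_) (fun i => ?_) i <;> simp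
  have i2 : Function.Injective (joinTup h
      (Matrix.vecCons (Sum.inl () : Unit ⊕ (Fin k ⊕ Fin l)) (fun i => Sum.inr (Sum.inr i)))
        (fun i => Sum.inr (Sum.inl i))) := by
    refine (joinTup_injective h).2 ⟨vecCons_injective (by simp) ?_, ?_, fun i j => ?_⟩
    · intro i j; simp
    · intro i j; simp
    · refine Fin.cases ?_ (fun i => ?_) i <;> simp
  obtain ⟨ε, hε, hs⟩ := exists_sign (by simp; omega) _ _ i1 i2
  refine ⟨ε, by rintro rfl; simp at hε, fun x z w => ?_⟩
  have := hs (Sum.elim (fun _ => x 0) (Sum.elim z w))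
  simp only [joinTup_comp, Sum.elim_inl, Sum.elim_inr, vecCons_comp] at this
  unfold volPair
  rw [← this]
  congr 2
  funext i
  refine Fin.addCases (fun i => ?_) (fun i => ?_) i
  · simp [Subsingleton.elim i 0]
  · simp

/-- The Hodge star of `⟨u, ·⟩ ∧ ω` in terms of the unnormalized star of `ω`. -/
lemma starAlt_wedgeAlt (hk : 1 + k ≤ m) (h : (m - (1 + k) + 1) + k = m) :
    ∃ ε : ℝ, ε ≠ 0 ∧ ∀ (u : Vec m) (ω : Vec m [⋀^Fin k]→ₗ[ℝ] ℝ)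
      (w : Fin (m - (1 + k)) → Vec m),
      starAlt m (1 + k) (wedgeAlt (nuForm m u) ω) w =
        ε * starForm h ω (Matrix.vecCons u w) := by
  have h0 : (1 + k) + (m - (1 + k)) = m := by omega
  obtain ⟨ε, hε0, hs'⟩ := volPair_append h0 h
  refine ⟨(k.factorial : ℝ)⁻¹ * ε, by positivity, fun u ω w => ?_⟩
  have hk' : (k.factorial : ℝ) ≠ 0 := by positivity
  have hk1 : ((1 + k).factorial : ℝ) ≠ 0 := by positivity
  have e1 : starAlt m (1 + k) (wedgeAlt (nuForm m u) ω) w = ((1 + k).factorial : ℝ)⁻¹ *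
      ∑ g : Fin (1 + k) → Fin m, wedgeAlt (nuForm m u) ω (bv g) * volLeft h0 w (bv g) := by
    rw [starAlt, dif_pos hk, AlternatingMap.smul_apply, smul_eq_mul, sum_altMap_apply]
    congr 1
    refine Finset.sum_congr rfl fun g _ => ?_
    rw [AlternatingMap.smul_apply, contrMany_apply]
    rfl
  have e2 := sum_wedgeAlt (nuForm m u) ω (volLeft h0 w)
  have e3 : ∑ f : (Fin 1 → Fin m) × (Fin k → Fin m), nuForm m u (bv f.1) * ω (bv f.2) *
      volLeft h0 w (Fin.append (bv f.1) (bv f.2)) =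
      ε * starForm h ω (Matrix.vecCons u w) := by
    rw [Fintype.sum_prod_type, Finset.sum_comm, starForm_apply, Finset.mul_sum]
    refine Finset.sum_congr rfl fun κ _ => ?_
    have h4 : ∀ x : Vec m, volPair h (Matrix.vecCons x w) (bv κ) =
      ((volLeft h (bv κ)).curryLeft x) w := fun _ => rfl
    have hu : u = ∑ a, u a • (Pi.single a 1 : Vec m) :=
        (pi_eq_sum_univ' u).trans (by simp)
    have h5 : volPair h (Matrix.vecCons u w) (bv κ) =
        ∑ a, u a * volPair h (Matrix.vecCons (Pi.single a 1) w) (bv κ) := by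
      simp only [h4]
      conv_lhs => rw [hu]
      simp [map_sum, sum_altMap_apply]
    rw [h5, ← (Equiv.funUnique (Fin 1) (Fin m)).symm.sum_comp, smul_eq_mul, Finset.sum_mul,
      Finset.mul_sum]
    refine Finset.sum_congr rfl fun a _ => ?_
    rw [volLeft_apply, hs']
    have : nuForm m u (bv ((Equiv.funUnique (Fin 1) (Fin m)).symm a)) = u a := by
      change dotLin m u (Pi.single a 1) = u a
      rw [dotLin_single]
    rw [this]
    simp only [bv, Equiv.funUnique_symm_apply, uniqueElim_const]
    ring
  rw [e3] at e2
  rw [e1]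
  field_simp
  linear_combination e2

lemma projSim_apply (v : Vec m) (i : Fin m) : projSim m v i = v i - (m : ℝ)⁻¹ * ∑ j, v j := by
  simp [projSim, sumLin_apply]

lemma projSim_eq_self {v : Vec m} (hv : sumLin m v = 0) : projSim m v = v := by
  funext i
  rw [projSim_apply, ← sumLin_apply, hv, mul_zero, sub_zero]

lemma sumLin_projSim [NeZero m] (v : Vec m) : sumLin m (projSim m v) = 0 := by
  have : (m : ℝ) ≠ 0 := by exact_mod_cast NeZero.ne m
  simp only [sumLin_apply, projSim_apply, Finset.sum_sub_distrib, Finset.sum_const,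
    Finset.card_univ, Fintype.card_fin, nsmul_eq_mul]
  field_simp
  ring

lemma sumLin_self {x : Vec m} (hx : x ∈ simplexSet m) : sumLin m x = 1 := by
  rw [sumLin_apply]; exact hx.2

lemma neZero_of_mem_simplexSet {x : Vec m} (hx : x ∈ simplexSet m) : NeZero m :=
  ⟨by rintro rfl; simpa using hx.2⟩

lemma projSph_apply (u v : Vec m) : projSph m u v = v + (-dotLin m u v) • u := by
  simp [projSph, sub_eq_add_neg]

lemma dotLin_self {u : Vec m} (hu : u ∈ sphereSet m) : dotLin m u u = 1 := by
  rw [dotLin_apply, ← show ∑ i, u i ^ 2 = 1 from hu]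
  exact Finset.sum_congr rfl fun i _ => (sq (u i)).symm

lemma dotLin_projSph {u : Vec m} (hu : u ∈ sphereSet m) (v : Vec m) :
    dotLin m u (projSph m u v) = 0 := by
  rw [projSph_apply, map_add, map_smul, dotLin_self hu]
  simp

lemma projSph_symm (u : Vec m) (i j : Fin m) :
    projSph m u (Pi.single i 1) j = projSph m u (Pi.single j 1) i := by
  have : (Pi.single i 1 : Vec m) j = (Pi.single j 1 : Vec m) i := by
    simp [Pi.single_apply, eq_comm]
  simp only [projSph_apply, Pi.add_apply, Pi.smul_apply, dotLin_single, this, smul_eq_mul]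
  ring

lemma dPhi_apply (u v : Vec m) : dPhi m u v = (2 : ℝ) • diagLin u v := by
  funext i
  simp [dPhi, mul_assoc]

lemma sumLin_diagLin (u v : Vec m) : sumLin m (diagLin u v) = dotLin m u v := by
  simp [sumLin_apply, dotLin_apply]

lemma projSim_dPhi_projSph {u : Vec m} (hu : u ∈ sphereSet m) (v : Vec m) :
    projSim m (dPhi m u (projSph m u v)) = (2 : ℝ) • diagLin u (projSph m u v) := by
  rw [projSim_eq_self, dPhi_apply]
  rw [dPhi_apply, map_smul, sumLin_diagLin, dotLin_projSph hu, smul_zero]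

lemma map_const_smul (F : Vec m [⋀^Fin p]→ₗ[ℝ] N) (c : ℝ) (v : Fin p → Vec m) :
    F (fun i => c • v i) = c ^ p • F v := by
  have := F.toMultilinearMap.map_smul_univ (fun _ => c) v
  simpa using this

lemma starForm_comp_diagLin (h : p + q = m) (β : Vec m [⋀^Fin q]→ₗ[ℝ] N) (u : Vec m)
    (z : Fin p → Vec m) : starForm h (β.compLinearMap (diagLin u)) (fun i => diagLin u (z i)) =
      (∏ i, u i) • starForm h β z := by
  simp only [starForm_apply, AlternatingMap.compLinearMap_apply, Finset.smul_sum]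
  have := sum_smul_comp_eq β (volRight h fun i => diagLin u (z i)) _ _ (diagLin_symm u)
  simp only [volRight_apply, volPair_diagLin] at this
  simp only [this, smul_smul]

/-- The form `y ↦ ⋆ (D_y^* α_y)`, where `D_y` is the diagonal map with entries `y`. -/
def etaForm (h : (l + 1) + k = m) (α : Form m k) : Form m (l + 1) :=
  fun y => starForm h ((α y).compLinearMap (diagLin y))

/-- An ambient representative of the image of `α`, up to a constant factor. -/
def bubbleForm (h : (l + 1) + k = m) (α : Form m k) : Form m l := iU (etaForm h α)

lemma bubbleForm_apply (h : (l + 1) + k = m) (α : Form m k) (y : Vec m) (v : Fin l → Vec m) :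
    bubbleForm h α y v = starForm h ((α y).compLinearMap (diagLin y)) (Matrix.vecCons y v) := rfl

/-- The operator `u_N ⋆ Φ^*` from forms on the simplex to forms on the sphere. -/
abbrev sphOp (hl : m - (1 + k) = l) (a : FormOn m (simplexSet m) k) : FormOn m (sphereSet m) l :=
  bubbleSmul m l (castFormOn hl (starSph m k (phiPullTS m k a)))

lemma starForm_tangent (h : (l + 1) + k = m) (β : Vec m [⋀^Fin k]→ₗ[ℝ] ℝ) {u : Vec m}
    (hu : u ∈ sphereSet m) (w : Fin l → Vec m) :
    starForm h ((β.compLinearMap (projSim m)).compLinearMap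
      ((dPhi m u).comp (projSph m u))) (Matrix.vecCons u w) =
      2 ^ k * starForm h (β.compLinearMap (diagLin u)) (Matrix.vecCons u w) := by
  have h1 : ∀ κ : Fin k → Fin m, ((β.compLinearMap (projSim m)).compLinearMap
      ((dPhi m u).comp (projSph m u))) (bv κ) =
      2 ^ k * (β.compLinearMap (diagLin u)) (fun i => projSph m u (bv κ i)) := by
    intro κ
    simp only [AlternatingMap.compLinearMap_apply, LinearMap.comp_apply, projSim_dPhi_projSph hu]
    rw [map_const_smul, smul_eq_mul]
  simp only [starForm_apply, h1, smul_eq_mul]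
  have h2 := sum_smul_comp_eq (β.compLinearMap (diagLin u)) (volRight h (Matrix.vecCons u w))
    _ _ (projSph_symm u)
  have h3 : ∀ κ : Fin k → Fin m, volRight h (Matrix.vecCons u w)
      (fun i => projSph m u (bv κ i)) = volRight h (Matrix.vecCons u w) (bv κ) := by
    intro κ
    simp only [projSph_apply]
    exact map_add_smul_eq _ u (fun v i hi => volPair_eq_zero_of_eq h _ _ 0 i (by simp [hi])) _ _
  simp only [h3, smul_eq_mul, volRight_apply] at h2
  rw [← h2, Finset.mul_sum]
  exact Finset.sum_congr rfl fun κ _ => by ring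

/-- The image of a form under the operator is the restriction of its `bubbleForm`. -/
lemma exists_phiPullTS_bubbleForm (hk : 1 + k ≤ m) (hl : m - (1 + k) = l)
    (h : (l + 1) + k = m) :
    ∃ c : ℝ, c ≠ 0 ∧ ∀ α : Form m k,
      phiPullTS m l (resSim m l (c • bubbleForm h α)) = sphOp hl (resSim m k α) := by
  subst hl
  obtain ⟨ε, hε, hs⟩ := starAlt_wedgeAlt hk h
  refine ⟨ε * 2 ^ k / 2 ^ (m - (1 + k)), by positivity, fun α => ?_⟩
  funext u
  ext v
  have e1 : sphOp rfl (resSim m k α) u v = bubble m u.1 *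
      starAlt m (1 + k) (wedgeAlt (nuForm m u.1) (phiPullTS m k (resSim m k α) u))
        (fun i => projSph m u.1 (v i)) := rfl
  have e2 : phiPullTS m k (resSim m k α) u =
    ((α (Phi m u.1)).compLinearMap (projSim m)).compLinearMap
      ((dPhi m u.1).comp (projSph m u.1)) := rfl
  rw [e1, hs, e2, starForm_tangent h _ u.2]
  have e3 : phiPullTS m _ (resSim m _ ((ε * 2 ^ k / 2 ^ (m - (1 + k))) • bubbleForm h α)) u v =
    (ε * 2 ^ k / 2 ^ (m - (1 + k))) * bubbleForm h α (Phi m u.1)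
      (fun i => projSim m (dPhi m u.1 (projSph m u.1 (v i)))) := rfl
  rw [e3]
  simp only [projSim_dPhi_projSph u.2]
  rw [map_const_smul, bubbleForm_apply]
  have e4 : diagLin u.1 u.1 = Phi m u.1 := by
    funext i; simp [Phi, sq]
  have e5 : (α (Phi m u.1)).compLinearMap (diagLin (Phi m u.1)) =
      ((α (Phi m u.1)).compLinearMap (diagLin u.1)).compLinearMap (diagLin u.1) := by
    ext v
    simp only [AlternatingMap.compLinearMap_apply]
    congr 1
    funext i j
    simp [Phi, sq, mul_assoc]
  have e6 : (Matrix.vecCons (Phi m u.1) fun i => diagLin u.1 (projSph m u.1 (v i))) =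
      fun i => diagLin u.1 (Matrix.vecCons u.1 (fun i => projSph m u.1 (v i)) i) := by
    rw [vecCons_comp, e4]
  rw [e5, e6, starForm_comp_diagLin, bubble]
  simp only [smul_eq_mul]
  field_simp

lemma vanishBdry_bubbleForm (h : (l + 1) + k = m) (c : ℝ) (α : Form m k) :
    vanishBdry m l (resSim m l (c • bubbleForm h α)) := by
  intro x i hxi v hv
  have e1 : resSim m l (c • bubbleForm h α) x v =
      c * bubbleForm h α x.1 (fun j => projSim m (v j)) := rfl
  have e2 : ∀ j, projSim m (v j) = v j := fun j =>
    projSim_eq_self (by rw [sumLin_apply]; exact (hv j).1)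
  rw [e1, bubbleForm_apply, starForm_apply, Finset.sum_eq_zero, mul_zero]
  intro κ _
  by_cases hκ : ∃ j, κ j = i
  · obtain ⟨j, hj⟩ := hκ
    rw [AlternatingMap.compLinearMap_apply, AlternatingMap.map_coord_zero _ j, smul_zero]
    rw [diagLin_single, hj, hxi, zero_smul]
  · push Not at hκ
    rw [volPair_eq_zero_of_forall h (LinearMap.proj i), zero_smul]
    · intro h0
      have := LinearMap.congr_fun h0 (Pi.single i 1)
      simp at this
    · intro j
      refine Fin.cases ?_ (fun j => ?_) j
      · simpa using hxi
      · simpa [e2] using (hv j).2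
    · intro j
      simp [Ne.symm (hκ j)]

/-- Two forms agree at the interior points of the simplex if their pullbacks to the sphere do. -/
lemma eq_of_phiPullTS_eq {β β' : Form m k}
    (h : phiPullTS m k (resSim m k β) = phiPullTS m k (resSim m k β')) (x : Vec m)
    (hx : x ∈ simplexSet m) (hpos : ∀ i, 0 < x i) (v : Fin k → Vec m)
    (hv : ∀ j, sumLin m (v j) = 0) : β x v = β' x v := by
  let u : Vec m := fun i => Real.sqrt (x i)
  have hu0 : ∀ i, u i ≠ 0 := fun i => (Real.sqrt_pos.2 (hpos i)).ne'
  have hux : Phi m u = x := by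
    funext i; exact Real.sq_sqrt (hx.1 i)
  have hu : u ∈ sphereSet m := by
    have : ∑ i, Phi m u i = 1 := by rw [hux]; exact hx.2
    exact this
  let w : Fin k → Vec m := fun j i => v j i / (2 * u i)
  have hdw : ∀ j, dPhi m u (w j) = v j := by
    intro j; funext i
    have := hu0 i
    simp only [dPhi_apply, w, Pi.smul_apply, diagLin_apply, smul_eq_mul]
    field_simp
  have hw : ∀ j, projSph m u (w j) = w j := by
    intro j
    have : dotLin m u (w j) = 0 := by
      have h1 : (2 : ℝ) • dotLin m u (w j) = 0 := by
        rw [← sumLin_diagLin, ← map_smul, ← dPhi_apply, hdw, hv]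
      simpa using h1
    rw [projSph_apply, this]
    simp
  have key : ∀ γ : Form m k, phiPullTS m k (resSim m k γ) ⟨u, hu⟩ w = γ x v := by
    intro γ
    have e : phiPullTS m k (resSim m k γ) ⟨u, hu⟩ w =
      γ (Phi m u) (fun j => projSim m (dPhi m u (projSph m u (w j)))) := rfl
    rw [e, hux]
    congr 1
    funext j
    rw [hw, hdw, projSim_eq_self (hv j)]
  rw [← key β, h, key]

/-- Continuous forms that agree at interior points of the simplex have equal restrictions. -/
lemma resSim_eq_of_forall {β β' : Form m k} (hβ : ∀ v, Continuous fun x => β x v)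
    (hβ' : ∀ v, Continuous fun x => β' x v)
    (h : ∀ x ∈ simplexSet m, (∀ i, 0 < x i) → ∀ v : Fin k → Vec m,
      (∀ j, sumLin m (v j) = 0) → β x v = β' x v) : resSim m k β = resSim m k β' := by
  funext x
  ext v
  have hm := neZero_of_mem_simplexSet x.2
  have hm0 : (m : ℝ) ≠ 0 := by exact_mod_cast NeZero.ne m
  have hmpos : (0 : ℝ) < (m : ℝ)⁻¹ := by positivity
  change β x.1 (fun j => projSim m (v j)) = β' x.1 (fun j => projSim m (v j))
  set w := fun j => projSim m (v j) with hw
  let c : ℝ → Vec m := fun t i => (1 - t) * x.1 i + t * (m : ℝ)⁻¹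
  have hc : Continuous c := by fun_prop
  have hclosed : IsClosed {t | β (c t) w = β' (c t) w} :=
    isClosed_eq ((hβ w).comp hc) ((hβ' w).comp hc)
  have hsub : Set.Ioo (0 : ℝ) 1 ⊆ {t | β (c t) w = β' (c t) w} := by
    rintro t ⟨h0, h1⟩
    have hp : ∀ i, 0 < c t i := fun i => by
      have := x.2.1 i
      have h2 : 0 ≤ (1 - t) * x.1 i := mul_nonneg (by linarith) this
      have h3 : 0 < t * (m : ℝ)⁻¹ := mul_pos h0 hmpos
      simp only [c]; linarith
    refine h (c t) ⟨fun i => (hp i).le, ?_⟩ hp w fun j => sumLin_projSim _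
    simp only [c, Finset.sum_add_distrib, ← Finset.mul_sum, x.2.2, Finset.sum_const,
      Finset.card_univ, Fintype.card_fin, nsmul_eq_mul]
    field_simp
    ring
  have h2 := hclosed.closure_subset_iff.2 hsub
  rw [closure_Ioo zero_ne_one] at h2
  have h3 := h2 (Set.left_mem_Icc.2 zero_le_one)
  have h4 : c 0 = x.1 := by funext i; simp [c]
  simpa [h4] using h3

/-- A tensor killed by `x`, with `x` in the simplex, is determined on tangent vectors. -/
lemma eq_zero_of_sumLin {x : Vec m} (hx : sumLin m x = 1) (F : Vec m [⋀^Fin k]→ₗ[ℝ] ℝ)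
    (hF : ∀ v i, v i = x → F v = 0) (h : ∀ v, (∀ j, sumLin m (v j) = 0) → F v = 0) : F = 0 := by
  ext v
  rw [← map_add_smul_eq F x hF v fun i => -sumLin m (v i), AlternatingMap.zero_apply]
  exact h _ fun j => by simp [hx]

lemma iU_eq_zero_of_eq (η : Form m (k + 1)) (x : Vec m) (v : Fin k → Vec m) (i : Fin k)
    (hv : v i = x) : iU η x v = 0 :=
  AlternatingMap.map_eq_zero_of_eq (η x) (Matrix.vecCons x v) (i := 0) (j := i.succ)
    (by simp [hv]) (Fin.succ_ne_zero i).symm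

lemma eq_of_sphOp_eq (hk : 1 + k ≤ m) (hl : m - (1 + k) = l) {α α' : Form m k}
    (hα : ∀ v, Continuous fun x => α x v) (hα' : ∀ v, Continuous fun x => α' x v)
    (hs : sphOp hl (resSim m k α) = sphOp hl (resSim m k α')) :
    resSim m k α = resSim m k α' := by
  have h : (l + 1) + k = m := by omega
  have h' : l + (k + 1) = m := by omega
  obtain ⟨c, hc, hb⟩ := exists_phiPullTS_bubbleForm hk hl h
  rw [← hb, ← hb] at hs
  refine resSim_eq_of_forall hα hα' fun x hx hpos v hv => ?_
  have hx1 := sumLin_self hx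
  have hx0 : x ≠ 0 := by rintro rfl; simp at hx1
  have h1 : bubbleForm h α x - bubbleForm h α' x = 0 := by
    refine eq_zero_of_sumLin hx1 _ (fun v i hi => ?_) fun v hv => ?_
    · rw [AlternatingMap.sub_apply, bubbleForm, bubbleForm, iU_eq_zero_of_eq _ _ _ i hi,
        iU_eq_zero_of_eq _ _ _ i hi, sub_zero]
    · have := eq_of_phiPullTS_eq hs x hx hpos v hv
      have h2 : c * bubbleForm h α x v = c * bubbleForm h α' x v := this
      rw [AlternatingMap.sub_apply, mul_left_cancel₀ hc h2, sub_self]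
  set μ := (α x - α' x).compLinearMap (diagLin x) with hμ
  have h2 : ∀ w : Fin l → Vec m, starForm h μ (Matrix.vecCons x w) = 0 := by
    intro w
    have := congrArg (fun F => F w) h1
    simp only [AlternatingMap.sub_apply, bubbleForm_apply, AlternatingMap.zero_apply] at this
    rw [← this, ← AlternatingMap.sub_apply, ← starForm_sub]
    rfl
  obtain ⟨C, hC, hw⟩ := starForm_wedgeOne h' h
  obtain ⟨C', hC', hw'⟩ := starForm_starForm h' (by omega : (k + 1) + l = m)
  have h3 : wedgeOne (dotLin m x) μ = 0 := by
    have e : starForm h' (wedgeOne (dotLin m x) μ) = 0 := by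
      ext w; rw [hw, h2, mul_zero, AlternatingMap.zero_apply]
    have := hw' (wedgeOne (dotLin m x) μ)
    rw [e, starForm_zero, eq_comm] at this
    exact (smul_eq_zero.1 this).resolve_left hC'
  let w : Fin k → Vec m := fun j i => v j i / x i
  have hdw : ∀ j, diagLin x (w j) = v j := by
    intro j; funext i
    have := (hpos i).ne'
    simp only [w, diagLin_apply]
    field_simp
  have h4 := wedgeOne_cons (dotLin m x) μ x w fun j => by rw [← sumLin_diagLin, hdw, hv]
  rw [h3, AlternatingMap.zero_apply, eq_comm, mul_eq_zero] at h4
  have h5 := h4.resolve_left (dotLin_self_ne_zero hx0)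
  rw [hμ, AlternatingMap.compLinearMap_apply] at h5
  simp only [hdw, AlternatingMap.sub_apply] at h5
  linarith

open MvPolynomial

lemma homogeneousComponent_mul {t : MvPolynomial (Fin m) ℝ} {e : ℕ} (ht : t.IsHomogeneous e)
    (g : MvPolynomial (Fin m) ℝ) (r : ℕ) :
    homogeneousComponent (e + r) (t * g) = t * homogeneousComponent r g := by
  conv_lhs => rw [← sum_homogeneousComponent g]
  rw [Finset.mul_sum, map_sum]
  have h : ∀ i, homogeneousComponent (e + r) (t * homogeneousComponent i g) =
      if i = r then t * homogeneousComponent i g else 0 := by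
    intro i
    rw [homogeneousComponent_of_mem
      ((mem_homogeneousSubmodule _ _).2 (ht.mul (homogeneousComponent_isHomogeneous i g)))]
    simp [eq_comm]
  simp only [h, Finset.sum_ite_eq', Finset.mem_range]
  split_ifs with h1
  · rfl
  · rw [homogeneousComponent_eq_zero _ _ (by omega), mul_zero]

/-- The quotient of two homogeneous polynomials is homogeneous. -/
lemma isHomogeneous_of_mul {t g : MvPolynomial (Fin m) ℝ} {e r : ℕ} (ht : t.IsHomogeneous e)
    (ht0 : t ≠ 0) (h : (t * g).IsHomogeneous (e + r)) : g.IsHomogeneous r := by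
  have h1 := homogeneousComponent_mul ht g r
  rw [homogeneousComponent_eq_self h] at h1
  rw [mul_left_cancel₀ ht0 h1]
  exact homogeneousComponent_isHomogeneous r g

/-- If an algebra endomorphism is trivial on the variables modulo `t`, it is trivial modulo `t`. -/
lemma dvd_sub_algHom (t : MvPolynomial (Fin m) ℝ)
    (φ : MvPolynomial (Fin m) ℝ →ₐ[ℝ] MvPolynomial (Fin m) ℝ) (hφ : ∀ j, t ∣ X j - φ (X j))
    (f : MvPolynomial (Fin m) ℝ) : t ∣ f - φ f := by
  have h : Ideal.Quotient.mkₐ ℝ (Ideal.span {t}) =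
      (Ideal.Quotient.mkₐ ℝ (Ideal.span {t})).comp φ := by
    refine algHom_ext fun j => ?_
    rw [AlgHom.comp_apply, Ideal.Quotient.mkₐ_eq_mk, Ideal.Quotient.mk_eq_mk_iff_sub_mem,
      Ideal.mem_span_singleton]
    exact hφ j
  have h1 := AlgHom.congr_fun h f
  rwa [AlgHom.comp_apply, Ideal.Quotient.mkₐ_eq_mk, Ideal.Quotient.mk_eq_mk_iff_sub_mem,
    Ideal.mem_span_singleton] at h1

/-- A product of distinct variables divides whatever each of the variables divides. -/
lemma prod_X_dvd {h : Fin p → Fin m} (hh : Function.Injective h) {f : MvPolynomial (Fin m) ℝ}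
    (hf : ∀ i, X (h i) ∣ f) : ∏ i, X (h i) ∣ f := by
  refine Fintype.prod_dvd_of_isRelPrime (fun i j hij => ?_) hf
  refine (X_prime.irreducible.isRelPrime_iff_not_dvd).2 fun hd => hij (hh ?_)
  exact X_dvd_X.1 hd

/-- Polynomials that agree at all points of the open orthant are equal. -/
lemma eq_of_eval_pos {f g : MvPolynomial (Fin m) ℝ}
    (h : ∀ y : Vec m, (∀ i, 0 < y i) → eval y f = eval y g) : f = g :=
  funext_set (fun _ => Set.Ioi 0) (fun _ => Set.Ioi_infinite 0)
    fun y hy => h y fun i => hy i (Set.mem_univ i)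

/-- The sum of the variables. -/
def sumX (m : ℕ) : MvPolynomial (Fin m) ℝ := ∑ i, X i

lemma eval_sumX (y : Vec m) : eval y (sumX m) = sumLin m y := by
  simp [sumX, sumLin_apply]

lemma sumX_isHomogeneous : (sumX m).IsHomogeneous 1 :=
  IsHomogeneous.sum _ _ _ fun i _ => isHomogeneous_X _ i

/-- Homogenization to degree `d` by means of the sum of the variables. -/
def homog (m d : ℕ) : MvPolynomial (Fin m) ℝ →ₗ[ℝ] MvPolynomial (Fin m) ℝ :=
  ∑ j ∈ Finset.range (d + 1),
    (LinearMap.mulLeft ℝ (sumX m ^ (d - j))).comp (homogeneousComponent j)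

lemma homog_isHomogeneous (d : ℕ) (f : MvPolynomial (Fin m) ℝ) :
    (homog m d f).IsHomogeneous d := by
  rw [homog, LinearMap.sum_apply]
  refine IsHomogeneous.sum _ _ _ fun j hj => ?_
  have := (sumX_isHomogeneous (m := m).pow (d - j)).mul (homogeneousComponent_isHomogeneous j f)
  have e : 1 * (d - j) + j = d := by have := Finset.mem_range.1 hj; omega
  rwa [e] at this

lemma eval_homog {d : ℕ} {f : MvPolynomial (Fin m) ℝ} (hf : f.totalDegree ≤ d) {y : Vec m}
    (hy : sumLin m y = 1) : eval y (homog m d f) = eval y f := by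
  have h : ∑ j ∈ Finset.range (d + 1), homogeneousComponent j f = f := by
    conv_rhs => rw [← sum_homogeneousComponent f]
    refine (Finset.sum_subset (by simpa using hf) fun j _ hj => ?_).symm
    exact homogeneousComponent_eq_zero _ _ (by simpa using hj)
  conv_rhs => rw [← h]
  simp [homog, eval_sumX, hy]

/-- Alternating tensors with polynomial coefficients. -/
abbrev PForm (m k : ℕ) := Vec m [⋀^Fin k]→ₗ[ℝ] MvPolynomial (Fin m) ℝ

/-- The differential form defined by an alternating tensor with polynomial coefficients. -/
def evalForm (A : PForm m k) : Form m k :=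
  fun y => (aeval y).toLinearMap.compAlternatingMap A

lemma evalForm_apply (A : PForm m k) (y : Vec m) (v : Fin k → Vec m) :
    evalForm A y v = eval y (A v) := by
  simp [evalForm, aeval_eq_eval]

lemma evalForm_starForm (h : p + q = m) (B : PForm m q) (y : Vec m) :
    evalForm (starForm h B) y = starForm h (evalForm B y) := by
  ext v
  simp [evalForm_apply, starForm_apply, smul_eval]

lemma continuous_evalForm (A : PForm m k) (v : Fin k → Vec m) :
    Continuous fun y => evalForm A y v := by
  simp only [evalForm_apply]
  exact MvPolynomial.continuous_eval _

lemma degLE_iff (d : ℕ) (f : MvPolynomial (Fin m) ℝ) : degLE (d : ℤ) f ↔ f.totalDegree ≤ d := by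
  rw [degLE, totalDegree, Finset.sup_le_iff]
  exact forall₂_congr fun _ _ => Nat.cast_le

lemma evalForm_mem_PL {A : PForm m k} {d : ℕ} (hA : ∀ v, (A v).totalDegree ≤ d) :
    evalForm A ∈ PL m k d :=
  fun v => ⟨A v, (degLE_iff _ _).2 (hA v), fun x => evalForm_apply A x v⟩

lemma exists_evalForm_of_mem_PL {α : Form m k} {d : ℕ} (hα : α ∈ PL m k d) :
    ∃ A : PForm m k, (∀ v, (A v).totalDegree ≤ d) ∧ α = evalForm A := by
  choose f hf hf' using hα
  refine ⟨{ toFun := f, map_update_add' := ?_, map_update_smul' := ?_,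
            map_eq_zero_of_eq' := ?_ }, fun v => (degLE_iff _ _).1 (hf v), ?_⟩
  · intro _ v i x y
    refine MvPolynomial.funext fun z => ?_
    simp only [map_add, ← hf']
    convert AlternatingMap.map_update_add (α z) v i x y
  · intro _ v i c x
    refine MvPolynomial.funext fun z => ?_
    rw [smul_eval, ← hf', ← hf', ← smul_eq_mul]
    convert AlternatingMap.map_update_smul (α z) v i c x
  · intro v i j hv hij
    refine MvPolynomial.funext fun z => ?_
    rw [← hf', map_zero]
    exact AlternatingMap.map_eq_zero_of_eq (α z) v hv hij
  · funext x
    ext v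
    rw [evalForm_apply, hf']
    rfl

lemma continuous_of_mem_PL {α : Form m k} {d : ℕ} (hα : α ∈ PL m k d) (v : Fin k → Vec m) :
    Continuous fun y => α y v := by
  obtain ⟨A, -, rfl⟩ := exists_evalForm_of_mem_PL hα
  exact continuous_evalForm A v

/-- Interior product with the radial vector field, on polynomial coefficients. -/
def iX (A : PForm m (k + 1)) : PForm m k :=
  ∑ i, (LinearMap.mulLeft ℝ (X i)).compAlternatingMap (A.curryLeft (Pi.single i 1))

lemma iX_apply (A : PForm m (k + 1)) (v : Fin k → Vec m) :
    iX A v = ∑ i, X i * A (Matrix.vecCons (Pi.single i 1) v) := by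
  simp [iX, sum_altMap_apply]

lemma evalForm_iX (A : PForm m (k + 1)) : evalForm (iX A) = iU (evalForm A) := by
  funext y
  ext v
  have h : ∀ L : Vec m →ₗ[ℝ] (Vec m [⋀^Fin k]→ₗ[ℝ] ℝ), L y = ∑ i, y i • L (Pi.single i 1) := by
    intro L
    conv_lhs => rw [← Finset.univ_sum_single y]
    rw [map_sum]
    refine Finset.sum_congr rfl fun i _ => ?_
    rw [← map_smul, ← Pi.single_smul', smul_eq_mul, mul_one]
  rw [iU, h, sum_altMap_apply, evalForm_apply, iX_apply]
  simp [evalForm_apply]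

lemma iX_isHomogeneous {A : PForm m (k + 1)} {d : ℕ} (hA : ∀ v, (A v).IsHomogeneous d)
    (v : Fin k → Vec m) : (iX A v).IsHomogeneous (d + 1) := by
  rw [iX_apply]
  refine IsHomogeneous.sum _ _ _ fun i _ => ?_
  exact add_comm 1 d ▸ (isHomogeneous_X _ i).mul (hA _)

/-- Every polynomial form is homogeneous of the prescribed degree up to restriction. -/
lemma exists_homogeneous_of_mem_PL {α : Form m k} {d : ℕ} (hα : α ∈ PL m k d) :
    ∃ A : PForm m k, (∀ v, (A v).IsHomogeneous d) ∧
      ∀ y, sumLin m y = 1 → α y = evalForm A y := by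
  obtain ⟨A, hA, rfl⟩ := exists_evalForm_of_mem_PL hα
  refine ⟨(homog m d).compAlternatingMap A, fun v => homog_isHomogeneous _ _, fun y hy => ?_⟩
  ext v
  rw [evalForm_apply, evalForm_apply]
  exact (eval_homog (hA v) hy).symm

lemma eval_smul_of_isHomogeneous {f : MvPolynomial (Fin m) ℝ} {d : ℕ} (hf : f.IsHomogeneous d)
    (c : ℝ) (y : Vec m) : eval (c • y) f = c ^ d * eval y f := by
  rw [eval_eq', eval_eq', Finset.mul_sum]
  refine Finset.sum_congr rfl fun e he => ?_
  have h : ∑ i, e i = d := by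
    rw [hf.degree_eq_sum_deg_support he]
    exact (Finset.sum_subset (Finset.subset_univ _) fun i _ hi =>
      Finsupp.notMem_support_iff.1 hi).symm
  simp only [Pi.smul_apply, smul_eq_mul, mul_pow, Finset.prod_mul_distrib, Finset.prod_pow_eq_pow_sum,
    h]
  ring

/-- The trace of a homogeneous form on the face `y i = 0` is the obstruction to divisibility of
its components by `X i`. -/
lemma X_dvd_of_vanish (hm : 2 ≤ m) {B : PForm m l} {D : ℕ} (hB : ∀ v, (B v).IsHomogeneous D)
    (hkill : ∀ y v i, v i = y → evalForm B y v = 0)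
    (hbd : ∀ y ∈ simplexSet m, ∀ i, y i = 0 → ∀ v : Fin l → Vec m,
      (∀ j, sumLin m (v j) = 0 ∧ v j i = 0) → evalForm B y v = 0)
    (κ : Fin l → Fin m) (i : Fin m) (hκ : ∀ j, κ j ≠ i) : X i ∣ B (bv κ) := by
  let φ : MvPolynomial (Fin m) ℝ →ₐ[ℝ] MvPolynomial (Fin m) ℝ :=
    aeval fun j => if j = i then 0 else X j
  have h1 := dvd_sub_algHom (X i) φ (fun j => by
    by_cases hj : j = i <;> simp [φ, hj]) (B (bv κ))
  suffices h : φ (B (bv κ)) = 0 by rwa [h, sub_zero] at h1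
  refine eq_of_eval_pos fun y hy => ?_
  rw [map_zero]
  let z : Vec m := Function.update y i 0
  have h2 : eval y (φ (B (bv κ))) = eval z (B (bv κ)) := by
    have : (aeval y).comp φ = aeval (R := ℝ) z := by
      refine algHom_ext fun j => ?_
      by_cases hj : j = i
      · subst hj; simp [φ, z]
      · simp [φ, z, hj]
    simpa [aeval_eq_eval] using AlgHom.congr_fun this (B (bv κ))
  have hz : ∀ j, 0 ≤ z j := by
    intro j
    by_cases hj : j = i
    · subst hj; simp [z]
    · simpa [z, hj] using (hy j).le
  have hzi : z i = 0 := by simp [z]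
  have hs : 0 < ∑ j, z j := by
    have : Nontrivial (Fin m) := Fin.nontrivial_iff_two_le.2 hm
    obtain ⟨j, hj⟩ := exists_ne i
    refine Finset.sum_pos' (fun j _ => hz j) ⟨j, Finset.mem_univ _, ?_⟩
    simpa [z, hj] using hy j
  set s := ∑ j, z j with hs'
  let x : Vec m := s⁻¹ • z
  have hx : x ∈ simplexSet m := by
    refine ⟨fun j => mul_nonneg (inv_pos.2 hs).le (hz j), ?_⟩
    simp only [x, Pi.smul_apply, smul_eq_mul, ← Finset.mul_sum]
    exact inv_mul_cancel₀ hs.ne'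
  have h3 : z = s • x := by
    simp [x, smul_smul, hs.ne']
  rw [h2, h3, eval_smul_of_isHomogeneous (hB _), ← evalForm_apply,
    ← map_add_smul_eq (evalForm B x) x (hkill x) (bv κ) fun _ => -1, hbd x hx i, mul_zero]
  · simp [x, hzi]
  · intro j
    constructor
    · rw [map_add, map_smul, sumLin_self hx]
      simp [sumLin_apply]
    · simp [x, hzi, (hκ j).symm]

lemma prod_X_dvd_starForm (h : p + l = m) (B : PForm m l)
    (hB : ∀ (κ : Fin l → Fin m) i, (∀ j, κ j ≠ i) → X i ∣ B (bv κ)) (g : Fin p → Fin m) :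
    ∏ i, X (g i) ∣ starForm h B (bv g) := by
  by_cases hg : Function.Injective g
  · refine prod_X_dvd hg fun i => ?_
    rw [starForm_apply]
    refine Finset.dvd_sum fun κ _ => ?_
    by_cases h0 : volPair h (bv g) (bv κ) = 0
    · simp [h0]
    · have := ((joinTup_injective h).1 (injective_of_volPair_bv_ne_zero h h0)).2.2 i
      rw [smul_eq_C_mul]
      exact (hB κ (g i) fun j hj => this j hj.symm).mul_left _
  · simp only [Function.Injective] at hg
    push Not at hg
    obtain ⟨i, j, hij, hne⟩ := hg
    rw [AlternatingMap.map_eq_zero_of_eq _ (bv g) (i := i) (j := j)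
      (congrArg (fun t => (Pi.single t 1 : Vec m)) hij) hne]
    exact dvd_zero _

/-- The multilinear map with prescribed values on tuples of basis vectors. -/
def ofBasis (G : (Fin p → Fin m) → MvPolynomial (Fin m) ℝ) :
    MultilinearMap ℝ (fun _ : Fin p => Vec m) (MvPolynomial (Fin m) ℝ) :=
  ∑ g, ((MultilinearMap.mkPiAlgebra ℝ (Fin p) ℝ).compLinearMap
    fun i => LinearMap.proj (g i)).smulRight (G g)

lemma ofBasis_apply (G : (Fin p → Fin m) → MvPolynomial (Fin m) ℝ) (v : Fin p → Vec m) :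
    ofBasis G v = ∑ g, (∏ i, v i (g i)) • G g := by
  simp [ofBasis]

/-- If the components of `ω` are divisible by the corresponding products of variables, then `ω`
is the pullback of a polynomial form along the diagonal maps. -/
lemma exists_compLinearMap_diagLin {ω : PForm m p} {r : ℕ} (hω : ∀ v, (ω v).IsHomogeneous (p + r))
    (hd : ∀ g : Fin p → Fin m, ∏ i, X (g i) ∣ ω (bv g)) :
    ∃ G : PForm m p, (∀ v, (G v).IsHomogeneous r) ∧
      ∀ y, (evalForm G y).compLinearMap (diagLin y) = evalForm ω y := by
  choose G hG using hd
  have hGr : ∀ g, (G g).IsHomogeneous r := by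
    intro g
    have h1 : (∏ i, X (g i) : MvPolynomial (Fin m) ℝ).IsHomogeneous p := by
      simpa using IsHomogeneous.prod Finset.univ (fun i => (X (g i) : MvPolynomial (Fin m) ℝ))
        (fun _ => 1) fun i _ => isHomogeneous_X _ _
    refine isHomogeneous_of_mul h1 (Finset.prod_ne_zero_iff.2 fun i _ => X_ne_zero _) ?_
    rw [← hG]
    exact hω _
  have key : ∀ (y : Vec m) (z : Fin p → Vec m),
      eval y (ofBasis G fun i => diagLin y (z i)) = evalForm ω y z := by
    intro y z
    rw [expand (evalForm ω y) z, ofBasis_apply, map_sum]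
    refine Finset.sum_congr rfl fun g _ => ?_
    rw [smul_eval, evalForm_apply, hG, map_mul, map_prod, smul_eq_mul]
    simp only [diagLin_apply, eval_X, Finset.prod_mul_distrib]
    ring
  refine ⟨{ ofBasis G with map_eq_zero_of_eq' := ?_ }, fun v => ?_, fun y => ?_⟩
  · intro v i j hv hij
    refine eq_of_eval_pos fun y hy => ?_
    let w : Fin p → Vec m := fun i j => v i j / y j
    have hw : v = fun i => diagLin y (w i) := by
      funext i j
      have := (hy j).ne'
      simp only [w, diagLin_apply]
      field_simp
    have : eval y (ofBasis G v) = 0 := by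
      rw [hw, key]
      exact AlternatingMap.map_eq_zero_of_eq _ _ (by simp only [w, hv]) hij
    simpa using this
  · have : (ofBasis G v).IsHomogeneous r := by
      rw [ofBasis_apply]
      refine IsHomogeneous.sum _ _ _ fun g _ => ?_
      rw [smul_eq_C_mul]
      exact (hGr g).C_mul _
    exact this
  · ext z
    rw [AlternatingMap.compLinearMap_apply, evalForm_apply, ← key]
    rfl

lemma starForm_isHomogeneous (h : p + q = m) {B : PForm m q} {D : ℕ}
    (hB : ∀ v, (B v).IsHomogeneous D) (v : Fin p → Vec m) : (starForm h B v).IsHomogeneous D := by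
  rw [starForm_apply]
  refine IsHomogeneous.sum _ _ _ fun κ _ => ?_
  rw [smul_eq_C_mul]
  exact (hB _).C_mul _

/-- The Hodge dual of a homogeneous form with vanishing trace is a pullback along the diagonal
maps. -/
lemma exists_compLinearMap_diagLin_eq_starForm (hm : 2 ≤ m) (h : p + l = m) {B : PForm m l}
    {r : ℕ} (hB : ∀ v, (B v).IsHomogeneous (p + r))
    (hkill : ∀ y v i, v i = y → evalForm B y v = 0)
    (hbd : ∀ y ∈ simplexSet m, ∀ i, y i = 0 → ∀ v : Fin l → Vec m,
      (∀ j, sumLin m (v j) = 0 ∧ v j i = 0) → evalForm B y v = 0) :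
    ∃ G : PForm m p, (∀ v, (G v).IsHomogeneous r) ∧
      ∀ y, (evalForm G y).compLinearMap (diagLin y) = starForm h (evalForm B y) := by
  obtain ⟨G, hG, hG'⟩ := exists_compLinearMap_diagLin (starForm_isHomogeneous h hB)
    (prod_X_dvd_starForm h B (X_dvd_of_vanish hm hB hkill hbd))
  exact ⟨G, hG, fun y => by rw [hG', evalForm_starForm]⟩

lemma smul_mem_PL {α : Form m k} {d : ℕ} (hα : α ∈ PL m k d) (c : ℝ) : c • α ∈ PL m k d := by
  intro v
  obtain ⟨f, hf, hf'⟩ := hα v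
  refine ⟨c • f, (degLE_iff _ _).2 ((totalDegree_smul_le _ _).trans ((degLE_iff _ _).1 hf)), ?_⟩
  intro x
  rw [smul_eval, ← hf']
  rfl

lemma starForm_comp_diagLin_mem_PL (h : p + q = m) {β : Form m q} {r : ℕ} (hβ : β ∈ PL m q r) :
    (fun y => starForm h ((β y).compLinearMap (diagLin y))) ∈ PL m p ((r + q : ℕ) : ℤ) := by
  intro v
  obtain ⟨A, hA, rfl⟩ := exists_evalForm_of_mem_PL hβ
  refine ⟨∑ κ : Fin q → Fin m, volPair h v (bv κ) • ((∏ i, X (κ i)) * A (bv κ)),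
    (degLE_iff _ _).2 ?_, fun y => ?_⟩
  · refine (totalDegree_finsetSum_le (d := r + q) fun κ _ => ?_)
    refine (totalDegree_smul_le _ _).trans ((totalDegree_mul _ _).trans ?_)
    rw [add_comm]
    refine add_le_add (hA _) ((totalDegree_finsetProd _ _).trans ?_)
    simp
  · rw [starForm_apply, map_sum]
    refine Finset.sum_congr rfl fun κ _ => ?_
    rw [smul_eval, map_mul, map_prod, smul_eq_mul, AlternatingMap.compLinearMap_apply]
    have : (fun i => diagLin y (bv κ i)) = fun i => y (κ i) • bv κ i := by
      funext i; exact diagLin_single _ _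
    rw [this, ← AlternatingMap.coe_multilinearMap, MultilinearMap.map_smul_univ]
    simp [evalForm_apply]

lemma etaForm_mem_PL (h : (l + 1) + k = m) {α : Form m k} {r : ℕ} (hα : α ∈ PL m k r) :
    etaForm h α ∈ PL m (l + 1) ((r + k : ℕ) : ℤ) :=
  starForm_comp_diagLin_mem_PL h hα

lemma continuous_iU {η : Form m (k + 1)} {d : ℕ} (hη : η ∈ PL m (k + 1) d) (v : Fin k → Vec m) :
    Continuous fun y => iU η y v := by
  obtain ⟨A, -, rfl⟩ := exists_evalForm_of_mem_PL hη
  rw [← evalForm_iX]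
  exact continuous_evalForm _ v

lemma bubbleForm_smul (h : (l + 1) + k = m) (c : ℝ) (α : Form m k) :
    bubbleForm h (c • α) = c • bubbleForm h α := by
  funext y
  ext v
  have e : ((c • α) y).compLinearMap (diagLin y) = c • (α y).compLinearMap (diagLin y) := rfl
  rw [bubbleForm_apply, e, starForm_smul]
  rfl

/-- If `⋆ B` is the pullback of `G` along the diagonal maps, then `B` is proportional to the image
of a contraction of `G`. -/
lemma exists_bubbleForm_curryLeft (h : (l + 1) + k = m) (hh : (k + 1) + l = m) (e : Fin m) :
    ∃ c : ℝ, c ≠ 0 ∧ ∀ (B : PForm m l) (G : PForm m (k + 1)),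
      (∀ y v i, v i = y → evalForm B y v = 0) →
      (∀ y, (evalForm G y).compLinearMap (diagLin y) = starForm hh (evalForm B y)) →
      ∀ y : Vec m, (∀ i, 0 < y i) → ∀ v,
        bubbleForm h (fun y => (evalForm G y).curryLeft (Pi.single e 1)) y v =
          c * evalForm B y v := by
  have h2 : l + (k + 1) = m := by omega
  obtain ⟨C, hC, hw⟩ := starForm_wedgeOne h2 h
  obtain ⟨C', hC', hs⟩ := starForm_starForm hh h2
  refine ⟨C⁻¹ * C', mul_ne_zero (inv_ne_zero hC) hC', fun B G hkill hG y hy v => ?_⟩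
  have hy0 : y ≠ 0 := by
    rintro rfl
    exact (hy e).ne' rfl
  set ω := (evalForm G y).compLinearMap (diagLin y) with hω
  set x : Vec m := (y e)⁻¹ • Pi.single e 1 with hx
  have hx1 : dotLin m y x = 1 := by
    rw [hx, map_smul, dotLin_single, smul_eq_mul, inv_mul_cancel₀ (hy e).ne']
  have h1 := eq_wedgeOne_curryLeft (dotLin m y) x hx1 ω fun z hz => by
    rw [hω, hG]
    exact starForm_eq_zero_of_forall hh _ y hy0 (hkill y) z hz
  have h3 : ω.curryLeft x =
      ((evalForm G y).curryLeft (Pi.single e 1)).compLinearMap (diagLin y) := by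
    have hd : diagLin y x = Pi.single e 1 := by
      rw [hx, map_smul, diagLin_single, smul_smul, inv_mul_cancel₀ (hy e).ne', one_smul]
    ext w
    simp only [hω, AlternatingMap.curryLeft_apply_apply, AlternatingMap.compLinearMap_apply]
    congr 1
    rw [← hd, ← vecCons_comp]
  have h4 := hw y (ω.curryLeft x) v
  rw [← h1, hω, hG, hs, ← hG, ← hω, h3, ← bubbleForm_apply h
    (fun y => (evalForm G y).curryLeft (Pi.single e 1))] at h4
  rw [mul_assoc, eq_inv_mul_iff_mul_eq₀ hC, ← h4]
  rfl

/-- A polynomial form with vanishing trace lies in the image of the operator. -/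
lemma exists_sphOp_eq (hk : 1 + k ≤ m) (hl : m - (1 + k) = l) (hh : (k + 1) + l = m) {r : ℕ}
    {B : PForm m l} {G : PForm m (k + 1)} (hGr : ∀ v, (G v).IsHomogeneous r)
    (hkill : ∀ y v i, v i = y → evalForm B y v = 0)
    (hG : ∀ y, (evalForm G y).compLinearMap (diagLin y) = starForm hh (evalForm B y)) :
    ∃ α ∈ PL m k (r : ℤ), phiPullTS m l (resSim m l (evalForm B)) = sphOp hl (resSim m k α) := by
  have h : (l + 1) + k = m := by omega
  obtain ⟨c, hc, hb⟩ := exists_phiPullTS_bubbleForm hk hl h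
  obtain ⟨C, hC, hB⟩ := exists_bubbleForm_curryLeft h hh ⟨0, by omega⟩
  set α : Form m k := fun y => (evalForm G y).curryLeft (Pi.single ⟨0, by omega⟩ 1) with hα
  have hα' : α ∈ PL m k (r : ℤ) := by
    intro v
    refine ⟨G (Matrix.vecCons (Pi.single ⟨0, by omega⟩ 1) v),
      (degLE_iff _ _).2 (hGr _).totalDegree_le, fun y => ?_⟩
    rw [← evalForm_apply]
    rfl
  have hα2 := smul_mem_PL hα' (c⁻¹ * C⁻¹)
  refine ⟨_, hα2, ?_⟩
  rw [← hb]
  congr 1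
  refine resSim_eq_of_forall (continuous_evalForm B) (fun v => ?_) fun x _ hpos v _ => ?_
  · exact continuous_const.mul (continuous_iU (etaForm_mem_PL h hα2) v)
  · have h1 : (c • bubbleForm h ((c⁻¹ * C⁻¹) • α)) x v =
        c * ((c⁻¹ * C⁻¹) * bubbleForm h α x v) := by
      rw [bubbleForm_smul]; rfl
    rw [h1, hB B G hkill hG x hpos]
    field_simp

lemma resSim_eq_of_phiPullTS_eq {β β' : Form m k} (hβ : ∀ v, Continuous fun x => β x v)
    (hβ' : ∀ v, Continuous fun x => β' x v)
    (h : phiPullTS m k (resSim m k β) = phiPullTS m k (resSim m k β')) :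
    resSim m k β = resSim m k β' :=
  resSim_eq_of_forall hβ hβ' fun x hx hpos v hv => eq_of_phiPullTS_eq h x hx hpos v hv

/-- Restriction of a form with vanishing trace, expressed for an ambient representative. -/
lemma eq_zero_of_vanishBdry {β : Form m k} (h : vanishBdry m k (resSim m k β)) {y : Vec m}
    (hy : y ∈ simplexSet m) (i : Fin m) (hi : y i = 0) (v : Fin k → Vec m)
    (hv : ∀ j, sumLin m (v j) = 0 ∧ v j i = 0) : β y v = 0 := by
  have h1 := h ⟨y, hy⟩ i hi v fun j => ⟨by rw [← sumLin_apply]; exact (hv j).1, (hv j).2⟩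
  have h2 : β y (fun j => projSim m (v j)) = 0 := h1
  simpa only [projSim_eq_self (hv _).1] using h2

lemma resSim_congr {β β' : Form m k} (h : ∀ x ∈ simplexSet m, ∀ v : Fin k → Vec m,
    (∀ j, sumLin m (v j) = 0) → β x v = β' x v) : resSim m k β = resSim m k β' := by
  funext x
  ext v
  have := neZero_of_mem_simplexSet x.2
  exact h x.1 x.2 _ fun j => sumLin_projSim _

lemma evalForm_iX_eq_zero (A : PForm m (k + 1)) (y : Vec m) (v : Fin k → Vec m) (i : Fin k)
    (hv : v i = y) : evalForm (iX A) y v = 0 := by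
  rw [evalForm_iX]
  exact iU_eq_zero_of_eq _ _ _ i hv

lemma existsUnique_PLmosim (hk : 1 + k ≤ m) (hl : m - (1 + k) = l) (r : ℕ)
    {a : FormOn m (simplexSet m) k} (ha : a ∈ PLsim m k r) :
    ∃! b, b ∈ PLmosim m l ((r : ℤ) + k + 1) ∧ phiPullTS m l b = sphOp hl a := by
  have h : (l + 1) + k = m := by omega
  obtain ⟨α, hα, rfl⟩ := ha
  obtain ⟨c, hc, hb⟩ := exists_phiPullTS_bubbleForm hk hl h
  have hdeg : ((r : ℤ) + k + 1 - 1) = ((r + k : ℕ) : ℤ) := by push_cast; ring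
  have hη := smul_mem_PL (etaForm_mem_PL h hα) c
  refine ⟨resSim m l (c • bubbleForm h α), ⟨⟨⟨c • bubbleForm h α, ?_, rfl⟩,
    vanishBdry_bubbleForm h c α⟩, hb α⟩, ?_⟩
  · refine ⟨c • etaForm h α, ?_, ?_⟩
    · rw [hdeg]; exact hη
    · rfl
  · rintro b ⟨⟨⟨β, ⟨η, hη', rfl⟩, rfl⟩, -⟩, hb'⟩
    rw [hdeg] at hη'
    refine resSim_eq_of_phiPullTS_eq (continuous_iU hη') (fun v => ?_) (hb'.trans (hb α).symm)
    exact continuous_iU hη v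

lemma existsUnique_PLsim (hm : 2 ≤ m) (hk : 1 + k ≤ m) (hl : m - (1 + k) = l) (r : ℕ)
    {b : FormOn m (simplexSet m) l} (hb : b ∈ PLmosim m l ((r : ℤ) + k + 1)) :
    ∃! a, a ∈ PLsim m k r ∧ phiPullTS m l b = sphOp hl a := by
  have hh : (k + 1) + l = m := by omega
  have hdeg : ((r : ℤ) + k + 1 - 1) = ((r + k : ℕ) : ℤ) := by push_cast; ring
  obtain ⟨⟨β, ⟨η, hη, rfl⟩, rfl⟩, hbd⟩ := hb
  rw [hdeg] at hη
  obtain ⟨A, hA, hA'⟩ := exists_homogeneous_of_mem_PL hη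
  have hres : resSim m l (iU η) = resSim m l (evalForm (iX A)) := by
    refine resSim_congr fun x hx v _ => ?_
    rw [evalForm_iX, iU, iU, hA' x (sumLin_self hx)]
  rw [hres] at hbd ⊢
  have hAX : ∀ v, (iX A v).IsHomogeneous (k + 1 + r) := by
    have e : k + 1 + r = r + k + 1 := by omega
    rw [e]
    exact iX_isHomogeneous hA
  have hkill := evalForm_iX_eq_zero A
  obtain ⟨G, hG, hG'⟩ := exists_compLinearMap_diagLin_eq_starForm hm hh hAX hkill
    fun y hy i hi v hv => eq_zero_of_vanishBdry hbd hy i hi v hv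
  obtain ⟨α, hα, hα'⟩ := exists_sphOp_eq hk hl hh hG hkill hG'
  refine ⟨resSim m k α, ⟨⟨α, hα, rfl⟩, hα'⟩, ?_⟩
  rintro a ⟨⟨α', hα'', rfl⟩, ha⟩
  exact eq_of_sphOp_eq hk hl (continuous_of_mem_PL hα'') (continuous_of_mem_PL hα)
    (ha.symm.trans hα')

lemma removeNth_succ_vecCons {M : Type*} (x : M) (v : Fin (k + 1) → M) (i : Fin (k + 1)) :
    i.succ.removeNth (Matrix.vecCons x v) = Matrix.vecCons x (i.removeNth v) := by
  funext j
  refine Fin.cases ?_ (fun j => ?_) j <;> simp [Fin.removeNth]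

/-- Contraction is an antiderivation with respect to the exterior product by a functional. -/
lemma wedgeOne_vecCons (lam : Vec m →ₗ[ℝ] ℝ) (μ : Vec m [⋀^Fin (k + 1)]→ₗ[ℝ] ℝ) (x : Vec m)
    (v : Fin (k + 1) → Vec m) :
    wedgeOne lam μ (Matrix.vecCons x v) = lam x * μ v - wedgeOne lam (μ.curryLeft x) v := by
  rw [wedgeOne_apply, Fin.sum_univ_succ, wedgeOne_apply, sub_eq_add_neg, ← Finset.sum_neg_distrib]
  congr 1
  · simp [Matrix.vecCons]
  · refine Finset.sum_congr rfl fun i _ => ?_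
    rw [removeNth_succ_vecCons, AlternatingMap.curryLeft_apply_apply]
    simp [pow_succ]

lemma diagLin_one (y : Vec m) : diagLin y (fun _ => 1) = y := by
  funext i; simp

lemma exists_bubbleForm_iU (h : (l + 1) + k = m) (h2 : l + (k + 1) = m) :
    ∃ C : ℝ, C ≠ 0 ∧ ∀ (γ : Form m (k + 1)) (y : Vec m) (v : Fin l → Vec m),
      (∀ j, sumLin m (v j) = 0) → bubbleForm h (iU γ) y v =
        C * sumLin m y * starForm h2 ((γ y).compLinearMap (diagLin y)) v := by
  obtain ⟨C, hC, hw⟩ := starForm_wedgeOne h2 h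
  refine ⟨C⁻¹, inv_ne_zero hC, fun γ y v hv => ?_⟩
  set ω := (γ y).compLinearMap (diagLin y) with hω
  have h1 : (iU γ y).compLinearMap (diagLin y) = ω.curryLeft fun _ => 1 := by
    ext w
    simp only [hω, iU, AlternatingMap.curryLeft_apply_apply, AlternatingMap.compLinearMap_apply]
    rw [vecCons_comp, diagLin_one]
  have h0 : (fun _ => 1 : Vec m) ≠ 0 := by
    intro h0
    exact one_ne_zero (congrFun h0 ⟨0, by omega⟩)
  have h3 : wedgeOne (dotLin m y) (ω.curryLeft fun _ => 1) =
      sumLin m y • ω - (wedgeOne (dotLin m y) ω).curryLeft fun _ => 1 := by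
    ext w
    rw [AlternatingMap.sub_apply, AlternatingMap.curryLeft_apply_apply, wedgeOne_vecCons,
      AlternatingMap.smul_apply, smul_eq_mul, ← sumLin_diagLin, diagLin_one]
    ring
  have h4 : starForm h2 ((wedgeOne (dotLin m y) ω).curryLeft fun _ => 1) v = 0 := by
    refine starForm_eq_zero_of_forall h2 _ (fun _ => 1) h0 (fun w i hi => ?_) v fun i => ?_
    · rw [AlternatingMap.curryLeft_apply_apply]
      exact AlternatingMap.map_eq_zero_of_eq _ _ (i := 0) (j := i.succ) (by simp [hi])
        (Fin.succ_ne_zero i).symm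
    · rw [dotLin_one]; exact hv i
  have h5 := hw y (ω.curryLeft fun _ => 1) v
  rw [h3, starForm_sub, starForm_smul, AlternatingMap.sub_apply, h4, sub_zero,
    AlternatingMap.smul_apply, smul_eq_mul] at h5
  rw [bubbleForm_apply, h1, mul_assoc, h5, inv_mul_cancel_left₀ hC]

/-- The exterior derivative on polynomial coefficients. -/
def dX (A : PForm m k) : PForm m (k + 1) :=
  AlternatingMap.alternatizeUncurryFin (∑ j, (LinearMap.proj j : Vec m →ₗ[ℝ] ℝ).smulRight
    ((pderiv j).toLinearMap.compAlternatingMap A))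

lemma dX_apply (A : PForm m k) (v : Fin (k + 1) → Vec m) :
    dX A v = ∑ i : Fin (k + 1), (-1) ^ (i : ℕ) •
      ∑ j, v i j • pderiv j (A (i.removeNth v)) := by
  simp [dX, AlternatingMap.alternatizeUncurryFin_apply, sum_altMap_apply]

lemma dX_isHomogeneous {A : PForm m k} {r : ℕ} (hA : ∀ v, (A v).IsHomogeneous r)
    (v : Fin (k + 1) → Vec m) : (dX A v).IsHomogeneous (r - 1) := by
  rw [dX_apply]
  refine IsHomogeneous.sum _ _ _ fun i _ => ?_
  refine zsmul_mem (K := homogeneousSubmodule (Fin m) ℝ (r - 1))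
    (IsHomogeneous.sum _ _ _ fun j _ => ?_) ((-1) ^ (i : ℕ))
  rw [smul_eq_C_mul]
  exact ((hA _).pderiv).C_mul _

/-- The homotopy formula for homogeneous forms killed by the radial vector field. -/
lemma iX_dX {A : PForm m k} {r : ℕ} (hA : ∀ v, (A v).IsHomogeneous r)
    (hkill : ∀ y : Vec m, (∀ i, 0 < y i) → ∀ v i, v i = y → evalForm A y v = 0)
    (w : Fin k → Vec m) : iX (dX A) w = (r + k) • A w := by
  have h1 : ∀ a : Fin m, dX A (Matrix.vecCons (Pi.single a 1) w) =
      pderiv a (A w) + ∑ i : Fin k, (-1) ^ ((i : ℕ) + 1) • ∑ j, w i j •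
        pderiv j (A (i.succ.removeNth (Matrix.vecCons (Pi.single a 1) w : Fin (k + 1) → Vec m))) := by
    intro a
    rw [dX_apply, Fin.sum_univ_succ]
    congr 1
    simp only [Fin.val_zero, pow_zero, one_smul, Matrix.cons_val_zero]
    rw [Finset.sum_eq_single a]
    · simp [Matrix.vecCons]
    · intro j _ hj; simp [hj]
    · simp
  simp only [iX_apply, h1, mul_add, Finset.sum_add_distrib]
  rw [(hA w).sum_X_mul_pderiv, add_smul]
  congr 1
  cases k with
  | zero => simp
  | succ k =>
    have h0 : iX A = 0 := by
      ext1 u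
      refine eq_of_eval_pos fun y hy => ?_
      rw [← evalForm_apply, evalForm_iX]
      exact (hkill y hy (Matrix.vecCons y u) 0 rfl).trans (map_zero _).symm
    have h2 : ∀ j (u : Fin k → Vec m),
        ∑ a, X a * pderiv j (A (Matrix.vecCons (Pi.single a 1) u)) =
          -A (Matrix.vecCons (Pi.single j 1) u) := by
      intro j u
      have h3 := congrArg (pderiv j) (iX_apply A u)
      rw [h0, AlternatingMap.zero_apply, map_zero, map_sum] at h3
      simp only [Derivation.leibniz, pderiv_X, smul_eq_mul, Finset.sum_add_distrib] at h3
      rw [Finset.sum_eq_single j (f := fun a => A (Matrix.vecCons (Pi.single a 1) u) * _)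
        (fun a _ ha => by simp [ha.symm]) (by simp)] at h3
      rw [eq_neg_iff_add_eq_zero, h3]
      simp
    have h4 : ∀ i : Fin (k + 1), ∑ j, w i j • A (Matrix.vecCons (Pi.single j 1) (i.removeNth w)) =
        (-1) ^ (i : ℕ) • A w := by
      intro i
      have e1 : A (Matrix.vecCons (w i) (i.removeNth w)) = (-1) ^ (i : ℕ) • A w := by
        have := A.map_insertNth i (w i) (i.removeNth w)
        rw [Fin.insertNth_self_removeNth] at this
        rw [this, smul_smul, ← mul_pow]
        simp
      rw [← e1]
      have e2 : ∀ L : Vec m →ₗ[ℝ] PForm m k, L (w i) = ∑ j, w i j • L (Pi.single j 1) := by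
        intro L
        conv_lhs => rw [← Finset.univ_sum_single (w i)]
        rw [map_sum]
        refine Finset.sum_congr rfl fun j _ => ?_
        rw [← map_smul, ← Pi.single_smul', smul_eq_mul, mul_one]
      have e3 := congrArg (fun F => F (i.removeNth w)) (e2 A.curryLeft)
      simpa [sum_altMap_apply] using e3.symm
    simp only [removeNth_succ_vecCons, Finset.mul_sum]
    rw [Finset.sum_comm]
    have h5 : ∀ i : Fin (k + 1), ∑ a, X a * ((-1) ^ ((i : ℕ) + 1) • ∑ j, w i j •
        pderiv j (A (Matrix.vecCons (Pi.single a 1) (i.removeNth w)))) = A w := by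
      intro i
      have : ∀ a, X a * ((-1) ^ ((i : ℕ) + 1) • ∑ j, w i j •
          pderiv j (A (Matrix.vecCons (Pi.single a 1) (i.removeNth w)))) =
          (-1) ^ ((i : ℕ) + 1) • ∑ j, w i j •
            (X a * pderiv j (A (Matrix.vecCons (Pi.single a 1) (i.removeNth w)))) := by
        intro a
        rw [mul_smul_comm, Finset.mul_sum]
        simp only [mul_smul_comm]
      simp only [this]
      rw [← Finset.smul_sum, Finset.sum_comm]
      simp only [← Finset.smul_sum, h2, smul_neg, Finset.sum_neg_distrib, h4]
      rw [smul_smul, pow_succ]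
      simp [← mul_pow]
    rw [Finset.sum_congr rfl fun i _ => h5 i]
    simp

/-- Homogeneous polynomial forms killed by the radial vector field are trimmed forms. -/
lemma evalForm_mem_PLm {A : PForm m k} {r : ℕ} (hr : 1 ≤ r) (hA : ∀ v, (A v).IsHomogeneous r)
    (hkill : ∀ y : Vec m, (∀ i, 0 < y i) → ∀ v i, v i = y → evalForm A y v = 0) :
    evalForm A ∈ PLm m k r := by
  have hrk : ((r + k : ℕ) : ℝ) ≠ 0 := by
    have : r + k ≠ 0 := by omega
    exact_mod_cast this
  have hdeg : ((r : ℤ) - 1) = ((r - 1 : ℕ) : ℤ) := by omega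
  refine ⟨((r + k : ℕ) : ℝ)⁻¹ • evalForm (dX A), ?_, ?_⟩
  · rw [hdeg]
    exact smul_mem_PL (evalForm_mem_PL fun v => (dX_isHomogeneous hA v).totalDegree_le) _
  · funext y
    ext v
    have h1 : iU (((r + k : ℕ) : ℝ)⁻¹ • evalForm (dX A)) y v =
      ((r + k : ℕ) : ℝ)⁻¹ * iU (evalForm (dX A)) y v := rfl
    rw [h1, ← evalForm_iX, evalForm_apply, iX_dX hA hkill, map_nsmul, ← evalForm_apply,
      nsmul_eq_mul, inv_mul_cancel_left₀ hrk]

/-- The exterior product of the sum functional with a polynomial form. -/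
def wedgeSum (A : PForm m l) : PForm m (l + 1) :=
  AlternatingMap.alternatizeUncurryFin ((sumLin m).smulRight A)

lemma wedgeSum_apply (A : PForm m l) (v : Fin (l + 1) → Vec m) :
    wedgeSum A v = ∑ i : Fin (l + 1), (-1) ^ (i : ℕ) • (sumLin m (v i) • A (i.removeNth v)) := by
  simp [wedgeSum, AlternatingMap.alternatizeUncurryFin_apply]

lemma evalForm_wedgeSum (A : PForm m l) (y : Vec m) :
    evalForm (wedgeSum A) y = wedgeOne (sumLin m) (evalForm A y) := by
  ext v
  simp [evalForm_apply, wedgeOne_apply, wedgeSum_apply, smul_eval]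
  exact Finset.sum_congr rfl fun i _ => mul_left_comm _ _ _

lemma wedgeSum_isHomogeneous {A : PForm m l} {d : ℕ} (hA : ∀ v, (A v).IsHomogeneous d)
    (v : Fin (l + 1) → Vec m) : (wedgeSum A v).IsHomogeneous d := by
  rw [wedgeSum_apply]
  refine IsHomogeneous.sum _ _ _ fun i _ => ?_
  refine zsmul_mem (K := homogeneousSubmodule (Fin m) ℝ d) ?_ ((-1) ^ (i : ℕ))
  exact Submodule.smul_mem _ _ (hA _)

lemma evalForm_iX_wedgeSum (A : PForm m l) (y : Vec m) (v : Fin l → Vec m)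
    (hv : ∀ j, sumLin m (v j) = 0) :
    evalForm (iX (wedgeSum A)) y v = sumLin m y * evalForm A y v := by
  rw [evalForm_iX]
  have : iU (evalForm (wedgeSum A)) y v = evalForm (wedgeSum A) y (Matrix.vecCons y v) := rfl
  rw [this, evalForm_wedgeSum, wedgeOne_cons _ _ _ _ hv]

/-- A polynomial vanishing on the hyperplane `∑ y i = 0`, away from the coordinate hyperplanes,
is divisible by the sum of the variables. -/
lemma sumX_dvd (hm : 2 ≤ m) {f : MvPolynomial (Fin m) ℝ}
    (hf : ∀ y : Vec m, sumLin m y = 0 → (∀ i, y i ≠ 0) → eval y f = 0) : sumX m ∣ f := by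
  have : Nontrivial (Fin m) := Fin.nontrivial_iff_two_le.2 hm
  let e : Fin m := ⟨0, by omega⟩
  let φ : MvPolynomial (Fin m) ℝ →ₐ[ℝ] MvPolynomial (Fin m) ℝ :=
    aeval fun j => if j = e then X e - sumX m else X j
  have h1 := dvd_sub_algHom (sumX m) φ (fun j => by
    by_cases hj : j = e <;> simp [φ, hj]) f
  suffices h : φ f = 0 by rwa [h, sub_zero] at h1
  refine eq_of_eval_pos fun y hy => ?_
  rw [map_zero]
  let z : Vec m := Function.update y e (y e - sumLin m y)
  have h2 : eval y (φ f) = eval z f := by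
    have : (aeval y).comp φ = aeval (R := ℝ) z := by
      refine algHom_ext fun j => ?_
      by_cases hj : j = e
      · subst hj; simp [φ, z, aeval_eq_eval, eval_sumX]
      · simp [φ, z, hj]
    simpa [aeval_eq_eval] using AlgHom.congr_fun this f
  have hsum : sumLin m y = y e + ∑ j ∈ Finset.univ.erase e, y j := by
    rw [sumLin_apply, Finset.add_sum_erase _ _ (Finset.mem_univ e)]
  have hpos : 0 < ∑ j ∈ Finset.univ.erase e, y j := by
    obtain ⟨j, hj⟩ := exists_ne e
    exact Finset.sum_pos (fun j _ => hy j) ⟨j, Finset.mem_erase.2 ⟨hj, Finset.mem_univ _⟩⟩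
  rw [h2]
  refine hf z ?_ fun i => ?_
  · rw [sumLin_apply, ← Finset.add_sum_erase _ _ (Finset.mem_univ e)]
    have : ∑ j ∈ Finset.univ.erase e, z j = ∑ j ∈ Finset.univ.erase e, y j :=
      Finset.sum_congr rfl fun j hj => by simp [z, Finset.ne_of_mem_erase hj]
    rw [this]
    simp only [z, Function.update_self]
    linarith
  · by_cases hi : i = e
    · subst hi
      simp only [z, Function.update_self]
      have : y e - sumLin m y < 0 := by linarith
      exact this.ne
    · simpa [z, hi] using (hy i).ne'

lemma exists_eq_mul {F : PForm m k} {s : MvPolynomial (Fin m) ℝ} (hs : s ≠ 0)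
    (hF : ∀ v, s ∣ F v) : ∃ A : PForm m k, ∀ v, F v = s * A v := by
  choose f hf using hF
  refine ⟨{ toFun := f, map_update_add' := ?_, map_update_smul' := ?_,
            map_eq_zero_of_eq' := ?_ }, hf⟩
  · intro _ v i x y
    refine mul_left_cancel₀ hs ?_
    rw [mul_add, ← hf, ← hf, ← hf]
    convert F.map_update_add v i x y
  · intro _ v i c x
    refine mul_left_cancel₀ hs ?_
    rw [mul_smul_comm, ← hf, ← hf]
    convert F.map_update_smul v i c x
  · intro v i j hv hij
    refine mul_left_cancel₀ hs ?_
    rw [mul_zero, ← hf]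
    exact F.map_eq_zero_of_eq v hv hij

lemma sumX_ne_zero (hm : 1 ≤ m) : sumX m ≠ 0 := by
  intro h
  have h1 := eval_sumX (m := m) fun _ => 1
  rw [h, map_zero, sumLin_apply] at h1
  have h2 : (m : ℝ) = 0 := by simpa using h1.symm
  have h3 : m = 0 := by exact_mod_cast h2
  omega

lemma existsUnique_PLosim (hk : 1 + k ≤ m) (hl : m - (1 + k) = l) (r : ℕ) (hr : 1 ≤ r)
    {a : FormOn m (simplexSet m) k} (ha : a ∈ PLmsim m k r) :
    ∃! b, b ∈ PLosim m l ((r : ℤ) + k) ∧ phiPullTS m l b = sphOp hl a := by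
  have h : (l + 1) + k = m := by omega
  have h2 : l + (k + 1) = m := by omega
  obtain ⟨α, ⟨γ, hγ, rfl⟩, rfl⟩ := ha
  obtain ⟨c, hc, hb⟩ := exists_phiPullTS_bubbleForm hk hl h
  obtain ⟨C, hC, hB⟩ := exists_bubbleForm_iU h h2
  have hdeg : ((r : ℤ) - 1) = ((r - 1 : ℕ) : ℤ) := by omega
  have hdeg' : ((r : ℤ) + k) = ((r - 1 + (k + 1) : ℕ) : ℤ) := by omega
  rw [hdeg] at hγ
  have hβ := smul_mem_PL (starForm_comp_diagLin_mem_PL h2 hγ) (c * C)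
  rw [← hdeg'] at hβ
  set β : Form m l := (c * C) • fun y => starForm h2 ((γ y).compLinearMap (diagLin y)) with hβ'
  have hres : resSim m l (c • bubbleForm h (iU γ)) = resSim m l β := by
    refine resSim_congr fun x hx v hv => ?_
    have e1 : (c • bubbleForm h (iU γ)) x v = c * bubbleForm h (iU γ) x v := rfl
    have e2 : β x v = c * C * starForm h2 ((γ x).compLinearMap (diagLin x)) v := rfl
    rw [e1, e2, hB _ _ _ hv, sumLin_self hx]
    ring
  refine ⟨resSim m l β, ⟨⟨⟨β, hβ, rfl⟩, ?_⟩, ?_⟩, ?_⟩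
  · rw [← hres]
    exact vanishBdry_bubbleForm h c _
  · rw [← hres]
    exact hb _
  · rintro b ⟨⟨⟨β₁, hβ₁, rfl⟩, -⟩, hb'⟩
    rw [hdeg'] at hβ₁ hβ
    refine resSim_eq_of_phiPullTS_eq (continuous_of_mem_PL hβ₁) (continuous_of_mem_PL hβ) ?_
    rw [hb', ← hres, hb]

lemma existsUnique_PLmsim (hm : 2 ≤ m) (hk : 1 + k ≤ m) (hl : m - (1 + k) = l) (r : ℕ)
    (hr : 1 ≤ r) {b : FormOn m (simplexSet m) l} (hb : b ∈ PLosim m l ((r : ℤ) + k)) :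
    ∃! a, a ∈ PLmsim m k r ∧ phiPullTS m l b = sphOp hl a := by
  have h : (l + 1) + k = m := by omega
  have h2 : l + (k + 1) = m := by omega
  have hh : (k + 1) + l = m := by omega
  have hdeg : ((r : ℤ) + k) = ((r + k : ℕ) : ℤ) := by push_cast; ring
  have hdeg' : ((r : ℤ) - 1) = ((r - 1 : ℕ) : ℤ) := by omega
  obtain ⟨⟨β, hβ, rfl⟩, hbd⟩ := hb
  rw [hdeg] at hβ
  obtain ⟨A, hA, hA'⟩ := exists_homogeneous_of_mem_PL hβ
  set B := iX (wedgeSum A) with hBdef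
  have hres : resSim m l β = resSim m l (evalForm B) := by
    refine resSim_congr fun x hx v hv => ?_
    rw [hBdef, evalForm_iX_wedgeSum A x v hv, sumLin_self hx, one_mul, hA' x (sumLin_self hx)]
  rw [hres] at hbd ⊢
  have hBhom : ∀ v, (B v).IsHomogeneous (k + 1 + r) := by
    have e : k + 1 + r = r + k + 1 := by omega
    rw [e]
    exact iX_isHomogeneous (wedgeSum_isHomogeneous hA)
  have hkill : ∀ y v i, v i = y → evalForm B y v = 0 := evalForm_iX_eq_zero _
  obtain ⟨G, hG, hG'⟩ := exists_compLinearMap_diagLin_eq_starForm hm hh hBhom hkill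
    fun y hy i hi v hv => eq_zero_of_vanishBdry hbd hy i hi v hv
  have h0 : (fun _ => 1 : Vec m) ≠ 0 := by
    intro h0
    exact one_ne_zero (congrFun h0 ⟨0, by omega⟩)
  have hdvd : ∀ v, sumX m ∣ iX G v := by
    refine fun v => sumX_dvd hm fun y hy hy0 => ?_
    let w : Fin k → Vec m := fun j i => v j i / y i
    have hdw : (fun j => diagLin y (w j)) = v := by
      funext j i
      have := hy0 i
      simp only [w, diagLin_apply]
      field_simp
    rw [← evalForm_apply, evalForm_iX]
    have e1 : iU (evalForm G) y v =
        (evalForm G y).compLinearMap (diagLin y) (Matrix.vecCons (fun _ => 1) w) := by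
      rw [AlternatingMap.compLinearMap_apply, vecCons_comp, diagLin_one, hdw]
      rfl
    rw [e1, hG']
    refine starForm_eq_zero_of_eq hh _ _ h0 (fun u hu => ?_) _ 0 rfl
    rw [hBdef, evalForm_iX_wedgeSum A y u (fun j => by rw [← dotLin_one]; exact hu j), hy,
      zero_mul]
  obtain ⟨A₁, hA₁⟩ := exists_eq_mul (sumX_ne_zero (by omega)) hdvd
  have hA₁eval : ∀ y v, iU (evalForm G) y v = sumLin m y * evalForm A₁ y v := by
    intro y v
    rw [← evalForm_iX, evalForm_apply, hA₁, map_mul, eval_sumX, evalForm_apply]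
  have hA₁hom : ∀ v, (A₁ v).IsHomogeneous r := by
    intro v
    refine isHomogeneous_of_mul sumX_isHomogeneous (sumX_ne_zero (by omega)) ?_
    rw [← hA₁, add_comm 1 r]
    exact iX_isHomogeneous hG v
  have hA₁kill : ∀ y : Vec m, (∀ i, 0 < y i) → ∀ v i, v i = y → evalForm A₁ y v = 0 := by
    intro y hy v i hv
    have e1 := hA₁eval y v
    rw [iU_eq_zero_of_eq _ _ _ i hv, eq_comm, mul_eq_zero] at e1
    refine e1.resolve_left ?_
    rw [sumLin_apply]
    exact (Finset.sum_pos (fun i _ => hy i) ⟨⟨0, by omega⟩, Finset.mem_univ _⟩).ne'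
  obtain ⟨γ, hγ, hγA⟩ := evalForm_mem_PLm hr hA₁hom hA₁kill
  obtain ⟨c, hc, hbub⟩ := exists_phiPullTS_bubbleForm hk hl h
  obtain ⟨C, hC, hB⟩ := exists_bubbleForm_iU h h2
  obtain ⟨C', hC', hs⟩ := starForm_starForm hh h2
  rw [hdeg'] at hγ
  have hγ' := smul_mem_PL hγ (c⁻¹ * (C * C')⁻¹)
  set α : Form m k := (c⁻¹ * (C * C')⁻¹) • evalForm A₁ with hα
  have hαγ : iU ((c⁻¹ * (C * C')⁻¹) • γ) = α := by
    rw [hα, ← hγA]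
    rfl
  have key : phiPullTS m l (resSim m l (evalForm B)) = sphOp hl (resSim m k α) := by
    rw [← hbub]
    congr 1
    refine resSim_congr fun x hx v hv => ?_
    have e1 : (c • bubbleForm h α) x v =
        c * ((c⁻¹ * (C * C')⁻¹) * bubbleForm h (evalForm A₁) x v) := by
      rw [hα, bubbleForm_smul]; rfl
    have e2 : bubbleForm h (evalForm A₁) x v = bubbleForm h (iU (evalForm G)) x v := by
      have : evalForm A₁ x = iU (evalForm G) x := by
        ext u
        rw [hA₁eval, sumLin_self hx, one_mul]
      rw [bubbleForm_apply, bubbleForm_apply, this]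
    rw [e1, e2, hB _ _ _ hv, sumLin_self hx, hG', hs, AlternatingMap.smul_apply, smul_eq_mul]
    field_simp
  refine ⟨resSim m k α, ⟨⟨α, ⟨_, ?_, hαγ⟩, rfl⟩, key⟩, ?_⟩
  · rw [hdeg']
    exact hγ'
  · rintro a ⟨⟨_, ⟨γ₁, hγ₁, rfl⟩, rfl⟩, ha⟩
    rw [hdeg'] at hγ₁
    refine eq_of_sphOp_eq hk hl (continuous_iU hγ₁) ?_ (ha.symm.trans key)
    rw [← hαγ]
    exact continuous_iU hγ'

end AltVec

theorem stmt4 (n k r : ℕ) (hn : 1 ≤ n) (hk : k ≤ n) :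
    ((∀ a ∈ PLsim (n + 1) k (r : ℤ), ∃! b,
        b ∈ PLmosim (n + 1) (n - k) ((r : ℤ) + k + 1) ∧
        phiPullTS (n + 1) (n - k) b = bubbleSmul (n + 1) (n - k)
          (castFormOn (show (n + 1) - (1 + k) = n - k by omega)
            (starSph (n + 1) k (phiPullTS (n + 1) k a)))) ∧
     (∀ b ∈ PLmosim (n + 1) (n - k) ((r : ℤ) + k + 1), ∃! a,
        a ∈ PLsim (n + 1) k (r : ℤ) ∧
        phiPullTS (n + 1) (n - k) b = bubbleSmul (n + 1) (n - k)
          (castFormOn (show (n + 1) - (1 + k) = n - k by omega)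
            (starSph (n + 1) k (phiPullTS (n + 1) k a))))) ∧
    (1 ≤ r →
      (∀ a ∈ PLmsim (n + 1) k (r : ℤ), ∃! b,
          b ∈ PLosim (n + 1) (n - k) ((r : ℤ) + k) ∧
          phiPullTS (n + 1) (n - k) b = bubbleSmul (n + 1) (n - k)
          (castFormOn (show (n + 1) - (1 + k) = n - k by omega)
            (starSph (n + 1) k (phiPullTS (n + 1) k a)))) ∧
      (∀ b ∈ PLosim (n + 1) (n - k) ((r : ℤ) + k), ∃! a,
          a ∈ PLmsim (n + 1) k (r : ℤ) ∧
          phiPullTS (n + 1) (n - k) b = bubbleSmul (n + 1) (n - k)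
          (castFormOn (show (n + 1) - (1 + k) = n - k by omega)
            (starSph (n + 1) k (phiPullTS (n + 1) k a))))) := by
  have h2 : 2 ≤ n + 1 := by omega
  have hk1 : 1 + k ≤ n + 1 := by omega
  have hl : (n + 1) - (1 + k) = n - k := by omega
  exact ⟨⟨fun a ha => AltVec.existsUnique_PLmosim hk1 hl r ha,
      fun b hb => AltVec.existsUnique_PLsim h2 hk1 hl r hb⟩,
    fun hr => ⟨fun a ha => AltVec.existsUnique_PLosim hk1 hl r hr ha,
      fun b hb => AltVec.existsUnique_PLmsim h2 hk1 hl r hr hb⟩⟩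

end
end

section
/- Let n ≥ 1, 0 ≤ k ≤ n, and r ≥ 0 (r ≥ 1 in the second case). If a ∈ P_rΛ^k(T^n) is nonzero and b = ((Φ^*)^{-1} ∘ (u_N *_{S^n}) ∘ Φ^*)(a) ∈ P̊_{r+k+1}^-Λ^{n-k}(T^n), then ∫_{T^n} a ∧ b > 0. Similarly, if a ∈ P_r^-Λ^k(T^n) is nonzero and b = ((Φ^*)^{-1} ∘ (u_N *_{S^n}) ∘ Φ^*)(a) ∈ P̊_{r+k}Λ^{n-k}(T^n), then ∫_{T^n} a ∧ b > 0. -/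
open scoped BigOperators
open MeasureTheory

noncomputable section

lemma AlternatingMap.sum_apply_vec {M ι κ : Type*} [AddCommGroup M] [Module ℝ M]
    (s : Finset κ) (F : κ → M [⋀^ι]→ₗ[ℝ] ℝ) (v : ι → M) :
    (∑ i ∈ s, F i) v = ∑ i ∈ s, F i v := by
  classical
  induction s using Finset.induction_on with
  | empty => simp
  | insert a s ha ih => simp [Finset.sum_insert ha, ih]

open Equiv in
lemma wedgeAlt_apply {m k l : ℕ} (α : (Vec m) [⋀^Fin k]→ₗ[ℝ] ℝ) (β : (Vec m) [⋀^Fin l]→ₗ[ℝ] ℝ)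
    (v : Fin (k + l) → Vec m) :
    (k.factorial * l.factorial : ℝ) * wedgeAlt α β v =
      ∑ σ : Perm (Fin k ⊕ Fin l), ((Perm.sign σ : ℤ) : ℝ) *
        (α (fun i => v (finSumFinEquiv (σ (Sum.inl i)))) *
          β (fun i => v (finSumFinEquiv (σ (Sum.inr i))))) := by
  have h := congrArg (fun f => TensorProduct.lid ℝ ℝ (f (v ∘ finSumFinEquiv)))
    (MultilinearMap.domCoprod_alternization_eq α β)
  simp only [Fintype.card_fin, MultilinearMap.alternatization_apply, map_sum] at h
  have h2 : TensorProduct.lid ℝ ℝ (((k.factorial * l.factorial) • α.domCoprod β)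
      (v ∘ finSumFinEquiv)) = (k.factorial * l.factorial : ℝ) * wedgeAlt α β v := by
    rw [← Nat.cast_smul_eq_nsmul ℝ, AlternatingMap.smul_apply, map_smul]
    simp [wedgeAlt]
  rw [← h2, ← h]
  refine Finset.sum_congr rfl fun σ _ => ?_
  rw [Units.smul_def, map_zsmul, MultilinearMap.domDomCongr_apply, MultilinearMap.domCoprod_apply]
  simp

/-- Summing an alternating map against an alternatization over all index tuples. -/
lemma sum_sign_mul_alternating {ι κ : Type*} [Fintype ι] [DecidableEq ι] [Fintype κ]
    (A ζ : (ι → κ) → ℝ)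
    (hζ : ∀ (g : ι → κ) (σ : Equiv.Perm ι), ζ (g ∘ σ) = ((Equiv.Perm.sign σ : ℤ) : ℝ) * ζ g) :
    ∑ g : ι → κ, (∑ σ : Equiv.Perm ι, ((Equiv.Perm.sign σ : ℤ) : ℝ) * A (g ∘ σ)) * ζ g =
      (Fintype.card ι).factorial * ∑ g : ι → κ, A g * ζ g := by
  simp_rw [Finset.sum_mul]
  rw [Finset.sum_comm]
  have : ∀ σ : Equiv.Perm ι, ∑ g : ι → κ, ((Equiv.Perm.sign σ : ℤ) : ℝ) * A (g ∘ σ) * ζ g =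
      ∑ g : ι → κ, A g * ζ g := by
    intro σ
    rw [← (Equiv.arrowCongr σ.symm (Equiv.refl κ)).sum_comp (fun g => A g * ζ g)]
    refine Finset.sum_congr rfl fun g _ => ?_
    have e : (Equiv.arrowCongr σ.symm (Equiv.refl κ)) g = g ∘ σ := by ext; simp
    rw [e, hζ]
    ring
  simp [this, Fintype.card_perm]

/-- Fixing the right-hand block of arguments of an alternating map. -/
def fixRight {M ιa ιb : Type*} [AddCommGroup M] [Module ℝ M]
    (δ : M [⋀^(ιa ⊕ ιb)]→ₗ[ℝ] ℝ) (w : ιb → M) : M [⋀^ιa]→ₗ[ℝ] ℝ where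
  toFun v := δ (Sum.elim v w)
  map_update_add' v i x y := by
    classical
    have := Subsingleton.elim ‹DecidableEq ιa› (Classical.decEq ιa)
    subst this
    simp only [← Sum.update_elim_inl, AlternatingMap.map_update_add]
  map_update_smul' v i c x := by
    classical
    have := Subsingleton.elim ‹DecidableEq ιa› (Classical.decEq ιa)
    subst this
    simp only [← Sum.update_elim_inl, AlternatingMap.map_update_smul]
  map_eq_zero_of_eq' v i j h hij :=
    δ.map_eq_zero_of_eq _ (i := Sum.inl i) (j := Sum.inl j) (by simpa using h) (by simpa using hij)

lemma fixRight_apply {M ιa ιb : Type*} [AddCommGroup M] [Module ℝ M]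
    (δ : M [⋀^(ιa ⊕ ιb)]→ₗ[ℝ] ℝ) (w : ιb → M) (v : ιa → M) :
    fixRight δ w v = δ (Sum.elim v w) := rfl

open Equiv in
lemma sum_shuffle_self {M ιa ιb : Type*} [AddCommGroup M] [Module ℝ M]
    [Fintype ιa] [Fintype ιb] [DecidableEq ιa] [DecidableEq ιb]
    (α : M [⋀^ιa]→ₗ[ℝ] ℝ) (δ : M [⋀^(ιa ⊕ ιb)]→ₗ[ℝ] ℝ) (w : ιa ⊕ ιb → M) :
    ∑ σ : Perm (ιa ⊕ ιb), ((Perm.sign σ : ℤ) : ℝ) *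
        (α (fun i => w (σ (Sum.inl i))) *
          δ (Sum.elim (fun i => w (Sum.inl i)) fun i => w (σ (Sum.inr i)))) =
      ((Fintype.card ιa).factorial * (Fintype.card ιb).factorial : ℝ) *
        (α (fun i => w (Sum.inl i)) * δ w) := by
  set F : Perm (ιa ⊕ ιb) → ℝ := fun σ => ((Perm.sign σ : ℤ) : ℝ) *
        (α (fun i => w (σ (Sum.inl i))) *
          δ (Sum.elim (fun i => w (Sum.inl i)) fun i => w (σ (Sum.inr i)))) with hF
  have h0 : ∀ σ, σ ∉ Set.range (Perm.sumCongrHom ιa ιb) → F σ = 0 := by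
    intro σ hσ
    have : ¬ Set.MapsTo (σ⁻¹ : Perm (ιa ⊕ ιb)) (Set.range Sum.inl) (Set.range Sum.inl) := by
      intro h
      apply hσ
      have := Perm.mem_sumCongrHom_range_of_perm_mapsTo_inl h
      rw [inv_mem_iff] at this
      exact this
    simp only [Set.MapsTo, not_forall] at this
    obtain ⟨x, ⟨i, rfl⟩, hx⟩ := this
    obtain ⟨j, hj⟩ : ∃ j, σ⁻¹ (Sum.inl i) = Sum.inr j := by
      rcases h : σ⁻¹ (Sum.inl i) with j | j
      · exact absurd ⟨j, h.symm⟩ hx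
      · exact ⟨j, rfl⟩
    have hj' : σ (Sum.inr j) = Sum.inl i := by rw [← hj]; simp
    simp only [hF]
    rw [δ.map_eq_zero_of_eq _ (i := Sum.inl i) (j := Sum.inr j) (by simp [hj']) (by simp)]
    simp
  have h1 : ∀ p : Perm ιa × Perm ιb, F (Perm.sumCongrHom ιa ιb p) =
      α (fun i => w (Sum.inl i)) * δ w := by
    rintro ⟨s, t⟩
    have e1 : α (fun i => w (Perm.sumCongrHom ιa ιb (s, t) (Sum.inl i))) =
        ((Perm.sign s : ℤ) : ℝ) * α (fun i => w (Sum.inl i)) := by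
      have := α.map_perm (fun i => w (Sum.inl i)) s
      simpa [Function.comp_def, Units.smul_def] using this
    have e2 : δ (Sum.elim (fun i => w (Sum.inl i))
          fun i => w (Perm.sumCongrHom ιa ιb (s, t) (Sum.inr i))) =
        ((Perm.sign t : ℤ) : ℝ) * δ w := by
      have := δ.map_perm w (Perm.sumCongr 1 t)
      have e : (w ∘ (Perm.sumCongr 1 t : Perm (ιa ⊕ ιb))) = Sum.elim (fun i => w (Sum.inl i))
          fun i => w (Perm.sumCongrHom ιa ιb (s, t) (Sum.inr i)) := by
        ext x; rcases x with x | x <;> simp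
      rw [e] at this
      simpa [Units.smul_def] using this
    simp only [hF]
    rw [e1, e2]
    have hs : ((Perm.sign s : ℤ) : ℝ) * ((Perm.sign s : ℤ) : ℝ) = 1 := by
      rw [← Int.cast_mul, ← Units.val_mul, Int.units_mul_self]; simp
    have ht : ((Perm.sign t : ℤ) : ℝ) * ((Perm.sign t : ℤ) : ℝ) = 1 := by
      rw [← Int.cast_mul, ← Units.val_mul, Int.units_mul_self]; simp
    simp only [Perm.sumCongrHom_apply, Perm.sign_sumCongr, Units.val_mul, Int.cast_mul]
    linear_combination (α (fun i => w (Sum.inl i)) * δ w) *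
      (((Perm.sign t : ℤ) : ℝ) * ((Perm.sign t : ℤ) : ℝ) * hs + ht)
  rw [← Fintype.sum_of_injective (Perm.sumCongrHom ιa ιb) Perm.sumCongrHom_injective
    (fun p => F (Perm.sumCongrHom ιa ιb p)) F (fun σ => h0 σ) (fun _ => rfl)]
  simp only [h1]
  simp [Fintype.card_perm]

open Equiv in
/-- Expansion of `α(v) δ(w)` over shuffles, for `δ` of top degree modulo the vector `b none`. -/
lemma sum_shuffle_eq {M ιa ιb : Type*} [AddCommGroup M] [Module ℝ M]
    [Fintype ιa] [Fintype ιb] [DecidableEq ιa] [DecidableEq ιb]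
    (b : Module.Basis (Option (ιa ⊕ ιb)) ℝ M)
    (α : M [⋀^ιa]→ₗ[ℝ] ℝ) (δ : M [⋀^(ιa ⊕ ιb)]→ₗ[ℝ] ℝ)
    (hα : ∀ v i, v i = b none → α v = 0) (hδ : ∀ v i, v i = b none → δ v = 0)
    (v : ιa → M) :
    ∑ σ : Perm (ιa ⊕ ιb), ((Perm.sign σ : ℤ) : ℝ) *
        (α (fun i => b (some (σ (Sum.inl i)))) *
          δ (Sum.elim v fun i => b (some (σ (Sum.inr i))))) =
      ((Fintype.card ιa).factorial * (Fintype.card ιb).factorial : ℝ) *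
        (α v * δ (fun i => b (some i))) := by
  let f : M [⋀^ιa]→ₗ[ℝ] ℝ := ∑ σ : Perm (ιa ⊕ ιb), (((Perm.sign σ : ℤ) : ℝ) *
    α (fun i => b (some (σ (Sum.inl i))))) • fixRight δ fun i => b (some (σ (Sum.inr i)))
  let g : M [⋀^ιa]→ₗ[ℝ] ℝ := (((Fintype.card ιa).factorial * (Fintype.card ιb).factorial : ℝ) *
    δ (fun i => b (some i))) • α
  have hfg : f = g := by
    refine Module.Basis.ext_alternating b fun h hh => ?_
    simp only [f, g, AlternatingMap.sum_apply_vec, AlternatingMap.smul_apply, smul_eq_mul, fixRight_apply]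
    by_cases hn : ∃ i, h i = none
    · obtain ⟨i, hi⟩ := hn
      rw [hα _ i (by rw [hi])]
      simp only [mul_zero]
      refine Finset.sum_eq_zero fun σ _ => ?_
      rw [hδ _ (Sum.inl i) (by simp [hi]), mul_zero]
    · push Not at hn
      choose h' hh' using fun i => Option.ne_none_iff_exists'.mp (hn i)
      have hinj : Function.Injective h' := fun i j hij => hh (by rw [hh', hh', hij])
      obtain ⟨τ, hτ⟩ := Perm.exists_extending_pair Sum.inl h' (Sum.inl_injective (β := ιb)) hinj
      have key := sum_shuffle_self α δ (fun i => b (some (τ i)))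
      have hδτ := δ.map_perm (fun i => b (some i)) τ
      simp only [Function.comp_def, Units.smul_def, zsmul_eq_mul] at hδτ
      have hs : ((Perm.sign τ : ℤ) : ℝ) * ((Perm.sign τ : ℤ) : ℝ) = 1 := by
        rw [← Int.cast_mul, ← Units.val_mul, Int.units_mul_self]; simp
      simp only [hτ, ← hh', hδτ] at key
      rw [← Equiv.sum_comp (Equiv.mulLeft τ)]
      simp only [Equiv.coe_mulLeft, Perm.sign_mul, Perm.mul_apply, Units.val_mul, Int.cast_mul]
      have := congrArg (((Perm.sign τ : ℤ) : ℝ) * ·) key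
      simp only [Finset.mul_sum] at this
      refine Eq.trans (Finset.sum_congr rfl fun σ _ => ?_) (this.trans ?_)
      · ring
      · linear_combination (((Fintype.card ιa).factorial * (Fintype.card ιb).factorial : ℝ) *
          α (fun i => b (h i)) * δ (fun i => b (some i))) * hs
  have := congrArg (fun F => F v) hfg
  simp only [f, g, AlternatingMap.sum_apply_vec, AlternatingMap.smul_apply, smul_eq_mul, fixRight_apply] at this
  refine Eq.trans (Finset.sum_congr rfl fun σ _ => ?_) (this.trans ?_) <;> ring

lemma succ_sub_one_add (n k : ℕ) : n + 1 - (1 + k) = n - k := by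
  lia

lemma contrMany_apply {m : ℕ} (k : ℕ) (v : Fin k → Vec m) {j : ℕ}
    (α : (Vec m) [⋀^Fin (k + j)]→ₗ[ℝ] ℝ) (w : Fin j → Vec m) :
    contrMany k v α w = α (Fin.append v w) := by
  induction k generalizing j with
  | zero =>
    simp only [contrMany, AlternatingMap.domDomCongr_apply]
    congr 1
    ext1 i
    obtain rfl : v = Fin.elim0 := Subsingleton.elim _ _
    rw [Fin.elim0_append]
    rfl
  | succ k ih =>
    simp only [contrMany, ih, AlternatingMap.curryLeft_apply_apply,
      AlternatingMap.domDomCongr_apply]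
    congr 1
    ext1 i
    rcases i with ⟨i, hi⟩
    rcases i with _ | i
    · simp [Fin.append, Fin.addCases, Matrix.vecCons]
      rfl
    · have e : (finCongr (by omega : (k + 1) + j = (k + j) + 1)) ⟨i + 1, hi⟩ =
        Fin.succ ⟨i, by omega⟩ := rfl
      simp only [Function.comp_apply]
      rw [e]
      simp only [Matrix.cons_val_succ]
      by_cases h : i < k
      · simp [Fin.append, Fin.addCases, h]
      · simp only [Fin.append, Fin.addCases, h, Nat.add_lt_add_iff_right, dite_false, eq_rec_constant]
        congr 1
        ext
        simp

/-- Contraction of the volume form with `u`. -/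
def areaForm {n k : ℕ} (hk : k ≤ n) (u : Vec (n + 1)) :
    (Vec (n + 1)) [⋀^(Fin k ⊕ Fin (n - k))]→ₗ[ℝ] ℝ :=
  ((volForm (n + 1)).curryLeft u).domDomCongr
    (finSumFinEquiv.trans (finCongr (Nat.add_sub_of_le hk))).symm

lemma areaForm_apply {n k : ℕ} (hk : k ≤ n) (u : Vec (n + 1))
    (w : Fin k ⊕ Fin (n - k) → Vec (n + 1)) :
    areaForm hk u w = volForm (n + 1) (Fin.cons u
      (w ∘ (finSumFinEquiv.trans (finCongr (Nat.add_sub_of_le hk))).symm)) := rfl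

lemma nuForm_apply (m : ℕ) (u : Vec m) (v : Fin 1 → Vec m) :
    nuForm m u v = ∑ i, u i * v 0 i := by
  simp [nuForm, dotLin]

/-- `⋆(ν ∧ α)` as a contraction of `α` against the area form. -/
lemma starAlt_wedge_nu {n k : ℕ} (hk : k ≤ n) (u : Vec (n + 1))
    (α : (Vec (n + 1)) [⋀^Fin k]→ₗ[ℝ] ℝ) (w : Fin (n - k) → Vec (n + 1)) :
    starAlt (n + 1) (1 + k) (wedgeAlt (nuForm (n + 1) u) α)
        (w ∘ finCongr (succ_sub_one_add n k)) =
      (k.factorial : ℝ)⁻¹ * ∑ g : Fin k → Fin (n + 1), α (fun i => Pi.single (g i) 1) *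
        areaForm hk u (Sum.elim (fun i => Pi.single (g i) 1) w) := by
  rw [starAlt, dif_pos (by omega)]
  simp only [AlternatingMap.smul_apply, AlternatingMap.sum_apply_vec, smul_eq_mul, contrMany_apply,
    AlternatingMap.domDomCongr_apply]
  set e := (Equiv.arrowCongr (finSumFinEquiv (m := 1) (n := k)) (Equiv.refl (Fin (n + 1))))
  let B : Fin (n + 1) → Vec (n + 1) := fun i => Pi.single i 1
  let ζ : (Fin 1 ⊕ Fin k → Fin (n + 1)) → ℝ := fun g => volForm (n + 1)
      (Fin.append (fun i => B (e g i)) (w ∘ finCongr (succ_sub_one_add n k)) ∘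
        finCongr (by omega : n + 1 = 1 + k + (n + 1 - (1 + k))))
  let A : (Fin 1 ⊕ Fin k → Fin (n + 1)) → ℝ := fun g =>
    nuForm (n + 1) u (fun i => B (g (Sum.inl i))) * α (fun i => B (g (Sum.inr i)))
  let E : Fin (n + 1) ≃ (Fin 1 ⊕ Fin k) ⊕ Fin (n - k) :=
    (finCongr (by omega : n + 1 = (1 + k) + (n - k))).trans
      (finSumFinEquiv.symm.trans (Equiv.sumCongr finSumFinEquiv.symm (Equiv.refl _)))
  have hζE : ∀ g, ζ g = fixRight ((volForm (n + 1)).domDomCongr E) w (fun i => B (g i)) := by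
    intro g
    rw [fixRight_apply, AlternatingMap.domDomCongr_apply]
    simp only [ζ]
    congr 1
    ext1 i
    rcases i with ⟨i, hi⟩
    by_cases h : i < 1 + k
    · have e1 : E ⟨i, hi⟩ = Sum.inl (finSumFinEquiv.symm ⟨i, h⟩) := by
        rw [← Equiv.eq_symm_apply]
        ext
        simp [E]
      simp [e1, Fin.append, Fin.addCases, h, e]
    · have e1 : E ⟨i, hi⟩ = Sum.inr ⟨i - (1 + k), by omega⟩ := by
        rw [← Equiv.eq_symm_apply]
        ext
        simp [E]
        omega
      have e2 : finCongr (by omega : n + 1 = 1 + k + (n + 1 - (1 + k))) ⟨i, hi⟩ =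
          Fin.natAdd (1 + k) ⟨i - (1 + k), by omega⟩ := by
        ext
        simp
        omega
      rw [Function.comp_apply, Function.comp_apply, e1, e2, Fin.append_right]
      rfl
  have hζ : ∀ g (σ : Equiv.Perm (Fin 1 ⊕ Fin k)),
      ζ (g ∘ σ) = ((Equiv.Perm.sign σ : ℤ) : ℝ) * ζ g := by
    intro g σ
    rw [hζE, hζE]
    have := (fixRight ((volForm (n + 1)).domDomCongr E) w).map_perm (fun i => B (g i)) σ
    simpa [Units.smul_def, Function.comp_def] using this
  have key := sum_sign_mul_alternating A ζ hζ
  have h1 : ∀ g : Fin 1 ⊕ Fin k → Fin (n + 1),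
      (∑ σ : Equiv.Perm (Fin 1 ⊕ Fin k), ((Equiv.Perm.sign σ : ℤ) : ℝ) * A (g ∘ σ)) =
        k.factorial * wedgeAlt (nuForm (n + 1) u) α (fun i => B (e g i)) := by
    intro g
    have := wedgeAlt_apply (nuForm (n + 1) u) α (fun i => B (e g i))
    simp only [Nat.factorial_one, Nat.cast_one, one_mul] at this
    rw [this]
    refine Finset.sum_congr rfl fun σ _ => ?_
    simp [A, e]
  simp only [h1] at key
  have h2 : ∑ g, A g * ζ g = ∑ g : Fin k → Fin (n + 1), α (fun i => Pi.single (g i) 1) *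
        areaForm hk u (Sum.elim (fun i => Pi.single (g i) 1) w) := by
    have h3 : ∀ (i : Fin (n + 1)) (g : Fin k → Fin (n + 1)),
        ζ (Sum.elim (fun _ => i) g) = areaForm hk (B i) (Sum.elim (fun i => B (g i)) w) := by
      intro i g
      rw [hζE, fixRight_apply, AlternatingMap.domDomCongr_apply, areaForm_apply]
      congr 1
      ext1 j
      refine Fin.cases ?_ (fun j => ?_) j
      · have e1 : E 0 = Sum.inl (Sum.inl 0) := by
          rw [← Equiv.eq_symm_apply]
          ext
          simp [E]
        rw [Function.comp_apply, e1]
        rfl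
      · rw [Fin.cons_succ]
        simp only [Function.comp_apply]
        obtain ⟨x, rfl⟩ :=
          (finSumFinEquiv.trans (finCongr (Nat.add_sub_of_le hk))).surjective j
        rw [Equiv.symm_apply_apply]
        rcases x with x | x
        · have e1 : E (Fin.succ ((finSumFinEquiv.trans (finCongr (Nat.add_sub_of_le hk)))
              (Sum.inl x))) = Sum.inl (Sum.inr x) := by
            rw [← Equiv.eq_symm_apply]
            ext
            simp [E]
            omega
          rw [e1]
          rfl
        · have e1 : E (Fin.succ ((finSumFinEquiv.trans (finCongr (Nat.add_sub_of_le hk)))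
              (Sum.inr x))) = Sum.inr x := by
            rw [← Equiv.eq_symm_apply]
            ext
            simp [E]
            omega
          rw [e1]
          rfl
    have h4 : ∀ x, areaForm hk u x = ∑ i, u i * areaForm hk (B i) x := by
      intro x
      have hu : u = ∑ i, u i • B i := by
        simpa [B] using pi_eq_sum_univ' u
      have h5 : (volForm (n + 1)).curryLeft u = ∑ i, u i • (volForm (n + 1)).curryLeft (B i) := by
        conv_lhs => rw [hu]
        simp only [map_sum, map_smul]
      simp only [areaForm, AlternatingMap.domDomCongr_apply]
      rw [h5]
      simp [AlternatingMap.sum_apply_vec]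
    rw [← Equiv.sum_comp (Equiv.sumArrowEquivProdArrow (Fin 1) (Fin k) (Fin (n + 1))).symm,
      Fintype.sum_prod_type_right]
    refine Finset.sum_congr rfl fun g _ => ?_
    rw [← Equiv.sum_comp (Equiv.funUnique (Fin 1) (Fin (n + 1))).symm, h4, Finset.mul_sum]
    refine Finset.sum_congr rfl fun i _ => ?_
    have e2 : (Equiv.sumArrowEquivProdArrow (Fin 1) (Fin k) (Fin (n + 1))).symm
        ((Equiv.funUnique (Fin 1) (Fin (n + 1))).symm i, g) = Sum.elim (fun _ => i) g := by
      ext x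
      rcases x with x | x <;> simp [Equiv.sumArrowEquivProdArrow]
    rw [e2, h3]
    have e3 : nuForm (n + 1) u (fun _ => B i) = u i := by
      rw [nuForm_apply]
      simp [B, Pi.single_apply]
    have e4 : A (Sum.elim (fun _ => i) g) = u i * α (fun i => B (g i)) :=
      congrArg (· * α (fun i => B (g i))) e3
    rw [e4]
    ring
  rw [h2] at key
  rw [← Equiv.sum_comp e]
  have hk0 : (k.factorial : ℝ) ≠ 0 := by positivity
  have hk1 : ((1 + k).factorial : ℝ) ≠ 0 := by positivity
  simp only [Fintype.card_sum, Fintype.card_fin] at key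
  rw [inv_mul_eq_iff_eq_mul₀ hk1]
  rw [← mul_assoc, mul_comm _ (k.factorial : ℝ)⁻¹, mul_assoc, eq_inv_mul_iff_mul_eq₀ hk0, ← key,
    Finset.mul_sum]
  refine Finset.sum_congr rfl fun g _ => ?_
  rw [mul_assoc]

lemma wedgeAlt_compLinearMap {m k l : ℕ} (α : (Vec m) [⋀^Fin k]→ₗ[ℝ] ℝ)
    (β : (Vec m) [⋀^Fin l]→ₗ[ℝ] ℝ) (f : Vec m →ₗ[ℝ] Vec m) (v : Fin (k + l) → Vec m) :
    wedgeAlt (α.compLinearMap f) (β.compLinearMap f) v = wedgeAlt α β (fun i => f (v i)) := by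
  have h : (k.factorial * l.factorial : ℝ) ≠ 0 := by positivity
  apply mul_left_cancel₀ h
  rw [wedgeAlt_apply, wedgeAlt_apply]
  rfl

/-- `α ∧ ⋆(ν ∧ α)` is `|α|²` times the area form, evaluated on a frame `w`. -/
lemma wedgeAlt_star_frame {n k : ℕ} (hk : k ≤ n) (u : Vec (n + 1)) (c : ℝ)
    (α : (Vec (n + 1)) [⋀^Fin k]→ₗ[ℝ] ℝ) (β : (Vec (n + 1)) [⋀^Fin (n - k)]→ₗ[ℝ] ℝ)
    (w : Fin n → Vec (n + 1)) (hw : volForm (n + 1) (Fin.cons u w) ≠ 0)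
    (hα : ∀ v i, v i = u → α v = 0)
    (hβ : ∀ s : Fin (n - k) → Fin n, β (fun i => w (s i)) =
      c * starAlt (n + 1) (1 + k) (wedgeAlt (nuForm (n + 1) u) α)
        ((fun i => w (s i)) ∘ finCongr (succ_sub_one_add n k))) :
    wedgeAlt α β (fun i => w (finCongr (Nat.add_sub_of_le hk) i)) =
      c * ((k.factorial : ℝ)⁻¹ * ∑ g : Fin k → Fin (n + 1), α (fun i => Pi.single (g i) 1) ^ 2) *
        volForm (n + 1) (Fin.cons u w) := by
  set e := finSumFinEquiv.trans (finCongr (Nat.add_sub_of_le hk)) with he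
  have hli : LinearIndependent ℝ (Fin.cons u w : Fin (n + 1) → Vec (n + 1)) := by
    by_contra h
    exact hw ((volForm (n + 1)).map_linearDependent _ h)
  let b₀ := basisOfLinearIndependentOfCardEqFinrank hli (by simp)
  let b := b₀.reindex ((finSuccEquiv n).trans (Equiv.optionCongr e.symm))
  have hbn : b none = u := by simp [b, b₀]
  have hbs : ∀ x, b (some x) = w (e x) := by
    intro x
    simp [b, b₀]
  have hδ : ∀ v i, v i = b none → areaForm hk u v = 0 := by
    intro v i hi
    rw [areaForm_apply]
    refine (volForm (n + 1)).map_eq_zero_of_eq _ (i := 0) (j := (e i).succ) ?_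
      (Fin.succ_ne_zero _).symm
    rw [Fin.cons_zero, Fin.cons_succ, Function.comp_apply, Equiv.symm_apply_apply, hi, hbn]
  have hkl : (k.factorial * (n - k).factorial : ℝ) ≠ 0 := by positivity
  have hD : areaForm hk u (fun x => w (e x)) = volForm (n + 1) (Fin.cons u w) := by
    rw [areaForm_apply]
    congr 2
    ext1 j
    rw [Function.comp_apply, ← he, Equiv.apply_symm_apply]
  apply mul_left_cancel₀ hkl
  rw [wedgeAlt_apply]
  have hcr := fun g : Fin k → Fin (n + 1) => sum_shuffle_eq b α (areaForm hk u)
    (fun v i hi => hα v i (hi.trans hbn)) hδ (fun i => Pi.single (g i) 1)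
  simp only [hbs, hD, Fintype.card_fin] at hcr
  calc _ = ∑ σ : Equiv.Perm (Fin k ⊕ Fin (n - k)), ∑ g : Fin k → Fin (n + 1),
        (c * (k.factorial : ℝ)⁻¹ * α (fun i => Pi.single (g i) 1)) *
        (((Equiv.Perm.sign σ : ℤ) : ℝ) * (α (fun i => w (e (σ (Sum.inl i)))) *
          areaForm hk u (Sum.elim (fun i => Pi.single (g i) 1)
            fun i => w (e (σ (Sum.inr i)))))) := by
        refine Finset.sum_congr rfl fun σ _ => ?_
        have := hβ (fun i => e (σ (Sum.inr i)))
        rw [starAlt_wedge_nu hk] at this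
        refine (congrArg (fun t => ((Equiv.Perm.sign σ : ℤ) : ℝ) *
          (α (fun i => w (e (σ (Sum.inl i)))) * t)) this).trans ?_
        simp only [Finset.mul_sum]
        refine Finset.sum_congr rfl fun g _ => ?_
        ring
    _ = _ := by
        rw [Finset.sum_comm]
        simp only [← Finset.mul_sum, hcr]
        simp only [Finset.mul_sum, Finset.sum_mul]
        refine Finset.sum_congr rfl fun g _ => ?_
        ring

lemma volForm_apply (m : ℕ) (v : Fin m → Vec m) : volForm m v = (Matrix.of v).det := by
  rw [volForm, Module.Basis.det_apply, ← Matrix.det_transpose]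
  congr 1

/-- The frame `(x, simplexTangent)` has determinant `∑ xᵢ`. -/
lemma volForm_cons_simplexTangent (n : ℕ) (x : Vec (n + 1)) :
    volForm (n + 1) (Fin.cons x (simplexTangent n)) = ∑ i, x i := by
  rw [volForm_apply]
  set A : Matrix (Fin (n + 1)) (Fin (n + 1)) ℝ := Matrix.of (Fin.cons x (simplexTangent n)) with hA
  have h := Matrix.det_updateCol_sum A 0 (fun _ => 1)
  simp only [one_smul] at h
  rw [← h, Matrix.det_succ_column_zero, Fin.sum_univ_succ]
  have h0 : ∀ j : Fin n, ∑ i, A j.succ i = 0 := by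
    intro j
    simp [hA, simplexTangent, Fin.sum_univ_succ, Pi.single_apply]
  have h1 : ((A.updateCol 0 fun k => ∑ i, A k i).submatrix (Fin.succAbove 0) Fin.succ) = 1 := by
    ext i j
    simp [hA, simplexTangent, Matrix.one_apply, Pi.single_apply, eq_comm]
  rw [h1]
  simp [h0]
  simp [hA]

/-- Lift of a vector along the differential of `Φ`. -/
def liftVec {m : ℕ} (u v : Vec m) : Vec m := fun i => v i / (2 * u i)

lemma dPhi_liftVec {m : ℕ} {u : Vec m} (hu : ∀ i, 0 < u i) (v : Vec m) :
    dPhi m u (liftVec u v) = v := by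
  ext i
  have := (hu i).ne'
  simp only [dPhi, liftVec, LinearMap.pi_apply, LinearMap.smul_apply, LinearMap.proj_apply,
    smul_eq_mul]
  field_simp

lemma projSph_liftVec {m : ℕ} {u : Vec m} (hu : ∀ i, 0 < u i) {v : Vec m} (hv : ∑ i, v i = 0) :
    projSph m u (liftVec u v) = liftVec u v := by
  have : dotLin m u (liftVec u v) = 0 := by
    have h : ∀ i, u i * liftVec u v i = v i / 2 := fun i => by
      have := (hu i).ne'
      simp only [liftVec]
      field_simp
    simp [dotLin, h, ← Finset.sum_div, hv]
  simp [projSph, this]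

lemma sum_simplexTangent (n : ℕ) (j : Fin n) : ∑ i, simplexTangent n j i = 0 := by
  simp [simplexTangent, Fin.sum_univ_succ, Pi.single_apply]

lemma volForm_cons_liftVec {n : ℕ} {u : Vec (n + 1)} (hu : ∀ i, 0 < u i)
    (hs : u ∈ sphereSet (n + 1)) :
    0 < volForm (n + 1) (Fin.cons u fun j => liftVec u (simplexTangent n j)) := by
  have h1 : volForm (n + 1) (dPhi (n + 1) u ∘
      (Fin.cons u fun j => liftVec u (simplexTangent n j))) = 2 := by
    have : dPhi (n + 1) u ∘ (Fin.cons u fun j => liftVec u (simplexTangent n j)) =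
        Fin.cons (fun i => 2 * u i ^ 2) (simplexTangent n) := by
      ext1 i
      refine Fin.cases ?_ (fun j => ?_) i
      · ext i
        simp [dPhi]
        ring
      · simp [dPhi_liftVec hu]
    rw [this, volForm_cons_simplexTangent, ← Finset.mul_sum]
    rw [show ∑ i, u i ^ 2 = 1 from hs, mul_one]
  have h2 : LinearMap.det (dPhi (n + 1) u) = ∏ i, (2 * u i) := by
    rw [← LinearMap.det_toMatrix', ← Matrix.det_diagonal]
    congr 1
    ext i j
    simp [dPhi, LinearMap.toMatrix'_apply, Matrix.diagonal_apply, Pi.single_apply]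
  rw [volForm, Module.Basis.det_comp, h2, ← volForm] at h1
  have h3 : 0 < ∏ i, (2 * u i) := Finset.prod_pos fun i _ => by linarith [hu i]
  exact (mul_pos_iff_of_pos_left h3).mp (by rw [h1]; norm_num)

/-- At an interior point, the integrand is nonnegative, and positive where `a ≠ 0`. -/
lemma wedge_pos_at {n k : ℕ} (hk : k ≤ n)
    (a : FormOn (n + 1) (simplexSet (n + 1)) k)
    (b : FormOn (n + 1) (simplexSet (n + 1)) (n - k))
    (hat : TangentialSim (n + 1) k a)
    (hb : phiPullTS (n + 1) (n - k) b = bubbleSmul (n + 1) (n - k)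
          (castFormOn (succ_sub_one_add n k)
            (starSph (n + 1) k (phiPullTS (n + 1) k a))))
    (x : simplexSet (n + 1)) (hx : ∀ i, 0 < x.1 i) :
    let G := castFormOn (Nat.add_sub_of_le hk) (wedgeOn a b) x (simplexTangent n)
    0 ≤ G ∧ (a x ≠ 0 → 0 < G) := by
  intro G
  let u : Vec (n + 1) := fun i => √(x.1 i)
  have hu : ∀ i, 0 < u i := fun i => Real.sqrt_pos.mpr (hx i)
  have hPhi : Phi (n + 1) u = x.1 := by
    ext i
    exact Real.sq_sqrt (hx i).le
  have hs : u ∈ sphereSet (n + 1) := by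
    show ∑ i, u i ^ 2 = 1
    rw [← x.2.2]
    exact Finset.sum_congr rfl fun i _ => Real.sq_sqrt (hx i).le
  have hxe : (⟨Phi (n + 1) u, phi_mem_simplex hs⟩ : simplexSet (n + 1)) = x := Subtype.ext hPhi
  set f := (dPhi (n + 1) u).comp (projSph (n + 1) u) with hf
  set α := (a x).compLinearMap f with hα
  set β := (b x).compLinearMap f with hβ
  set w : Fin n → Vec (n + 1) := fun j => liftVec u (simplexTangent n j) with hw
  have hfw : ∀ v, ∑ i, v i = 0 → f (liftVec u v) = v := fun v hv => by
    rw [hf, LinearMap.comp_apply, projSph_liftVec hu hv, dPhi_liftVec hu]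
  have hα' : phiPullTS (n + 1) k a ⟨u, hs⟩ = α := by simp only [phiPullTS, hxe, hα, hf]
  have hβ' : phiPullTS (n + 1) (n - k) b ⟨u, hs⟩ = β := by simp only [phiPullTS, hxe, hβ, hf]
  have hb' := congrFun hb ⟨u, hs⟩
  rw [hβ'] at hb'
  have hvol := volForm_cons_liftVec hu hs
  have hG : G = wedgeAlt α β (fun i => w (finCongr (Nat.add_sub_of_le hk) i)) := by
    rw [hα, hβ, wedgeAlt_compLinearMap]
    simp only [hw, hfw _ (sum_simplexTangent n _)]
    rfl
  have huz : f u = 0 := by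
    have h1 : dotLin (n + 1) u u = 1 := by
      have : ∑ i, u i ^ 2 = 1 := hs
      simpa [dotLin, sq] using this
    simp [hf, projSph, h1]
  rw [wedgeAlt_star_frame hk u (bubble (n + 1) u) α β w hvol.ne' ?_ ?_] at hG
  · have hbub : 0 < bubble (n + 1) u := Finset.prod_pos fun i _ => hu i
    have hfac : 0 < (k.factorial : ℝ)⁻¹ := by positivity
    have hsum : 0 ≤ ∑ g : Fin k → Fin (n + 1), α (fun i => Pi.single (g i) 1) ^ 2 :=
      Finset.sum_nonneg fun _ _ => sq_nonneg _
    rw [hG]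
    refine ⟨by positivity, fun ha => ?_⟩
    have hα0 : α ≠ 0 := by
      intro h0
      apply ha
      rw [← hat x]
      ext v
      have hp : ∀ j, ∑ i, projSim (n + 1) (v j) i = 0 := by
        intro j
        have : (n + 1 : ℝ) ≠ 0 := by positivity
        simp [projSim, sumLin]
        field_simp
        ring
      have := congrArg (fun F => F fun j => liftVec u (projSim (n + 1) (v j))) h0
      simpa [hα, hfw _ (hp _)] using this
    have : 0 < ∑ g : Fin k → Fin (n + 1), α (fun i => Pi.single (g i) 1) ^ 2 := by
      refine lt_of_le_of_ne hsum fun h0 => hα0 ?_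
      rw [eq_comm, Finset.sum_eq_zero_iff_of_nonneg fun _ _ => sq_nonneg _] at h0
      refine Module.Basis.ext_alternating (Pi.basisFun ℝ (Fin (n + 1))) fun g _ => ?_
      simpa using h0 g (Finset.mem_univ _)
    positivity
  · intro v i hi
    exact (a x).map_coord_zero i (by rw [hi, huz])
  · intro s
    rw [hb']
    have hw' : ∀ j, projSph (n + 1) u (w j) = w j :=
      fun j => projSph_liftVec hu (sum_simplexTangent n j)
    change bubble (n + 1) u * starAlt (n + 1) (1 + k) (wedgeAlt (nuForm (n + 1) u)
      (phiPullTS (n + 1) k a ⟨u, hs⟩)) (fun i => projSph (n + 1) u (w (s (finCongr _ i)))) = _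
    simp only [hw', hα']
    rfl

lemma continuous_wedgeAlt {m k l : ℕ} {M : Set (Vec m)} {a : FormOn m M k} {b : FormOn m M l}
    (ha : ContFormOn m M k a) (hb : ContFormOn m M l b) : ContFormOn m M (k + l) (wedgeOn a b) := by
  intro v
  have h : (k.factorial * l.factorial : ℝ) ≠ 0 := by positivity
  have e : ∀ x, wedgeOn a b x v = (k.factorial * l.factorial : ℝ)⁻¹ *
      ∑ σ : Equiv.Perm (Fin k ⊕ Fin l), ((Equiv.Perm.sign σ : ℤ) : ℝ) *
        (a x (fun i => v (finSumFinEquiv (σ (Sum.inl i)))) *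
          b x (fun i => v (finSumFinEquiv (σ (Sum.inr i))))) := fun x => by
    rw [eq_inv_mul_iff_mul_eq₀ h, ← wedgeAlt_apply]
    rfl
  simp only [e]
  exact continuous_const.mul <| continuous_finsetSum _ fun σ _ =>
    continuous_const.mul ((ha _).mul (hb _))

lemma PL_continuous {m k : ℕ} {r : ℤ} {α : Form m k} (h : α ∈ PL m k r) (v : Fin k → Vec m) :
    Continuous fun x => α x v := by
  obtain ⟨p, -, hp⟩ := h v
  simp only [hp]
  exact MvPolynomial.continuous_eval p

lemma PLm_continuous {m k : ℕ} {r : ℤ} {α : Form m k} (h : α ∈ PLm m k r) (v : Fin k → Vec m) :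
    Continuous fun x => α x v := by
  obtain ⟨β, hβ, rfl⟩ := h
  have e : ∀ x, iU β x v = ∑ i, x i * β x (Matrix.vecCons (Pi.single i 1) v) := by
    intro x
    have hx : x = ∑ i, x i • (Pi.single i 1 : Vec m) := pi_eq_sum_univ' x
    have h5 : (β x).curryLeft x = ∑ i, x i • (β x).curryLeft (Pi.single i 1) := by
      conv_lhs => arg 2; rw [hx]
      simp only [map_sum, map_smul]
    rw [iU, h5, AlternatingMap.sum_apply_vec]
    rfl
  simp only [e]
  exact continuous_finsetSum _ fun i _ => (continuous_apply i).mul (PL_continuous hβ _)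

lemma resSim_cont {m k : ℕ} {α : Form m k} (h : ∀ v, Continuous fun x => α x v) :
    ContFormOn m (simplexSet m) k (resSim m k α) :=
  fun v => (h fun i => projSim m (v i)).comp continuous_subtype_val

lemma projSim_comp_self (m : ℕ) : (projSim m).comp (projSim m) = projSim m := by
  rcases Nat.eq_zero_or_pos m with rfl | hm
  · ext v i
    exact i.elim0
  · have hm' : (m : ℝ) ≠ 0 := by positivity
    ext v i
    simp [projSim, sumLin, hm']

lemma resSim_tangential {m k : ℕ} (α : Form m k) : TangentialSim m k (resSim m k α) := by
  intro x
  ext v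
  exact congrArg (α x.1) (funext fun i => LinearMap.congr_fun (projSim_comp_self m) (v i))

lemma dense_interior_simplex (n : ℕ) :
    Dense {x : simplexSet (n + 1) | ∀ i, 0 < x.1 i} := by
  intro x
  let p : ℝ → Vec (n + 1) := fun t i => (1 - t) * x.1 i + t * (n + 1 : ℝ)⁻¹
  have hp : ∀ t ∈ Set.Icc (0 : ℝ) 1, p t ∈ simplexSet (n + 1) := by
    intro t ht
    refine ⟨fun i => add_nonneg (mul_nonneg (by linarith [ht.2]) (x.2.1 i))
      (mul_nonneg ht.1 (by positivity)), ?_⟩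
    simp only [p, Finset.sum_add_distrib, ← Finset.mul_sum, x.2.2]
    simp
    field_simp
    ring
  have hcont : Continuous fun t : Set.Icc (0 : ℝ) 1 =>
      (⟨p t, hp t t.2⟩ : simplexSet (n + 1)) := by
    refine Continuous.subtype_mk (continuous_pi fun i => ?_) _
    fun_prop
  have h0 : (⟨p 0, hp 0 (by simp)⟩ : simplexSet (n + 1)) = x := by
    ext i
    simp [p]
  have hmem : (⟨0, by simp⟩ : Set.Icc (0 : ℝ) 1) ∈ closure {t : Set.Icc (0 : ℝ) 1 | 0 < t.1} := by
    rw [Metric.mem_closure_iff]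
    intro ε hε
    refine ⟨⟨min 1 (ε / 2), by positivity, min_le_left _ _⟩, ?_, ?_⟩
    · show 0 < min 1 (ε / 2)
      positivity
    · rw [Subtype.dist_eq, Real.dist_eq]
      have : 0 < min 1 (ε / 2) := by positivity
      have h2 : min 1 (ε / 2) ≤ ε / 2 := min_le_right _ _
      simp only [zero_sub, abs_neg]
      rw [abs_of_pos this]
      linarith
  have := map_mem_closure (t := {x : simplexSet (n + 1) | ∀ i, 0 < x.1 i}) hcont hmem ?_
  · rwa [h0] at this
  · intro t ht i
    exact add_pos_of_nonneg_of_pos (mul_nonneg (by linarith [t.2.2]) (x.2.1 i))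
      (mul_pos ht (by positivity))

lemma baseSimplex_isCompact (n : ℕ) : IsCompact (baseSimplex n) := by
  refine (isCompact_Icc (a := (0 : Fin n → ℝ)) (b := 1)).of_isClosed_subset ?_ ?_
  · refine IsClosed.and ?_ ?_
    · simp only [Set.ofPred_forall]
      exact isClosed_iInter fun j => isClosed_le continuous_const (continuous_apply j)
    · exact isClosed_le (by fun_prop) continuous_const
  · intro y hy
    refine ⟨hy.1, fun j => ?_⟩
    exact (Finset.single_le_sum (fun i _ => hy.1 i) (Finset.mem_univ j)).trans hy.2

lemma simplexParam_continuous (n : ℕ) : Continuous (simplexParam n) := by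
  refine continuous_pi fun i => ?_
  refine Fin.cases ?_ (fun j => ?_) i
  · simp only [simplexParam, Fin.cons_zero]
    fun_prop
  · simp only [simplexParam, Fin.cons_succ]
    fun_prop

/-- The integral over the simplex of a continuous form that is nonnegative, and positive at some
interior point, is positive. -/
lemma integralSimplex_pos {n : ℕ} (ω : FormOn (n + 1) (simplexSet (n + 1)) n)
    (hc : Continuous fun x => ω x (simplexTangent n)) (h0 : ∀ x, 0 ≤ ω x (simplexTangent n))
    (x : simplexSet (n + 1)) (hx : ∀ i, 0 < x.1 i) (hpos : 0 < ω x (simplexTangent n)) :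
    0 < integralSimplex n ω := by
  classical
  rw [integralSimplex]
  set F : (Fin n → ℝ) → ℝ := fun y => if h : y ∈ baseSimplex n then
    ω ⟨simplexParam n y, simplexParam_mem h⟩ (simplexTangent n) else 0 with hF
  have hFc : ContinuousOn F (baseSimplex n) := by
    rw [continuousOn_iff_continuous_domRestrict]
    have : (baseSimplex n).domRestrict F = fun y : baseSimplex n =>
        ω ⟨simplexParam n y.1, simplexParam_mem y.2⟩ (simplexTangent n) := by
      ext y
      exact dif_pos y.2
    rw [this]
    exact hc.comp (((simplexParam_continuous n).comp continuous_subtype_val).subtype_mk _)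
  have hFind : (baseSimplex n).indicator F = F := by
    refine Set.indicator_eq_self.mpr fun y hy => ?_
    by_contra h
    exact hy (by simp [hF, h])
  have hFi : Integrable F := by
    rw [← hFind, integrable_indicator_iff (baseSimplex_isCompact n).measurableSet]
    exact hFc.integrableOn_compact (baseSimplex_isCompact n)
  have hF0 : 0 ≤ F := by
    intro y
    by_cases h : y ∈ baseSimplex n
    · simpa [hF, h] using h0 _
    · simp [hF, h]
  refine (integral_pos_iff_support_of_nonneg hF0 hFi).mpr ?_
  let y : Fin n → ℝ := fun j => x.1 j.succ
  have hsum : x.1 0 + ∑ j, y j = 1 := by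
    rw [← Fin.sum_univ_succ]
    exact x.2.2
  have hparam : simplexParam n y = x.1 := by
    ext i
    refine Fin.cases ?_ (fun j => ?_) i
    · simp only [simplexParam, Fin.cons_zero]
      linarith
    · simp [simplexParam, y]
  have hy : baseSimplex n ∈ nhds y := by
    have hopen : IsOpen {z : Fin n → ℝ | (∀ j, 0 < z j) ∧ ∑ j, z j < 1} := by
      refine IsOpen.and ?_ ?_
      · simp only [Set.ofPred_forall]
        exact isOpen_iInter_of_finite fun j => isOpen_lt continuous_const (continuous_apply j)
      · exact isOpen_lt (by fun_prop) continuous_const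
    refine Filter.mem_of_superset (hopen.mem_nhds ⟨fun j => hx _, ?_⟩)
      fun z hz => ⟨fun j => (hz.1 j).le, hz.2.le⟩
    linarith [hx 0]
  have hFy : 0 < F y := by
    have hyK := mem_of_mem_nhds hy
    have : (⟨simplexParam n y, simplexParam_mem hyK⟩ : simplexSet (n + 1)) = x :=
      Subtype.ext hparam
    simpa only [hF, hyK, dif_pos, this] using hpos
  refine Measure.measure_pos_of_mem_nhds (x := y) _ ?_
  filter_upwards [(hFc.continuousAt hy).eventually (lt_mem_nhds hFy)] with z hz
  exact hz.ne'

lemma integral_wedge_pos {n k : ℕ} (hk : k ≤ n)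
    (a : FormOn (n + 1) (simplexSet (n + 1)) k)
    (b : FormOn (n + 1) (simplexSet (n + 1)) (n - k))
    (hat : TangentialSim (n + 1) k a) (hac : ContFormOn _ _ k a) (hbc : ContFormOn _ _ (n - k) b)
    (ha : a ≠ 0)
    (hb : phiPullTS (n + 1) (n - k) b = bubbleSmul (n + 1) (n - k)
          (castFormOn (succ_sub_one_add n k)
            (starSph (n + 1) k (phiPullTS (n + 1) k a)))) :
    0 < integralSimplex n (castFormOn (Nat.add_sub_of_le hk) (wedgeOn a b)) := by
  have hc : Continuous fun x => castFormOn (Nat.add_sub_of_le hk) (wedgeOn a b) x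
      (simplexTangent n) := continuous_wedgeAlt hac hbc _
  have hdense := dense_interior_simplex n
  have h0 : ∀ x, 0 ≤ castFormOn (Nat.add_sub_of_le hk) (wedgeOn a b) x
      (simplexTangent n) := by
    intro x
    have hsub : {x : simplexSet (n + 1) | ∀ i, 0 < x.1 i} ⊆ {x | 0 ≤ castFormOn
      (Nat.add_sub_of_le hk) (wedgeOn a b) x (simplexTangent n)} :=
      fun x hx => (wedge_pos_at hk a b hat hb x hx).1
    exact closure_minimal hsub (isClosed_le continuous_const hc) (hdense x)
  obtain ⟨x₀, hx₀⟩ := Function.ne_iff.mp ha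
  obtain ⟨v, hv⟩ : ∃ v, a x₀ v ≠ 0 := by
    by_contra! h
    exact hx₀ (AlternatingMap.ext h)
  obtain ⟨x, hxU, hx⟩ := hdense.inter_open_nonempty {x | a x v ≠ 0}
    (isOpen_ne_fun (hac v) continuous_const) ⟨x₀, hv⟩
  refine integralSimplex_pos _ hc h0 x hx ((wedge_pos_at hk a b hat hb x hx).2 fun h => hxU ?_)
  rw [h]
  rfl

theorem stmt5 (n k r : ℕ) (hn : 1 ≤ n) (hk : k ≤ n) :
    (∀ (a : FormOn (n + 1) (simplexSet (n + 1)) k)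
       (b : FormOn (n + 1) (simplexSet (n + 1)) (n - k)),
      a ∈ PLsim (n + 1) k (r : ℤ) → a ≠ 0 →
      b ∈ PLmosim (n + 1) (n - k) ((r : ℤ) + k + 1) →
      phiPullTS (n + 1) (n - k) b = bubbleSmul (n + 1) (n - k)
          (castFormOn (show (n + 1) - (1 + k) = n - k by omega)
            (starSph (n + 1) k (phiPullTS (n + 1) k a))) →
      0 < integralSimplex n (castFormOn (show k + (n - k) = n by omega) (wedgeOn a b))) ∧
    (1 ≤ r →
      ∀ (a : FormOn (n + 1) (simplexSet (n + 1)) k)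
        (b : FormOn (n + 1) (simplexSet (n + 1)) (n - k)),
        a ∈ PLmsim (n + 1) k (r : ℤ) → a ≠ 0 →
        b ∈ PLosim (n + 1) (n - k) ((r : ℤ) + k) →
        phiPullTS (n + 1) (n - k) b = bubbleSmul (n + 1) (n - k)
          (castFormOn (show (n + 1) - (1 + k) = n - k by omega)
            (starSph (n + 1) k (phiPullTS (n + 1) k a))) →
        0 < integralSimplex n (castFormOn (show k + (n - k) = n by omega) (wedgeOn a b))) := by
  refine ⟨?_, fun _ => ?_⟩
  · rintro a b ⟨α, hα, rfl⟩ ha ⟨⟨β, hβ, rfl⟩, -⟩ hb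
    exact integral_wedge_pos hk _ _ (resSim_tangential α) (resSim_cont (PL_continuous hα))
      (resSim_cont (PLm_continuous hβ)) ha hb
  · rintro a b ⟨α, hα, rfl⟩ ha ⟨⟨β, hβ, rfl⟩, -⟩ hb
    exact integral_wedge_pos hk _ _ (resSim_tangential α) (resSim_cont (PLm_continuous hα))
      (resSim_cont (PL_continuous hβ)) ha hb

end
end
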